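/- Let G be an almost torsion-free group with finite generating set S whose Cayley graph Γ(G,S) is δ-hyperbolic, let l ≥ 1 be an integer such that every l-generated subgroup of G is quasiconvex, and let k ≥ l+1 be an integer. Then there exists a constant C = C(G,S,k,l) with the following property: whenever g₁,…,g_k ∈ G are such that the subgroup U = ⟨g₁,…,g_k⟩ is freely indecomposable and not infinite cyclic, the tuple (g₁,…,g_k) is Nielsen-equivalent to a tuple (f₁,…,f_k) such that for some g ∈ G one has d_S(1, g⁻¹f_i g) ≤ C for all i = 1,…,l+1. -/

import Mathlib

noncomputable section

namespace KW

open Metric Set Pointwise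

variable {X : Type*} [MetricSpace X]

/-- `s` is (the image of) a unit-speed geodesic segment joining `x` to `y`. -/
def IsGeodesicSegment (s : Set X) (x y : X) : Prop :=
  ∃ (b : ℝ) (f : ℝ → X), 0 ≤ b ∧ f 0 = x ∧ f b = y ∧
    (∀ u ∈ Set.Icc (0 : ℝ) b, ∀ v ∈ Set.Icc (0 : ℝ) b, dist (f u) (f v) = |u - v|) ∧
    s = f '' Set.Icc 0 b

/-- A geodesic metric space. -/
def GeodesicSpace (X : Type*) [MetricSpace X] : Prop :=
  ∀ x y : X, ∃ s : Set X, IsGeodesicSegment s x y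

/-- `X` is `δ`-hyperbolic: geodesic, and every geodesic triangle is `δ`-thin. -/
def DeltaHyperbolic (δ : ℝ) (X : Type*) [MetricSpace X] : Prop :=
  GeodesicSpace X ∧
    ∀ (x y z : X) (s₁ s₂ s₃ : Set X),
      IsGeodesicSegment s₁ x y → IsGeodesicSegment s₂ y z → IsGeodesicSegment s₃ x z →
      ∀ p ∈ s₁, ∃ q ∈ s₂ ∪ s₃, dist p q ≤ δ

/-- `A` is an `ε`-quasiconvex subset of `X`. -/
def Quasiconvex (ε : ℝ) (A : Set X) : Prop :=
  ∀ x ∈ A, ∀ y ∈ A, ∀ s : Set X, IsGeodesicSegment s x y → ∀ p ∈ s, ∃ a ∈ A, dist p a ≤ ε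

/-- The Gromov product `(y,z)_x`. -/
def gromov (x y z : X) : ℝ := (dist y x + dist z x - dist y z) / 2

def IsGeodesicRay (γ : ℝ → X) : Prop :=
  ∀ s t : ℝ, 0 ≤ s → 0 ≤ t → dist (γ s) (γ t) = |s - t|

def IsBiGeodesic (γ : ℝ → X) : Prop :=
  ∀ s t : ℝ, dist (γ s) (γ t) = |s - t|

/-- `A` and `B` are `K`-Hausdorff close. -/
def HClose (K : ℝ) (A B : Set X) : Prop :=
  (∀ a ∈ A, ∃ b ∈ B, dist a b ≤ K) ∧ ∀ b ∈ B, ∃ a ∈ A, dist a b ≤ K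

def HausdorffClose (A B : Set X) : Prop := ∃ K : ℝ, HClose K A B

/-- Two geodesic rays are asymptotic iff their images are Hausdorff close. -/
def Asymptotic (γ γ' : ℝ → X) : Prop :=
  HausdorffClose (γ '' Set.Ici 0) (γ' '' Set.Ici 0)

def GRay (X : Type*) [MetricSpace X] : Type _ := {γ : ℝ → X // IsGeodesicRay γ}

theorem asymptotic_refl (γ : ℝ → X) : Asymptotic γ γ :=
  ⟨0, fun a ha => ⟨a, ha, by simp⟩, fun b hb => ⟨b, hb, by simp⟩⟩

theorem asymptotic_symm {γ γ' : ℝ → X} (h : Asymptotic γ γ') : Asymptotic γ' γ := by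
  obtain ⟨K, h₁, h₂⟩ := h
  refine ⟨K, fun a ha => ?_, fun b hb => ?_⟩
  · obtain ⟨b, hb, hd⟩ := h₂ a ha
    exact ⟨b, hb, by rwa [dist_comm]⟩
  · obtain ⟨a, ha, hd⟩ := h₁ b hb
    exact ⟨a, ha, by rwa [dist_comm]⟩

theorem asymptotic_trans {γ₁ γ₂ γ₃ : ℝ → X} (h : Asymptotic γ₁ γ₂)
    (h' : Asymptotic γ₂ γ₃) : Asymptotic γ₁ γ₃ := by
  obtain ⟨K, h₁, h₂⟩ := h
  obtain ⟨K', h₁', h₂'⟩ := h'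
  refine ⟨K + K', fun a ha => ?_, fun c hc => ?_⟩
  · obtain ⟨b, hb, hab⟩ := h₁ a ha
    obtain ⟨c, hc, hbc⟩ := h₁' b hb
    exact ⟨c, hc, (dist_triangle a b c).trans (by linarith)⟩
  · obtain ⟨b, hb, hbc⟩ := h₂' c hc
    obtain ⟨a, ha, hab⟩ := h₂ b hb
    exact ⟨a, ha, (dist_triangle a b c).trans (by linarith)⟩

def raySetoid (X : Type*) [MetricSpace X] : Setoid (GRay X) where
  r γ γ' := Asymptotic γ.1 γ'.1
  iseqv := ⟨fun γ => asymptotic_refl γ.1, fun h => asymptotic_symm h,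
    fun h h' => asymptotic_trans h h'⟩

/-- The (geodesic) boundary of `X`: asymptoty classes of geodesic rays. -/
def Boundary (X : Type*) [MetricSpace X] : Type _ := Quotient (raySetoid X)

def Boundary.mk {X : Type*} [MetricSpace X] (γ : GRay X) : Boundary X :=
  Quotient.mk (raySetoid X) γ

/-- A strongly geodesic metric space. -/
def StronglyGeodesic (X : Type*) [MetricSpace X] : Prop :=
  GeodesicSpace X ∧
  (∀ γ : ℝ → X, IsGeodesicRay γ → ∀ y : X,
      ∃ γ' : ℝ → X, IsGeodesicRay γ' ∧ γ' 0 = y ∧ Asymptotic γ γ') ∧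
  (∀ γ₁ γ₂ : ℝ → X, IsGeodesicRay γ₁ → IsGeodesicRay γ₂ → γ₁ 0 = γ₂ 0 →
      ¬ Asymptotic γ₁ γ₂ →
      ∃ γ : ℝ → X, IsBiGeodesic γ ∧
        HausdorffClose (Set.range γ) (γ₁ '' Set.Ici 0 ∪ γ₂ '' Set.Ici 0)) ∧
  (∀ (x : X) (u : ℕ → X),
      (∀ M : ℝ, ∃ N : ℕ, ∀ n, N ≤ n → ∀ m, N ≤ m → M ≤ gromov x (u n) (u m)) →
      ∃ γ : ℝ → X, IsGeodesicRay γ ∧ γ 0 = x ∧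
        ∀ M : ℝ, ∃ N : ℕ, ∀ n, N ≤ n → ∀ m, N ≤ m → M ≤ gromov x (γ (n : ℝ)) (u m))

/-- The sequence `u` converges to the boundary point `p`, with basepoint `x`. -/
def SeqConvTo (x : X) (u : ℕ → X) (p : Boundary X) : Prop :=
  ∃ γ : GRay X, Boundary.mk γ = p ∧
    ∀ M : ℝ, ∃ N : ℕ, ∀ n, N ≤ n → ∀ m, N ≤ m → M ≤ gromov x (u n) (γ.1 (m : ℝ))

/-- `γ` is a geodesic ray in the class of the boundary point `p`. -/
def RayTo (γ : ℝ → X) (p : Boundary X) : Prop :=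
  ∃ h : IsGeodesicRay γ, Boundary.mk ⟨γ, h⟩ = p

/-- `γ` is a biinfinite geodesic whose two ends converge to `p` and `q`. -/
def BiGeodesicJoins (γ : ℝ → X) (p q : Boundary X) : Prop :=
  IsBiGeodesic γ ∧ SeqConvTo (γ 0) (fun n => γ (-(n : ℝ))) p ∧
    SeqConvTo (γ 0) (fun n => γ (n : ℝ)) q

/-- `s` is (the image of) a geodesic joining two points of `X ∪ ∂X`. -/
def JoinSet : X ⊕ Boundary X → X ⊕ Boundary X → Set X → Prop
  | Sum.inl x, Sum.inl y, s => IsGeodesicSegment s x y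
  | Sum.inl x, Sum.inr p, s => ∃ γ : ℝ → X, γ 0 = x ∧ RayTo γ p ∧ s = γ '' Set.Ici 0
  | Sum.inr p, Sum.inl x, s => ∃ γ : ℝ → X, γ 0 = x ∧ RayTo γ p ∧ s = γ '' Set.Ici 0
  | Sum.inr p, Sum.inr q, s => ∃ γ : ℝ → X, BiGeodesicJoins γ p q ∧ s = Set.range γ

/-- The convex hull `Conv(A)` of a subset `A ⊆ X ∪ ∂X`. -/
def geoConv (A : Set (X ⊕ Boundary X)) : Set X :=
  {x | (∃ a : X, A = {Sum.inl a} ∧ x = a) ∨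
    ∃ p ∈ A, ∃ q ∈ A, p ≠ q ∧ ∃ s : Set X, JoinSet p q s ∧ x ∈ s}

/-- The distance between two subsets of `X`. -/
def setDist (A B : Set X) : ℝ := sInf (Set.image2 dist A B)

/-- `a` is a projection of `p` on `A` (relative to `δ`). -/
def IsProjection (δ : ℝ) (A : Set X) (p a : X) : Prop :=
  a ∈ A ∧ ∀ a' ∈ A, dist p a ≤ dist p a' + δ

/-- `f` restricted to `[0,L]` is a unit-speed geodesic from `x` to `y`. -/
def GeodParam (f : ℝ → X) (L : ℝ) (x y : X) : Prop :=
  0 ≤ L ∧ f 0 = x ∧ f L = y ∧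
    ∀ u ∈ Set.Icc (0 : ℝ) L, ∀ v ∈ Set.Icc (0 : ℝ) L, dist (f u) (f v) = |u - v|

/-- Concatenation of three paths, the first on `[0,a]`, the second on `[0,b]`. -/
def concat3 (f₁ f₂ f₃ : ℝ → X) (a b : ℝ) : ℝ → X := fun t =>
  if t ≤ a then f₁ t else if t ≤ a + b then f₂ (t - a) else f₃ (t - a - b)

/-- `f` is a `(lam, ε)`-quasigeodesic on `[a,b]`. -/
def QuasigeodesicOn (lam ε : ℝ) (f : ℝ → X) (a b : ℝ) : Prop :=
  ∀ s ∈ Set.Icc a b, ∀ t ∈ Set.Icc a b, |s - t| ≤ lam * dist (f s) (f t) + ε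

/-- The action of `G` on `X` is by isometries. -/
def IsometricAction (G Y : Type*) [Group G] [MetricSpace Y] [MulAction G Y] : Prop :=
  ∀ (g : G) (x y : Y), dist (g • x) (g • y) = dist x y

section GroupAction

variable {G : Type*} [Group G]

/-- The limit set `Λ(U) ⊆ ∂X` of a subgroup `U ≤ G`. -/
def limitSet (X : Type*) [MetricSpace X] [MulAction G X] (U : Subgroup G) :
    Set (Boundary X) :=
  {p | ∃ x₀ : X, ∃ u : ℕ → U, SeqConvTo x₀ (fun n => ((u n : G)) • x₀) p}

/-- The small displacement set `E(U)` (relative to `δ`). -/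
def smallDispSet (X : Type*) [MetricSpace X] [MulAction G X] (δ : ℝ) (U : Subgroup G) :
    Set X :=
  {x | ∃ u : G, u ∈ U ∧ u ≠ 1 ∧ dist x (u • x) ≤ 100 * δ}

/-- `Z(U) = Conv(Λ(U) ∪ E(U))`. -/
def ZSet (X : Type*) [MetricSpace X] [MulAction G X] (δ : ℝ) (U : Subgroup G) : Set X :=
  geoConv (Sum.inr '' limitSet X U ∪ Sum.inl '' smallDispSet X δ U)

/-- The convex hull `X(U)`: the closure of `Conv(Z(U))`. -/
def cHull (X : Type*) [MetricSpace X] [MulAction G X] (δ : ℝ) (U : Subgroup G) : Set X :=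
  closure (geoConv (Sum.inl '' ZSet X δ U))

/-- The weak convex hull `X_U = Conv(Λ(U))`. -/
def weakHull (X : Type*) [MetricSpace X] [MulAction G X] (U : Subgroup G) : Set X :=
  geoConv (Sum.inr '' limitSet X U)

/-- `l_V(g) = d(X(V), gX(V))`. -/
def lV (X : Type*) [MetricSpace X] [MulAction G X] (δ : ℝ) (V : Subgroup G) (g : G) : ℝ :=
  setDist (cHull X δ V) (g • cHull X δ V)

/-- The translation length of `g`. -/
def translationLength (X : Type*) [MetricSpace X] [MulAction G X] (g : G) : ℝ :=
  sInf (Set.range fun x : X => dist x (g • x))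

/-- The asymptotic translation length of `g`. -/
def asympTranslationLength (X : Type*) [MetricSpace X] [MulAction G X] (g : G) : ℝ :=
  Filter.liminf (fun n : ℕ => translationLength X (g ^ n) / (n : ℝ)) Filter.atTop

/-- An elementary move between `G`-tuples `(U₁,…,U_n; h₁,…,h_m)`. -/
def gMove {n m : ℕ} (M M' : (Fin n → Subgroup G) × (Fin m → G)) : Prop :=
  (M'.2 = M.2 ∧ ∃ (j : Fin n) (g : G),
      g ∈ Subgroup.closure (Set.range M.2 ∪ ⋃ i ∈ {i : Fin n | i ≠ j}, ((M.1 i : Set G))) ∧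
      (∀ i, i ≠ j → M'.1 i = M.1 i) ∧
      M'.1 j = Subgroup.map (MulAut.conj g).toMonoidHom (M.1 j)) ∨
  (M'.1 = M.1 ∧ ∃ (i : Fin m) (g₁ g₂ : G),
      g₁ ∈ Subgroup.closure (M.2 '' {j : Fin m | j ≠ i} ∪ ⋃ t, ((M.1 t : Set G))) ∧
      g₂ ∈ Subgroup.closure (M.2 '' {j : Fin m | j ≠ i} ∪ ⋃ t, ((M.1 t : Set G))) ∧
      (∀ j, j ≠ i → M'.2 j = M.2 j) ∧
      M'.2 i = g₁ * M.2 i * g₂)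

/-- Equivalence of `G`-tuples: a finite chain of elementary moves. -/
def gEquiv {n m : ℕ} :
    (Fin n → Subgroup G) × (Fin m → G) → (Fin n → Subgroup G) × (Fin m → G) → Prop :=
  Relation.ReflTransGen gMove

/-- The family of factors `U₁,…,U_n, F(h₁),…,F(h_m)`. -/
def FF {n : ℕ} (m : ℕ) (U : Fin n → Subgroup G) : Fin n ⊕ Fin m → Type _
  | Sum.inl j => ↥(U j)
  | Sum.inr _ => FreeGroup PUnit

instance ffGroup {n : ℕ} (m : ℕ) (U : Fin n → Subgroup G) :
    (i : Fin n ⊕ Fin m) → Group (FF m U i)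
  | Sum.inl j => inferInstanceAs (Group ↥(U j))
  | Sum.inr _ => inferInstanceAs (Group (FreeGroup PUnit))

def ffHoms {n m : ℕ} (U : Fin n → Subgroup G) (H : Fin m → G) :
    (i : Fin n ⊕ Fin m) → FF m U i →* G
  | Sum.inl j => (U j).subtype
  | Sum.inr j => FreeGroup.lift fun _ => H j

/-- The canonical homomorphism `U₁ ∗ ⋯ ∗ U_n ∗ F(H) → G`. -/
def freeProdHom {n m : ℕ} (U : Fin n → Subgroup G) (H : Fin m → G) :
    Monoid.CoprodI (FF m U) →* G :=
  Monoid.CoprodI.lift (ffHoms U H)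

/-- `W = U₁ ∗ ⋯ ∗ U_n ∗ F(H)`: the canonical homomorphism is injective with image `W`. -/
def IsFreeProdDecomp {n m : ℕ} (U : Fin n → Subgroup G) (H : Fin m → G)
    (W : Subgroup G) : Prop :=
  Function.Injective (freeProdHom U H) ∧ (freeProdHom U H).range = W

/-- Minimality of the `G`-pair `(V; H)` (relative to a `1`-hyperbolic `G`-space `X`). -/
def PairMinimal (X : Type*) [MetricSpace X] [MulAction G X] {m : ℕ}
    (V : Subgroup G) (H : Fin m → G) : Prop :=
  ∀ (V' : Subgroup G) (H' : Fin m → G),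
    gEquiv ((fun _ : Fin 1 => V), H) ((fun _ : Fin 1 => V'), H') →
    (∑ i, lV X 1 V (H i)) ≤ (∑ i, lV X 1 V' (H' i)) + 1

/-- An elementary Nielsen move on tuples of elements of `G`. -/
def NielsenMove {k : ℕ} (g g' : Fin k → G) : Prop :=
  (∃ i : Fin k, (∀ j, j ≠ i → g' j = g j) ∧ g' i = (g i)⁻¹) ∨
  (∃ i j : Fin k, i ≠ j ∧ (∀ t, t ≠ i → g' t = g t) ∧ g' i = g i * g j) ∨
  (∃ i j : Fin k, i ≠ j ∧ g' = g ∘ Equiv.swap i j)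

/-- Nielsen equivalence: a finite chain of elementary Nielsen moves. -/
def NielsenEq {k : ℕ} : (Fin k → G) → (Fin k → G) → Prop :=
  Relation.ReflTransGen NielsenMove

/-- Word length of `g` with respect to the (symmetrized) generating set `S`. -/
def wordLength (S : Set G) (g : G) : ℕ :=
  sInf {n : ℕ | ∃ f : Fin n → G, (∀ i, f i ∈ S ∨ (f i)⁻¹ ∈ S) ∧ (List.ofFn f).prod = g}

/-- `(X, ι)` is a model of the Cayley graph `Γ(G,S)`. -/
def IsCayleyGraph (G : Type*) [Group G] (S : Set G) (X : Type*) [MetricSpace X]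
    [MulAction G X] (ι : G → X) : Prop :=
  IsometricAction G X ∧
  (∀ g h : G, ι (g * h) = g • ι h) ∧
  Function.Injective ι ∧
  GeodesicSpace X ∧
  (∀ g h : G, dist (ι g) (ι h) = (wordLength S (g⁻¹ * h) : ℝ)) ∧
  ∀ x : X, ∃ g h : G, wordLength S (g⁻¹ * h) ≤ 1 ∧
    ∃ s : Set X, IsGeodesicSegment s (ι g) (ι h) ∧ x ∈ s

/-- `H` is a quasiconvex subgroup (with respect to the Cayley graph model `(X, ι)`). -/
def QCSubgroup (X : Type*) [MetricSpace X] (ι : G → X) (H : Subgroup G) : Prop :=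
  ∃ ε : ℝ, 0 ≤ ε ∧ Quasiconvex ε (ι '' (H : Set G))

end GroupAction

/-- Every nontrivial element of finite order has finite centralizer. -/
def AlmostTorsionFree (G : Type*) [Group G] : Prop :=
  ∀ g : G, g ≠ 1 → IsOfFinOrder g → ((Subgroup.centralizer {g} : Subgroup G) : Set G).Finite

/-- `U` is nontrivial and admits no nontrivial free product decomposition. -/
def FreelyIndecomposable (U : Type*) [Group U] : Prop :=
  Nontrivial U ∧
    ¬ ∃ A B : Subgroup U, A ≠ ⊥ ∧ B ≠ ⊥ ∧
        Function.Bijective (Monoid.Coprod.lift A.subtype B.subtype)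

def InfiniteCyclic (U : Type*) [Group U] : Prop := Infinite U ∧ IsCyclic U

def VirtuallyCyclic (U : Type*) [Group U] : Prop :=
  ∃ H : Subgroup U, H.index ≠ 0 ∧ IsCyclic ↥H

def NonElementary (U : Type*) [Group U] : Prop := ¬ Finite U ∧ ¬ VirtuallyCyclic U

end KW


namespace KW

/-- The discrete data extracted from a hyperbolic Cayley graph. -/
structure Hyp {G : Type*} [Group G] (D : G → G → ℕ) (e : ℕ) : Prop where
  self : ∀ x, D x x = 0
  eq_of : ∀ x y, D x y = 0 → x = y
  symm : ∀ x y, D x y = D y x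
  tri : ∀ x y z, D x z ≤ D x y + D y z
  inv : ∀ g x y, D (g * x) (g * y) = D x y
  mid : ∀ x y t, t ≤ D x y → ∃ z, D x z = t ∧ D z y + t = D x y
  four : ∀ x y z w, D x y + D z w ≤ D x z + D y w + e ∨ D x y + D z w ≤ D x w + D y z + e
  ball : ∀ r, {x | D 1 x ≤ r}.Finite
  atf : AlmostTorsionFree G

section basic
variable {G : Type*}

/-- `z` lies on a geodesic from `x` to `y`. -/
def Btw (D : G → G → ℕ) (x z y : G) : Prop := D x z + D z y = D x y

/-- Discrete quasiconvexity. -/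
def QC (D : G → G → ℕ) (ε : ℕ) (A : Set G) : Prop :=
  ∀ a ∈ A, ∀ b ∈ A, ∀ z, Btw D a z b → ∃ a' ∈ A, D z a' ≤ ε

def Nearest (D : G → G → ℕ) (A : Set G) (x a : G) : Prop := a ∈ A ∧ ∀ a' ∈ A, D x a ≤ D x a'

/-- twice the Gromov product of `x` and `y` at `m` is at least `B`. -/
def GP (D : G → G → ℕ) (m x y : G) (B : ℕ) : Prop := D x y + B ≤ D m x + D m y

variable [Group G] {D : G → G → ℕ} {e : ℕ} (H : Hyp D e)
include H

theorem Hyp.btw_symm {x z y : G} (h : Btw D x z y) : Btw D y z x := by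
  unfold Btw at *
  have := H.symm x z; have := H.symm z y; have := H.symm x y; omega

theorem Hyp.btw_inv {x z y : G} (g : G) : Btw D (g * x) (g * z) (g * y) ↔ Btw D x z y := by
  unfold Btw; rw [H.inv, H.inv, H.inv]

theorem Hyp.gp_inv {m x y : G} {B : ℕ} (g : G) :
    GP D (g * m) (g * x) (g * y) B ↔ GP D m x y B := by
  unfold GP; rw [H.inv, H.inv, H.inv]

theorem Hyp.gp_symm {m x y : G} {B : ℕ} (h : GP D m x y B) : GP D m y x B := by
  unfold GP at *
  have := H.symm x y; omega

theorem Hyp.gp_trans {m x y z : G} {B C : ℕ} (h : GP D m x y (B + e)) (h' : GP D m y z (B + e))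
    (hC : C ≤ B) : GP D m x z C := by
  unfold GP at *
  have := H.symm m x; have := H.symm m y; have := H.symm m z
  have := H.symm x y; have := H.symm y z; have := H.symm x z
  rcases H.four x z y m with h | h <;> omega

theorem Hyp.exists_btw (x y : G) (t : ℕ) (h : t ≤ D x y) : ∃ z, Btw D x z y ∧ D x z = t := by
  obtain ⟨z, h1, h2⟩ := H.mid x y t h
  exact ⟨z, by unfold Btw; omega, h1⟩

/-- half of a thin triangle -/
theorem Hyp.guide {y y' p z u : G} (hg : GP D y y' p (2 * D y z)) (hz : Btw D y z p)
    (hu : Btw D y u y') (h : D y u = D y z) : D z u ≤ 2 * e := by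
  by_cases hh : D y z ≤ e
  · have := H.tri z y u; have := H.symm z y; omega
  have h1 : GP D y z p (2 * D y z) := by
    unfold GP Btw at *; omega
  have h2 : GP D y y' u (2 * D y z) := by
    unfold GP Btw at *; have := H.symm y' u; omega
  have h3 : GP D y z y' (2 * D y z - e) :=
    H.gp_trans (B := 2 * D y z - e) (by rwa [Nat.sub_add_cancel (by omega)])
      (H.gp_symm (by rwa [Nat.sub_add_cancel (by omega)])) le_rfl
  have h4 : GP D y z u (2 * D y z - 2 * e) := by
    refine H.gp_trans (B := 2 * D y z - 2 * e) (y := y') ?_ ?_ le_rfl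
    · unfold GP at *; omega
    · unfold GP at *; omega
  unfold GP at h4; omega

theorem Hyp.thin {x u y : G} (w : G) (h : Btw D x u y) :
    ∃ u', (Btw D x u' w ∨ Btw D w u' y) ∧ D u u' ≤ 2 * e := by
  by_cases hc : GP D x w y (2 * D x u)
  · have : D x u ≤ D x w := by
      unfold GP at hc; have := H.tri x w y; omega
    obtain ⟨u', h1, h2⟩ := H.exists_btw x w _ this
    exact ⟨u', Or.inl h1, H.guide hc h h1 h2⟩
  · have hc' : GP D y w x (2 * D y u) := by
      unfold GP Btw at *
      have := H.symm x y; have := H.symm y u; have := H.symm w y; have := H.symm x w; omega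
    have : D y u ≤ D y w := by
      unfold GP at hc'; have := H.tri y w x; omega
    obtain ⟨u', h1, h2⟩ := H.exists_btw y w _ this
    exact ⟨u', Or.inr (H.btw_symm h1), H.guide hc' (H.btw_symm h) h1 h2⟩

/-- projection constant -/
def c1 (e ε : ℕ) : ℕ := 2 * e + 2 * ε + 2
def c2 (e ε : ℕ) : ℕ := 2 * c1 e ε + e

theorem Hyp.proj1 {ε : ℕ} {A : Set G} (hA : QC D ε A) {x a b : G} (ha : Nearest D A x a)
    (hb : b ∈ A) : D x a + D a b ≤ D x b + c1 e ε := by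
  set g := D x a + D a b - D x b with hg
  have h0 := H.tri x b a; have h0' := H.symm a b
  obtain ⟨p, hp1, hp2⟩ := H.mid a b (g / 2) (by omega)
  obtain ⟨a', ha', hpa⟩ := hA a ha.1 b hb p (by unfold Btw; omega)
  have h1 := ha.2 a' ha'
  have h2 := H.tri x p a'
  have h3 := H.symm p a
  unfold c1
  rcases H.four x p a b with h | h <;> omega

theorem Hyp.proj2 {ε : ℕ} {A : Set G} (hA : QC D ε A) {x y a b : G} (ha : Nearest D A x a)
    (hb : Nearest D A y b) :
    D x a + D a b + D b y ≤ D x y + c2 e ε ∨ D a b ≤ c1 e ε + e := by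
  have h1 := H.proj1 hA ha hb.1
  have h2 := H.proj1 hA hb ha.1
  have := H.symm b a; have := H.symm y b; have := H.symm y a
  have := H.symm b y; have := H.symm a y
  unfold c2
  rcases H.four x b a y with h | h <;> omega

theorem Hyp.nearest_exists {A : Set G} (hA : A.Nonempty) (x : G) : ∃ a, Nearest D A x a := by
  obtain ⟨a, ha, h⟩ := exists_minimalFor_of_wellFoundedLT (· ∈ A) (fun a => D x a) hA
  refine ⟨a, ha, fun a' ha' => ?_⟩
  by_contra hc
  exact hc (h ha' (show D x a' ≤ D x a by omega))

theorem Hyp.nearest_inv {A : Set G} {x a : G} (v : G) (hv : ∀ y ∈ A, v * y ∈ A)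
    (hv' : ∀ y ∈ A, v⁻¹ * y ∈ A) (h : Nearest D A x a) : Nearest D A (v * x) (v * a) := by
  refine ⟨hv _ h.1, fun a' ha' => ?_⟩
  have := h.2 _ (hv' _ ha')
  rw [← H.inv v x, ← H.inv v x] at this
  simpa using this

theorem Hyp.local_qc {ε1 : ℕ} {A : Set G}
    (hloc : ∀ y ∈ A, ∀ p ∈ A, ∀ z, Btw D y z p → D y z ≤ e + ε1 + 1 → ∃ w ∈ A, D z w ≤ ε1) :
    QC D (2 * (e + ε1 + 1)) A := by
  intro p hp q hq z hz
  obtain ⟨y, hy⟩ := H.nearest_exists ⟨p, hp⟩ z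
  have key : ∀ p ∈ A, ¬ GP D y p z (2 * (e + ε1 + 1)) := by
    intro p hp hc
    have : e + ε1 + 1 ≤ D y p := by
      unfold GP at hc; have := H.tri y p z; omega
    obtain ⟨z1, h1, h2⟩ := H.exists_btw y p _ this
    obtain ⟨w, hw, hzw⟩ := hloc y hy.1 p hp z1 h1 (by omega)
    have h3 := hy.2 w hw
    have h4 : GP D y z1 z (2 * (e + ε1 + 1) - e) := by
      refine H.gp_trans (B := 2 * (e + ε1 + 1) - e) (y := p) ?_ ?_ le_rfl
      · unfold GP Btw at *; omega
      · unfold GP at *; omega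
    unfold GP at h4
    have := H.tri z z1 w; have := H.symm z z1; have := H.symm z y
    omega
  have k1 := key p hp
  have k2 := key q hq
  refine ⟨y, hy.1, ?_⟩
  unfold GP Btw at *
  have := H.tri p y q; have := H.symm p y; have := H.symm z y; have := H.symm z q
  omega

end basic
end KW

namespace KW
section lemA
variable {G : Type*} [Group G] {D : G → G → ℕ} {e : ℕ} (H : Hyp D e)
include H

theorem Hyp.D_one (x y : G) : D x y = D 1 (x⁻¹ * y) := by
  rw [← H.inv x 1 (x⁻¹ * y)]; simp

/-- Lemma A, element of infinite order. -/
theorem Hyp.lemA_inf (ε K : ℕ) : ∃ T : ℕ, ∀ (A : Set G) (v x a : G), QC D ε A →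
    (∀ n : ℕ, ∀ y ∈ A, v ^ n * y ∈ A ∧ (v ^ n)⁻¹ * y ∈ A) → ¬ IsOfFinOrder v →
    D x (v * x) ≤ K → Nearest D A x a → D x a ≤ T := by
  set Bl := (H.ball (c1 e ε + e)).toFinset with hBl
  refine ⟨Bl.card * K + c2 e ε, fun A v x a hA hv hinf hK ha => ?_⟩
  have hn : ∀ n : ℕ, D x (v ^ n * x) ≤ n * K := by
    intro n
    induction n with
    | zero => simp [H.self]
    | succ n ih =>
      have h1 := H.tri x (v ^ n * x) (v ^ (n + 1) * x)
      have h2 : D (v ^ n * x) (v ^ (n + 1) * x) = D x (v * x) := by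
        rw [pow_succ, mul_assoc, H.inv]
      rw [Nat.succ_mul]; omega
  have hex : ∃ n ∈ Finset.range (Bl.card + 1), a⁻¹ * v ^ n * a ∉ Bl := by
    by_contra hcon
    push Not at hcon
    obtain ⟨i, hi, j, hj, hij, heq⟩ := Finset.exists_ne_map_eq_of_card_lt_of_maps_to
      (s := Finset.range (Bl.card + 1)) (t := Bl) (by simp) (f := fun n => a⁻¹ * v ^ n * a)
      (fun n hn => hcon n (by simpa using hn))
    have h1 : v ^ i = v ^ j := by simpa using heq
    exact hij ((injective_pow_iff_not_isOfFinOrder.2 hinf) h1)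
  obtain ⟨n, hn1, hn2⟩ := hex
  have h3 : ¬ D a (v ^ n * a) ≤ c1 e ε + e := by
    rw [H.D_one, ← mul_assoc]
    simpa [hBl] using hn2
  have h4 := H.proj2 hA ha (H.nearest_inv (v ^ n) (fun y hy => (hv n y hy).1)
    (fun y hy => (hv n y hy).2) ha)
  have h5 := hn n
  have h6 : n * K ≤ Bl.card * K := Nat.mul_le_mul_right _ (by simp at hn1; omega)
  rcases h4 with h4 | h4 <;> omega

/-- Lemma A, element of finite order. -/
theorem Hyp.lemA_fin (ε K : ℕ) : ∃ T : ℕ, ∀ (A : Set G) (v x a : G), QC D ε A →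
    (∀ y ∈ A, v * y ∈ A ∧ v⁻¹ * y ∈ A) → IsOfFinOrder v → v ≠ 1 →
    D x (v * x) ≤ K → Nearest D A x a → D x a ≤ T := by
  set K' := c1 e ε + e + K + e with hK'
  set Bl := (H.ball K').toFinset with hBl
  have hR : ∃ R : ℕ, ∀ s ∈ Bl, s ≠ 1 → IsOfFinOrder s → ∀ u, u * s = s * u → D 1 u ≤ R := by
    have : ∀ s : G, ∃ R : ℕ, s ≠ 1 → IsOfFinOrder s → ∀ u, u * s = s * u → D 1 u ≤ R := by
      intro s
      by_cases h : s ≠ 1 ∧ IsOfFinOrder s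
      · have hf := H.atf s h.1 h.2
        obtain ⟨R, hR⟩ := (hf.image (fun u => D 1 u)).bddAbove
        refine ⟨R, fun _ _ u hu => hR ⟨u, ?_, rfl⟩⟩
        simp only [SetLike.mem_coe, Subgroup.mem_centralizer_iff, Set.mem_singleton_iff]
        rintro _ rfl
        exact hu.symm
      · exact ⟨0, fun h1 h2 => absurd ⟨h1, h2⟩ h⟩
    choose R hR using this
    refine ⟨Bl.sup R, fun s hs h1 h2 u hu => (hR s h1 h2 u hu).trans (Finset.le_sup hs)⟩
  obtain ⟨R, hR⟩ := hR
  refine ⟨K + c2 e ε + (Bl.card + 1) * (R + 1), fun A v x a hA hv hfin hv1 hK ha => ?_⟩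
  have h4 := H.proj2 hA ha (H.nearest_inv v (fun y hy => (hv y hy).1)
    (fun y hy => (hv y hy).2) ha)
  rcases h4 with h4 | h4
  · omega
  by_contra hbig
  have hlen : (Bl.card + 1) * (R + 1) ≤ D a x := by
    have := H.symm a x; omega
  have hy : ∀ t : ℕ, ∃ y, t ≤ D a x → D a y = t ∧ D y x + t = D a x := by
    intro t
    by_cases h : t ≤ D a x
    · obtain ⟨y, hy⟩ := H.mid a x t h
      exact ⟨y, fun _ => hy⟩
    · exact ⟨1, fun h' => absurd h' h⟩
  choose y hy using hy
  have hmv : ∀ t ≤ D a x, (y t)⁻¹ * v * y t ∈ Bl := by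
    intro t ht
    obtain ⟨h1, h2⟩ := hy t ht
    have h3 : D (y t) (v * y t) ≤ K' := by
      have e1 := H.inv v a x
      have e2 := H.inv v (y t) x
      have e3 := H.inv v a (y t)
      have e4 := H.tri (y t) a (v * a)
      have e5 := H.tri (y t) x (v * x)
      have := H.symm (y t) a
      have := H.symm (v * y t) (v * a)
      rcases H.four (y t) (v * y t) (v * a) (v * x) with h | h <;> omega
    rw [H.D_one, ← mul_assoc] at h3
    simpa [hBl] using h3
  have hle : ∀ i ∈ Finset.range (Bl.card + 1), i * (R + 1) ≤ D a x := by
    intro i hi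
    simp at hi
    exact (Nat.mul_le_mul_right _ (by omega)).trans hlen
  obtain ⟨i, hi, j, hj, hij, heq⟩ := Finset.exists_ne_map_eq_of_card_lt_of_maps_to
      (s := Finset.range (Bl.card + 1)) (t := Bl) (by simp)
      (f := fun i => (y (i * (R + 1)))⁻¹ * v * y (i * (R + 1)))
      (fun n hn => hmv _ (hle n (by simpa using hn)))
  set p := y (i * (R + 1)) with hp
  set q := y (j * (R + 1)) with hq
  have hc : D 1 (p⁻¹ * q) ≤ R := by
    refine hR (p⁻¹ * v * p) (hmv _ (hle i hi)) ?_ ?_ _ ?_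
    · intro h
      apply hv1
      have : v = p * (p⁻¹ * v * p) * p⁻¹ := by group
      rw [this, h]; group
    · have : p⁻¹ * v * p = MulAut.conj p⁻¹ v := by simp
      rw [this]
      exact (MulAut.conj p⁻¹).toMonoidHom.isOfFinOrder hfin
    · calc p⁻¹ * q * (p⁻¹ * v * p) = p⁻¹ * q * (q⁻¹ * v * q) := by rw [heq]
        _ = p⁻¹ * v * p * (p⁻¹ * q) := by group
  rw [← H.D_one] at hc
  have e1 := (hy _ (hle i hi)).1
  have e2 := (hy _ (hle j hj)).1
  rw [← hp] at e1
  rw [← hq] at e2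
  have e3 := H.tri a p q
  have e4 := H.tri a q p
  have := H.symm p q
  rcases lt_or_gt_of_ne hij with h | h
  · have : (i + 1) * (R + 1) ≤ j * (R + 1) := Nat.mul_le_mul_right _ h
    rw [Nat.succ_mul] at this; omega
  · have : (j + 1) * (R + 1) ≤ i * (R + 1) := Nat.mul_le_mul_right _ h
    rw [Nat.succ_mul] at this; omega

/-- `A` is invariant under the subgroup `V`. -/
def Inv (V : Subgroup G) (A : Set G) : Prop := ∀ v ∈ V, ∀ y ∈ A, v * y ∈ A

theorem Hyp.lemA (ε K : ℕ) : ∃ T : ℕ, ∀ (V : Subgroup G) (A : Set G) (v x a : G), QC D ε A →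
    Inv V A → v ∈ V → v ≠ 1 → D x (v * x) ≤ K → Nearest D A x a → D x a ≤ T := by
  obtain ⟨T1, h1⟩ := H.lemA_inf ε K
  obtain ⟨T2, h2⟩ := H.lemA_fin ε K
  refine ⟨T1 + T2, fun V A v x a hA hV hv hv1 hK ha => ?_⟩
  by_cases hf : IsOfFinOrder v
  · have := h2 A v x a hA (fun y hy => ⟨hV v hv y hy, hV _ (V.inv_mem hv) y hy⟩) hf hv1 hK ha
    omega
  · have := h1 A v x a hA (fun n y hy => ⟨hV _ (V.pow_mem hv n) y hy,
      hV _ (V.inv_mem (V.pow_mem hv n)) y hy⟩) hf hK ha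
    omega
end lemA
end KW

namespace KW
section star
variable {G : Type*} [Group G] {D : G → G → ℕ} {e : ℕ}

def eps1 (e ε : ℕ) : ℕ := ε + 6 * e
def rr (e ε : ℕ) : ℕ := 2 * ε + 16 * e + 4
def BB (e ε : ℕ) : ℕ := rr e ε + 3 * e
def epsQ (e ε : ℕ) : ℕ := 2 * (e + eps1 e ε + 1)

/-- A quasiconvex set with a separated family of bridges. -/
structure Star (D : G → G → ℕ) (e ε : ℕ) (A : Set G) {J : Type*} (a m o : J → G) : Prop where
  qc : QC D ε A
  near : ∀ j, Nearest D A (m j) (a j)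
  btw : ∀ j, Btw D (a j) (m j) (o j)
  sep : ∀ i j, i ≠ j → GP D (m i) (a i) (m j) (BB e ε)
  long : ∀ j, BB e ε + c1 e ε ≤ 2 * D (m j) (a j)

/-- the far side of a bridge -/
def Far (D : G → G → ℕ) (r : ℕ) (m o : G) : Set G := {x | Btw D m x o ∨ GP D m x o r}

variable (H : Hyp D e)
include H

theorem Hyp.far_inv {r : ℕ} {m o x : G} (g : G) (h : x ∈ Far D r m o) :
    g * x ∈ Far D r (g * m) (g * o) := by
  rcases h with h | h
  · exact Or.inl ((H.btw_inv g).2 h)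
  · exact Or.inr ((H.gp_inv g).2 h)

theorem Hyp.far_inv_iff {r : ℕ} {m o x : G} (g : G) :
    g * x ∈ Far D r (g * m) (g * o) ↔ x ∈ Far D r m o := by
  unfold Far
  simp only [Set.mem_ofPred_eq, H.btw_inv, H.gp_inv]

theorem Hyp.far_le {r : ℕ} (hr : e + 1 ≤ r) {a m o x : G} (hb : Btw D a m o)
    (hx : x ∈ Far D r m o) : D m x + D m a ≤ D x a + e := by
  have := H.symm a m; have := H.symm a x; have := H.symm x o; have := H.symm a o
  have := H.symm m o; have := H.symm m x
  rcases hx with hx | hx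
  · unfold Btw at *
    have := H.tri a x o; omega
  · unfold Btw GP at *
    rcases H.four a o x m with h | h <;> omega

theorem Hyp.btw_sub {a m o x : G} (h : Btw D a m o) (hx : Btw D a x m) : Btw D a x o := by
  unfold Btw at *
  have := H.tri a x o; have := H.tri x m o; omega

variable {ε : ℕ} {A : Set G} {J : Type*} {a m o : J → G} (St : Star D e ε A a m o)
include St

theorem Hyp.star_a {x : G} (hx : x ∈ A) (j : J) : GP D (m j) x (a j) (BB e ε) := by
  have h1 := H.proj1 St.qc (St.near j) hx
  have h2 := St.long j
  have := H.symm (a j) x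
  unfold GP; omega

theorem Hyp.star_b {x : G} {i j : J} (hij : i ≠ j) (hx : Btw D (a i) x (m i)) :
    GP D (m j) x (a j) (rr e ε) := by
  have h1 := H.star_a St (St.near i).1 j
  have h2 := H.gp_symm (St.sep j i hij.symm)
  have g : GP D (m j) (a i) (m i) (BB e ε - e) :=
    H.gp_trans (B := BB e ε - e) (y := a j) (by unfold GP BB rr at *; omega)
      (by have := H.gp_symm h2; unfold GP BB rr at *; omega) le_rfl
  have hh : GP D (m j) x (m i) (BB e ε - e) ∨ GP D (m j) x (a i) (BB e ε - e) := by
    unfold GP Btw at *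
    have := H.tri (m j) x (a i)
    have := H.tri (m j) x (m i)
    have := H.symm x (a i)
    omega
  rcases hh with hh | hh
  · exact H.gp_trans (B := BB e ε - 2 * e) (y := m i) (by unfold GP BB rr at *; omega)
      (by unfold GP BB rr at *; omega) (by unfold BB rr; omega)
  · exact H.gp_trans (B := BB e ε - 2 * e) (y := a i) (by unfold GP BB rr at *; omega)
      (by unfold GP BB rr at *; omega) (by unfold BB rr; omega)

theorem Hyp.star_f {x : G} {i j : J} (hij : i ≠ j) (hx : x ∈ Far D (rr e ε) (m i) (o i)) :
    GP D (m j) x (a j) (rr e ε) := by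
  have h0 := H.far_le (by unfold rr; omega) (St.btw i) hx
  have h1 := H.gp_symm (St.sep i j hij)
  have h2 := H.gp_symm (St.sep j i hij.symm)
  have h3 : D (m i) x + D (m i) (m j) ≤ D x (m j) + 2 * e := by
    unfold GP at h1
    have := H.symm (a i) (m i); have := H.symm (m j) (m i); have := H.symm (m j) (a i)
    have : 2 * e + 1 ≤ BB e ε := by unfold BB rr; omega
    rcases H.four x (a i) (m j) (m i) with h | h
    · have := H.symm x (m j); have := H.symm x (m i); omega
    · have := H.symm x (m j); have := H.symm x (m i); have := H.symm (a i) (m j); omega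
  refine H.gp_trans (B := rr e ε) (y := m i) ?_ ?_ le_rfl
  · unfold GP BB at *
    have := H.symm x (m j); have := H.symm (m i) (m j); have := H.symm x (m i)
    have := H.tri (m j) (m i) (a j)
    omega
  · unfold GP BB at *; omega

/-- The near side: the set together with half bridges. -/
def NearSide (D : G → G → ℕ) (A : Set G) {J : Type*} (a m : J → G) : Set G :=
  {x | x ∈ A ∨ ∃ j, Btw D (a j) x (m j)}

theorem Hyp.star_near {Â : Set G} (hÂ : A ⊆ Â) 
    (hÂ' : ∀ j x, Btw D (a j) x (m j) ∨ Btw D (m j) x (o j) → x ∈ Â)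
    {x y u : G} (hx : x ∈ NearSide D A a m) (hy : y ∈ NearSide D A a m) (hu : Btw D x u y) :
    ∃ w ∈ Â, D u w ≤ ε + 4 * e := by
  obtain ⟨x', hx'A, hx'⟩ : ∃ x' ∈ A, ∀ z, Btw D x z x' → z ∈ Â := by
    rcases hx with hx | ⟨i, hi⟩
    · refine ⟨x, hx, fun z hz => ?_⟩
      have : x = z := by
        apply H.eq_of; unfold Btw at hz; have := H.self x; omega
      exact this ▸ hÂ hx
    · refine ⟨a i, (St.near i).1, fun z hz => hÂ' i z (Or.inl ?_)⟩
      exact H.btw_sub hi (H.btw_symm hz)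
  obtain ⟨y', hy'A, hy'⟩ : ∃ y' ∈ A, ∀ z, Btw D y' z y → z ∈ Â := by
    rcases hy with hy | ⟨i, hi⟩
    · refine ⟨y, hy, fun z hz => ?_⟩
      have : y = z := by
        apply H.eq_of; unfold Btw at hz; have := H.self y; have := H.symm y z; omega
      exact this ▸ hÂ hy
    · refine ⟨a i, (St.near i).1, fun z hz => hÂ' i z (Or.inl ?_)⟩
      exact H.btw_sub hi hz
  obtain ⟨u1, h1 | h1, hd1⟩ := H.thin x' hu
  · exact ⟨u1, hx' _ h1, by omega⟩
  obtain ⟨u2, h2 | h2, hd2⟩ := H.thin y' h1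
  · obtain ⟨w, hw, hd3⟩ := St.qc x' hx'A y' hy'A u2 h2
    have := H.tri u u1 u2; have := H.tri u u2 w
    exact ⟨w, hÂ hw, by omega⟩
  · have := H.tri u u1 u2
    exact ⟨u2, hy' _ h2, by omega⟩

theorem Hyp.star_local {Â : Set G} (hÂ : A ⊆ Â) 
    (hÂ' : ∀ j x, Btw D (a j) x (m j) ∨ Btw D (m j) x (o j) → x ∈ Â)
    {y p z : G} (hy : y ∈ NearSide D A a m)
    (hp : p ∈ NearSide D A a m ∨ ∃ j, p ∈ Far D (rr e ε) (m j) (o j))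
    (hz : Btw D y z p) (hz' : D y z ≤ e + eps1 e ε + 1) : ∃ w ∈ Â, D z w ≤ eps1 e ε := by
  rcases hp with hp | ⟨i, hp⟩
  · obtain ⟨w, hw, h⟩ := H.star_near St hÂ hÂ' hy hp hz
    exact ⟨w, hw, by unfold eps1; omega⟩
  by_cases hg : GP D (m i) y (a i) (rr e ε)
  · have h0 := H.far_le (by unfold rr; omega) (St.btw i) hp
    have h3 : D (m i) y + D (m i) p ≤ D y p + 2 * e := by
      unfold GP at hg
      have : 2 * e + 1 ≤ rr e ε := by unfold rr; omega
      have := H.symm (a i) (m i)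
      have := H.symm p y; have := H.symm p (m i); have := H.symm (a i) y
      have := H.symm y (m i)
      rcases H.four p (a i) y (m i) with h | h <;> omega
    have hgp : GP D y (m i) p (2 * D y z) := by
      unfold GP at *
      have := H.symm (m i) y; have := H.tri (m i) y (a i)
      unfold rr eps1 at *; omega
    have : D y z ≤ D y (m i) := by
      unfold GP at hgp; have := H.tri y (m i) p; omega
    obtain ⟨u, hu1, hu2⟩ := H.exists_btw y (m i) _ this
    have hzu := H.guide hgp hz hu1 hu2
    have hmi : m i ∈ NearSide D A a m := Or.inr ⟨i, by unfold Btw; rw [H.self]; omega⟩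
    obtain ⟨w, hw, h⟩ := H.star_near St hÂ hÂ' hy hmi hu1
    have := H.tri z u w
    exact ⟨w, hw, by unfold eps1; omega⟩
  · rcases hy with hy | ⟨j, hj⟩
    · exact absurd (H.star_a St hy i) (by unfold GP BB at *; omega)
    · by_cases hij : j = i
      · subst hij
        have hb := St.btw j
        rcases hp with hp | hp
        · obtain ⟨u, hu | hu, hd⟩ := H.thin (m j) hz
          · refine ⟨u, hÂ' j u (Or.inl ?_), by unfold eps1; omega⟩
            exact H.btw_symm (H.btw_sub (H.btw_symm hj) (H.btw_symm hu))
          · exact ⟨u, hÂ' j u (Or.inr (H.btw_sub hp hu)), by unfold eps1; omega⟩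
        · have hgp : GP D y (o j) p (2 * D y z) := by
            unfold GP Btw at *
            have := H.symm (m j) y; have := H.symm (o j) p
            have := H.symm (m j) p
            have := H.tri (a j) y (o j)
            have := H.tri y (m j) (o j)
            have := H.symm (o j) y
            unfold rr eps1 at *
            rcases H.four y (o j) p (m j) with h | h
            · have := H.symm (o j) (m j); omega
            · omega
          have : D y z ≤ D y (o j) := by
            unfold GP at hgp; have := H.tri y (o j) p; omega
          obtain ⟨u, hu1, hu2⟩ := H.exists_btw y (o j) _ this
          have hzu := H.guide hgp hz hu1 hu2
          obtain ⟨w, hw | hw, hd⟩ := H.thin (m j) hu1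
          · have := H.tri z u w
            refine ⟨w, hÂ' j w (Or.inl ?_), by unfold eps1; omega⟩
            exact H.btw_symm (H.btw_sub (H.btw_symm hj) (H.btw_symm hw))
          · have := H.tri z u w
            exact ⟨w, hÂ' j w (Or.inr hw), by unfold eps1; omega⟩
      · exact absurd (H.star_b St hij hj) hg
end star

section sep
variable {G : Type*} [Group G] {D : G → G → ℕ} {e : ℕ} (H : Hyp D e)
include H

def KK (e ε : ℕ) : ℕ := BB e ε + c1 e ε + e + 1

theorem Hyp.sep_aux {ε : ℕ} {A : Set G} (hA : QC D ε A) {a m a' m' : G}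
    (ha : Nearest D A m a) (ha' : Nearest D A m' a')
    (hR : D m' a' ≤ D m a + 1) (hK : KK e ε < D m m')
    (hl : BB e ε + c2 e ε + 1 ≤ 2 * D m a) : GP D m a m' (BB e ε) := by
  unfold GP
  have := H.tri a a' m'; have := H.symm a' m'
  unfold KK at hK
  rcases H.proj2 hA ha ha' with h | h <;> omega
end sep
end KW

namespace KW
section red
open Monoid Monoid.Coprod
variable {G : Type*} [Group G] {P Q : Subgroup G}

/-- reduced words in a free product -/
inductive Red (P Q : Subgroup G) : Option Bool → Coprod P Q → Prop
  | one : Red P Q none 1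
  | left (p : P) (c : Coprod P Q) (s : Option Bool) (hp : p ≠ 1) (hs : s ≠ some true)
      (h : Red P Q s c) : Red P Q (some true) (inl p * c)
  | right (q : Q) (c : Coprod P Q) (s : Option Bool) (hp : q ≠ 1) (hs : s ≠ some false)
      (h : Red P Q s c) : Red P Q (some false) (inr q * c)

theorem Red.exists (w : Coprod P Q) : ∃ s, Red P Q s w := by
  induction w using Coprod.induction_on' with
  | one => exact ⟨_, Red.one⟩
  | inl_mul p c ih =>
    obtain ⟨s, hs⟩ := ih
    by_cases hp : p = 1
    · subst hp; exact ⟨s, by simpa using hs⟩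
    cases hs with
    | one => exact ⟨_, Red.left p 1 none hp (by simp) Red.one⟩
    | left p' c' s' hp' hs' h =>
      rw [← mul_assoc, ← map_mul]
      by_cases hpp : p * p' = 1
      · rw [hpp]; exact ⟨s', by simpa using h⟩
      · exact ⟨_, Red.left _ c' s' hpp hs' h⟩
    | right q c' s' hq hs' h =>
      exact ⟨_, Red.left p _ (some false) hp (by simp) (Red.right q c' s' hq hs' h)⟩
  | inr_mul p c ih =>
    obtain ⟨s, hs⟩ := ih
    by_cases hp : p = 1
    · subst hp; exact ⟨s, by simpa using hs⟩
    cases hs with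
    | one => exact ⟨_, Red.right p 1 none hp (by simp) Red.one⟩
    | right p' c' s' hp' hs' h =>
      rw [← mul_assoc, ← map_mul]
      by_cases hpp : p * p' = 1
      · rw [hpp]; exact ⟨s', by simpa using h⟩
      · exact ⟨_, Red.right _ c' s' hpp hs' h⟩
    | left q c' s' hq hs' h =>
      exact ⟨_, Red.right p _ (some true) hp (by simp) (Red.left q c' s' hq hs' h)⟩

variable {C Xl Xr : Set G}
  (hl : ∀ p ∈ P, p ≠ 1 → ∀ x, x ∈ C ∨ x ∈ Xr → p * x ∈ Xl)
  (hr : ∀ q ∈ Q, q ≠ 1 → ∀ x, x ∈ C ∨ x ∈ Xl → q * x ∈ Xr)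
include hl hr

theorem Red.sem {s : Option Bool} {w : Coprod P Q} (h : Red P Q s w) :
    (s = none → w = 1) ∧
    (s = some true → ∀ x ∈ C, Coprod.lift P.subtype Q.subtype w * x ∈ Xl) ∧
    (s = some false → ∀ x ∈ C, Coprod.lift P.subtype Q.subtype w * x ∈ Xr) := by
  induction h with
  | one => simp
  | left p c s hp hs h ih =>
    refine ⟨by simp, fun _ x hx => ?_, by simp⟩
    rw [map_mul, lift_apply_inl, mul_assoc]
    refine hl _ p.2 (by simpa using hp) _ ?_
    rcases s with _ | _ | _
    · rw [ih.1 rfl]; left; simpa using hx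
    · right; exact ih.2.2 rfl x hx
    · simp at hs
  | right p c s hp hs h ih =>
    refine ⟨by simp, by simp, fun _ x hx => ?_⟩
    rw [map_mul, lift_apply_inr, mul_assoc]
    refine hr _ p.2 (by simpa using hp) _ ?_
    rcases s with _ | _ | _
    · rw [ih.1 rfl]; left; simpa using hx
    · simp at hs
    · right; exact ih.2.1 rfl x hx

theorem pp_inj {x0 : G} (h0 : x0 ∈ C) (h1 : x0 ∉ Xl) (h2 : x0 ∉ Xr) :
    Function.Injective (Coprod.lift P.subtype Q.subtype) := by
  rw [injective_iff_map_eq_one]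
  intro w hw
  obtain ⟨s, hs⟩ := Red.exists w
  have := hs.sem hl hr
  rcases s with _ | _ | _
  · exact this.1 rfl
  · exact absurd (by simpa [hw] using this.2.2 rfl x0 h0) h2
  · exact absurd (by simpa [hw] using this.2.1 rfl x0 h0) h1

theorem pp_class {g : G} (hg : g ∈ P ⊔ Q) :
    ∃ v ∈ P, ∃ g', g = v * g' ∧ (g' = 1 ∨ ∀ x ∈ C, g' * x ∈ Xr) := by
  have : g ∈ (Coprod.lift P.subtype Q.subtype).range := by
    rw [Coprod.range_lift]; simpa using hg
  obtain ⟨w, rfl⟩ := this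
  obtain ⟨s, hs⟩ := Red.exists w
  have hsem := hs.sem hl hr
  cases hs with
  | one => exact ⟨1, P.one_mem, 1, by simp, Or.inl rfl⟩
  | left p c s hp hs h =>
    refine ⟨p, p.2, Coprod.lift P.subtype Q.subtype c, by simp, ?_⟩
    have := h.sem hl hr
    rcases s with _ | _ | _
    · left; rw [this.1 rfl]; simp
    · right; exact this.2.2 rfl
    · simp at hs
  | right p c s hp hs h =>
    exact ⟨1, P.one_mem, _, by rw [one_mul], Or.inr (hsem.2.2 rfl)⟩
end red
end KW

namespace KW
section merge
open Monoid
variable {G : Type*} [Group G] {D : G → G → ℕ} {e : ℕ}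

/-- translates of `C` under `W` -/
def hull (W : Subgroup G) (C : Set G) : Set G := {x | ∃ g ∈ W, ∃ c ∈ C, x = g * c}

theorem subset_hull (W : Subgroup G) (C : Set G) : C ⊆ hull W C :=
  fun c hc => ⟨1, W.one_mem, c, hc, by simp⟩

theorem hull_inv (W : Subgroup G) (C : Set G) : Inv W (hull W C) := by
  rintro v hv y ⟨g, hg, c, hc, rfl⟩
  exact ⟨v * g, W.mul_mem hv hg, c, hc, by group⟩

/-- The conclusion of Lemma A. -/
def LemA (D : G → G → ℕ) (ε K T : ℕ) : Prop := ∀ (V : Subgroup G) (A : Set G) (v x a : G),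
    QC D ε A → Inv V A → v ∈ V → v ≠ 1 → D x (v * x) ≤ K → Nearest D A x a → D x a ≤ T

/-- the bridge -/
def bridge (D : G → G → ℕ) (a m b : G) : Set G := {x | Btw D a x m ∨ Btw D m x b}

variable (H : Hyp D e)
include H

theorem Hyp.bridge_inv {a m b x : G} (g : G) (h : x ∈ bridge D a m b) :
    g * x ∈ bridge D (g * a) (g * m) (g * b) := by
  rcases h with h | h
  · exact Or.inl ((H.btw_inv g).2 h)
  · exact Or.inr ((H.btw_inv g).2 h)

theorem Hyp.star1 {ε T : ℕ} (hT : LemA D ε (KK e ε) T) {V : Subgroup G} {A : Set G} {a m o : G}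
    (hA : QC D ε A) (hV : Inv V A) (hn : Nearest D A m a) (hb : Btw D a m o)
    (h1 : T < D m a) (h2 : BB e ε + c2 e ε + 1 ≤ 2 * D m a) :
    Star D e ε A (fun v : V => v * a) (fun v : V => v * m) (fun v : V => v * o) where
  qc := hA
  near v := H.nearest_inv _ (hV _ v.2) (hV _ (V.inv_mem v.2)) hn
  btw v := (H.btw_inv _).2 hb
  long v := by
    rw [H.inv]; unfold c2 at h2; omega
  sep v w hvw := by
    refine H.sep_aux hA (H.nearest_inv _ (hV _ v.2) (hV _ (V.inv_mem v.2)) hn)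
      (H.nearest_inv _ (hV _ w.2) (hV _ (V.inv_mem w.2)) hn) ?_ ?_ ?_
    · rw [H.inv, H.inv]; omega
    · by_contra hc
      rw [← H.inv (v : G)⁻¹, inv_mul_cancel_left, ← mul_assoc] at hc
      have := hT V A ((v : G)⁻¹ * w) m a hA hV (V.mul_mem (V.inv_mem v.2) w.2)
        (fun h => hvw (Subtype.ext (inv_mul_eq_one.1 h))) (by omega) hn
      omega
    · rw [H.inv]; exact h2

theorem Hyp.nearest_mid {A B : Set G} {a b m : G} (ha : a ∈ A) (hb : b ∈ B)
    (hmin : ∀ a' ∈ A, ∀ b' ∈ B, D a b ≤ D a' b') (hm : Btw D a m b) : Nearest D A m a := by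
  refine ⟨ha, fun a' ha' => ?_⟩
  have := hmin a' ha' b hb
  have := H.tri a' m b
  unfold Btw at hm
  have := H.symm m a; have := H.symm m a'
  omega

theorem Hyp.half_pp {ε T : ℕ} (hT : LemA D ε (KK e ε) T) {V : Subgroup G} {A B : Set G}
    {a m o : G} (hA : QC D ε A) (hV : Inv V A) (hn : Nearest D A m a) (hb : Btw D a m o)
    (h1 : T < D m a) (h2 : BB e ε + c2 e ε + 1 ≤ 2 * D m a)
    (hB : ∀ x ∈ B, GP D m x o (rr e ε)) :
    ∀ p ∈ V, p ≠ 1 → ∀ x, (x ∈ A ∨ x ∈ B ∨ x ∈ bridge D a m o) ∨ GP D m x o (rr e ε) →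
      GP D m (p * x) a (rr e ε) := by
  intro p hp hp1 x hx
  have St := H.star1 hT hA hV hn hb h1 h2
  have hne : (⟨p, hp⟩ : V) ≠ 1 := fun h => hp1 (congrArg Subtype.val h)
  have hfar : x ∈ Far D (rr e ε) m o → GP D m (p * x) a (rr e ε) := by
    intro h
    have := H.star_f St (x := p * x) hne (H.far_inv p h)
    simpa using this
  rcases hx with (hx | hx | hx | hx) | hx
  · have := H.star_a St (hV p hp x hx) 1
    simp only [OneMemClass.coe_one, one_mul] at this
    unfold GP BB at *; omega
  · exact hfar (Or.inr (hB x hx))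
  · have := H.star_b St (x := p * x) hne ((H.btw_inv p).2 hx)
    simpa using this
  · exact hfar (Or.inl hx)
  · exact hfar (Or.inr hx)

theorem Hyp.half_loc {ε T : ℕ} (hT : LemA D ε (KK e ε) T) {V W : Subgroup G} {A B : Set G}
    {a m o : G} (hA : QC D ε A) (hV : Inv V A) (hn : Nearest D A m a) (hb : Btw D a m o)
    (h1 : T < D m a) (h2 : BB e ε + c2 e ε + 1 ≤ 2 * D m a)
    (hB : ∀ x ∈ B, GP D m x o (rr e ε)) (hVW : V ≤ W)
    (hcl : ∀ g ∈ W, ∃ v ∈ V, ∃ g', g = v * g' ∧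
      (g' = 1 ∨ ∀ x, (x ∈ A ∨ x ∈ B ∨ x ∈ bridge D a m o) → GP D m (g' * x) o (rr e ε))) 
    {y p z : G} (hy : y ∈ A ∨ Btw D a y m)
    (hp : p ∈ hull W {x | x ∈ A ∨ x ∈ B ∨ x ∈ bridge D a m o})
    (hz : Btw D y z p) (hz' : D y z ≤ e + eps1 e ε + 1) :
    ∃ w ∈ hull W {x | x ∈ A ∨ x ∈ B ∨ x ∈ bridge D a m o}, D z w ≤ eps1 e ε := by
  have St := H.star1 hT hA hV hn hb h1 h2
  refine H.star_local St ?_ ?_ (y := y) (p := p) ?_ ?_ hz hz'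
  · exact fun x hx => subset_hull _ _ (Or.inl hx)
  · intro v x hx
    refine ⟨v, hVW v.2, (v : G)⁻¹ * x, Or.inr (Or.inr ?_), by simp⟩
    have := H.bridge_inv (v : G)⁻¹ (show x ∈ bridge D (v * a) (v * m) (v * o) from hx)
    simpa using this
  · rcases hy with hy | hy
    · exact Or.inl hy
    · exact Or.inr ⟨1, by simpa using hy⟩
  · obtain ⟨g, hg, c, hc, rfl⟩ := hp
    obtain ⟨v, hv, g', rfl, rfl | hg'⟩ := hcl g hg
    · simp only [mul_one]
      have hfar : c ∈ Far D (rr e ε) m o → v * c ∈ Far D (rr e ε) (v * m) (v * o) := H.far_inv v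
      rcases hc with hc | hc | hc | hc
      · exact Or.inl (Or.inl (hV v hv c hc))
      · exact Or.inr ⟨⟨v, hv⟩, hfar (Or.inr (hB c hc))⟩
      · exact Or.inl (Or.inr ⟨⟨v, hv⟩, (H.btw_inv v).2 hc⟩)
      · exact Or.inr ⟨⟨v, hv⟩, hfar (Or.inl hc)⟩
    · have := hg' c hc
      refine Or.inr ⟨⟨v, hv⟩, ?_⟩
      rw [mul_assoc]
      exact H.far_inv v (Or.inr this)

theorem Hyp.bridge_symm {a m b x : G} (h : x ∈ bridge D a m b) : x ∈ bridge D b m a := by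
  rcases h with h | h
  · exact Or.inr (H.btw_symm h)
  · exact Or.inl (H.btw_symm h)

/-- It suffices to check quasiconvexity of a hull at points of the core. -/
theorem Hyp.hull_qc {ε1 : ℕ} {W : Subgroup G} {C : Set G}
    (h : ∀ y ∈ C, ∀ p ∈ hull W C, ∀ z, Btw D y z p → D y z ≤ e + ε1 + 1 →
      ∃ w ∈ hull W C, D z w ≤ ε1) : QC D (2 * (e + ε1 + 1)) (hull W C) := by
  refine H.local_qc ?_
  rintro _ ⟨g, hg, c, hc, rfl⟩ p hp z hz hz'
  obtain ⟨w, hw, hd⟩ := h c hc (g⁻¹ * p) (hull_inv W C _ (W.inv_mem hg) p hp) (g⁻¹ * z)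
    (by rw [← H.btw_inv g]; simpa using hz) (by rw [← H.inv g]; simpa using hz')
  refine ⟨g * w, hull_inv W C _ hg w hw, ?_⟩
  rw [← H.inv g⁻¹]; simpa using hd

theorem Hyp.merge1 (ε : ℕ) : ∃ L0 : ℕ, ∀ (V1 V2 : Subgroup G) (A1 A2 : Set G) (a b : G),
    QC D ε A1 → QC D ε A2 → Inv V1 A1 → Inv V2 A2 → a ∈ A1 → b ∈ A2 →
    (∀ a' ∈ A1, ∀ b' ∈ A2, D a b ≤ D a' b') → L0 ≤ D a b →
    Function.Injective (Coprod.lift V1.subtype V2.subtype) ∧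
    ∃ m, Btw D a m b ∧
      QC D (epsQ e ε) (hull (V1 ⊔ V2) {x | x ∈ A1 ∨ x ∈ A2 ∨ x ∈ bridge D a m b}) := by
  obtain ⟨T, hT⟩ := H.lemA ε (KK e ε)
  change LemA D ε (KK e ε) T at hT
  refine ⟨2 * T + BB e ε + c2 e ε + 4, fun V1 V2 A1 A2 a b q1 q2 i1 i2 ha hb hmin hL => ?_⟩
  obtain ⟨m, hm, hm'⟩ := H.exists_btw a b (D a b / 2) (by omega)
  have hms := H.btw_symm hm
  have n1 := H.nearest_mid ha hb hmin hm
  have n2 : Nearest D A2 m b := H.nearest_mid hb ha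
    (fun b' hb' a' ha' => by rw [H.symm b a, H.symm b' a']; exact hmin a' ha' b' hb') hms
  have s1 := H.symm m a
  have d2 : D m b = D a b - D a b / 2 := by unfold Btw at hm; omega
  have t1 : T < D m a := by omega
  have t2 : T < D m b := by omega
  have u1 : BB e ε + c2 e ε + 1 ≤ 2 * D m a := by omega
  have u2 : BB e ε + c2 e ε + 1 ≤ 2 * D m b := by omega
  have b1 : ∀ x ∈ A1, GP D m x a (rr e ε) := by
    intro x hx
    have := H.proj1 q1 n1 hx
    have := H.symm a x
    unfold GP BB c2 at *; omega
  have b2 : ∀ x ∈ A2, GP D m x b (rr e ε) := by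
    intro x hx
    have := H.proj1 q2 n2 hx
    have := H.symm b x
    unfold GP BB c2 at *; omega
  set C : Set G := {x | x ∈ A1 ∨ x ∈ A2 ∨ x ∈ bridge D a m b} with hC
  have hl := H.half_pp hT q1 i1 n1 hm t1 u1 b2
  have hr := H.half_pp hT q2 i2 n2 hms t2 u2 b1
  have hl' : ∀ p ∈ V1, p ≠ 1 → ∀ x, x ∈ C ∨ x ∈ {x | GP D m x b (rr e ε)} →
      p * x ∈ {x | GP D m x a (rr e ε)} := hl
  have hswap : ∀ x, x ∈ C ↔ x ∈ {x | x ∈ A2 ∨ x ∈ A1 ∨ x ∈ bridge D b m a} := by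
    intro x
    constructor
    · rintro (h | h | h)
      · exact Or.inr (Or.inl h)
      · exact Or.inl h
      · exact Or.inr (Or.inr (H.bridge_symm h))
    · rintro (h | h | h)
      · exact Or.inr (Or.inl h)
      · exact Or.inl h
      · exact Or.inr (Or.inr (H.bridge_symm h))
  have hr' : ∀ p ∈ V2, p ≠ 1 → ∀ x, x ∈ C ∨ x ∈ {x | GP D m x a (rr e ε)} →
      p * x ∈ {x | GP D m x b (rr e ε)} := by
    intro p hp hp1 x hx
    rw [hswap] at hx
    exact hr p hp hp1 x hx
  have hmm : ∀ o, ¬ GP D m m o (rr e ε) := by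
    intro o; unfold GP rr; have := H.self m; omega
  refine ⟨pp_inj hl' hr' (x0 := m) (Or.inr (Or.inr (Or.inl ?_))) (hmm a) (hmm b), m, hm, ?_⟩
  · unfold Btw; rw [H.self]; omega
  refine H.hull_qc ?_
  intro y hy p hp z hz hz'
  have case1 : (y ∈ A1 ∨ Btw D a y m) → ∃ w ∈ hull (V1 ⊔ V2) C, D z w ≤ eps1 e ε := fun h =>
    H.half_loc hT q1 i1 n1 hm t1 u1 b2 (W := V1 ⊔ V2) le_sup_left
      (fun g hg => pp_class hl' hr' hg) h hp hz hz'
  have case2 : (y ∈ A2 ∨ Btw D b y m) → ∃ w ∈ hull (V1 ⊔ V2) C, D z w ≤ eps1 e ε := by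
    intro h
    have hCe : C = {x | x ∈ A2 ∨ x ∈ A1 ∨ x ∈ bridge D b m a} := Set.ext hswap
    change p ∈ hull (V1 ⊔ V2) C at hp
    rw [hCe] at hp ⊢
    refine H.half_loc hT q2 i2 n2 hms t2 u2 b1 (W := V1 ⊔ V2) le_sup_right
      (fun g hg => ?_) h hp hz hz'
    obtain ⟨v, hv, g', h1, h2⟩ := pp_class hr' hl' (sup_comm V1 V2 ▸ hg)
    refine ⟨v, hv, g', h1, h2.imp id fun h2 x hx => h2 x ?_⟩
    rw [hswap]; exact hx
  rcases hy with hy | hy | hy | hy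
  · exact case1 (Or.inl hy)
  · exact case2 (Or.inl hy)
  · exact case1 (Or.inr hy)
  · exact case2 (Or.inr (H.btw_symm hy))
end merge
end KW

namespace KW
section merge2
open Monoid
variable {G : Type*} [Group G] {D : G → G → ℕ} {e : ℕ}
variable (H : Hyp D e)
include H

theorem Hyp.star2 {ε T : ℕ} (hT : LemA D ε (KK e ε) T) {V : Subgroup G} {A : Set G} {h : G}
    {a m o : Bool → G} (hA : QC D ε A) (hV : Inv V A) (hn : ∀ i, Nearest D A (m i) (a i))
    (hb : ∀ i, Btw D (a i) (m i) (o i)) (hm : m true = h * m false)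
    (h1 : ∀ i, T < D (m i) (a i)) (h2 : ∀ i, BB e ε + c2 e ε + 1 ≤ 2 * D (m i) (a i))
    (h3 : ∀ i j, D (m i) (a i) ≤ D (m j) (a j) + 1)
    (h4 : ∀ v ∈ V, ∀ x, KK e ε < D x (h * v * x)) :
    Star D e ε A (fun j : V × Bool => j.1 * a j.2) (fun j : V × Bool => j.1 * m j.2)
      (fun j : V × Bool => j.1 * o j.2) where
  qc := hA
  near j := H.nearest_inv _ (hV _ j.1.2) (hV _ (V.inv_mem j.1.2)) (hn _)
  btw v := (H.btw_inv _).2 (hb _)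
  long v := by
    rw [H.inv]; have := h2 v.2; unfold c2 at this; omega
  sep := by
    rintro ⟨v, i⟩ ⟨w, j⟩ hvw
    refine H.sep_aux hA (H.nearest_inv _ (hV _ v.2) (hV _ (V.inv_mem v.2)) (hn i))
      (H.nearest_inv _ (hV _ w.2) (hV _ (V.inv_mem w.2)) (hn j)) ?_ ?_ ?_
    · rw [H.inv, H.inv]; exact h3 _ _
    · have ht : ∀ v w : V, KK e ε < D (v * m true) (w * m false) := by
        intro v w
        have := h4 ((w : G)⁻¹ * v) (V.mul_mem (V.inv_mem w.2) v.2) (m true)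
        rw [H.symm, ← H.inv (w * h⁻¹ : G)] at this
        rw [hm] at this ⊢
        convert this using 2 <;> group
      by_cases hij : i = j
      · subst hij
        by_contra hc
        simp only at hc
        rw [← H.inv (v : G)⁻¹, inv_mul_cancel_left, ← mul_assoc] at hc
        have := hT V A ((v : G)⁻¹ * w) (m i) (a i) hA hV (V.mul_mem (V.inv_mem v.2) w.2)
          (fun h => hvw (by rw [Subtype.ext (inv_mul_eq_one.1 h)])) (by omega) (hn i)
        have := h1 i
        omega
      · cases i <;> cases j
        · exact absurd rfl hij
        · have := ht w v; rw [H.symm] at this; exact this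
        · exact ht v w
        · exact absurd rfl hij
    · rw [H.inv]; exact h2 i

theorem Hyp.merge2 (ε : ℕ) : ∃ L0 : ℕ, ∀ (V : Subgroup G) (A : Set G) (h a b : G),
    QC D ε A → Inv V A → a ∈ A → b ∈ A →
    (∀ a' ∈ A, ∀ b' ∈ A, D a (h * b) ≤ D a' (h * b')) → L0 ≤ D a (h * b) →
    (∀ v ∈ V, ∀ x, L0 < D x (h * v * x)) →
    Function.Injective (Coprod.lift V.subtype (Subgroup.zpowers h).subtype) ∧
    (∀ n : ℕ, n ≠ 0 → h ^ n ≠ 1) ∧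
    ∃ m, Btw D a m (h * b) ∧
      QC D (epsQ e ε) (hull (V ⊔ Subgroup.zpowers h) {x | x ∈ A ∨ x ∈ bridge D a m (h * b)}) := by
  obtain ⟨T, hT⟩ := H.lemA ε (KK e ε)
  change LemA D ε (KK e ε) T at hT
  refine ⟨2 * T + BB e ε + c2 e ε + KK e ε + 2 * e + 8,
    fun V A h a b hA hV ha hb hmin hL hmove => ?_⟩
  obtain ⟨m, hm, hm'⟩ := H.exists_btw a (h * b) (D a (h * b) / 2) (by omega)
  have n1 : Nearest D A m a := H.nearest_mid (B := {x | ∃ b' ∈ A, x = h * b'}) ha ⟨b, hb, rfl⟩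
    (by rintro a' ha' _ ⟨b', hb', rfl⟩; exact hmin a' ha' b' hb') hm
  have hm2 : Btw D b (h⁻¹ * m) (h⁻¹ * a) := by
    rw [← H.btw_inv h]; simpa using H.btw_symm hm
  have n2 : Nearest D A (h⁻¹ * m) b := by
    refine H.nearest_mid (B := {x | ∃ a' ∈ A, x = h⁻¹ * a'}) hb ⟨a, ha, rfl⟩ ?_ hm2
    rintro b' hb' _ ⟨a', ha', rfl⟩
    have := hmin a' ha' b' hb'
    rw [← H.inv h, ← H.inv h b']
    simp only [mul_inv_cancel_left]
    rw [H.symm, H.symm (h * b')]; exact this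
  have s1 := H.symm m a
  have d2 : D (h⁻¹ * m) b = D a (h * b) - D a (h * b) / 2 := by
    rw [← H.inv h]; simp only [mul_inv_cancel_left]; unfold Btw at hm; omega
  set aa : Bool → G := fun i => bif i then a else b with haa
  set mm : Bool → G := fun i => bif i then m else h⁻¹ * m with hmm
  set oo : Bool → G := fun i => bif i then h * b else h⁻¹ * a with hoo
  have St : Star D e ε A (fun j : V × Bool => j.1 * aa j.2) (fun j : V × Bool => j.1 * mm j.2)
      (fun j : V × Bool => j.1 * oo j.2) := by
    refine H.star2 (h := h) hT hA hV ?_ ?_ ?_ ?_ ?_ ?_ ?_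
    · rintro (_ | _)
      · exact n2
      · exact n1
    · rintro (_ | _)
      · exact hm2
      · exact hm
    · simp [hmm]
    · rintro (_ | _)
      · change T < D (h⁻¹ * m) b; omega
      · change T < D m a; omega
    · rintro (_ | _)
      · change _ ≤ 2 * D (h⁻¹ * m) b; omega
      · change _ ≤ 2 * D m a; omega
    · rintro (_ | _) (_ | _) <;> simp only [haa, hmm, cond_true, cond_false] <;> omega
    · intro v hv x
      have := hmove v hv x
      omega
  set r := rr e ε with hr
  set F : Bool → Set G := fun i => Far D r (mm i) (oo i) with hF
  set C : Set G := {x | x ∈ A ∨ ∃ i, Btw D (aa i) x (mm i)} with hC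
  set Xr : Set G := {x | ∃ i, x ∈ F i} with hXr
  set Xl : Set G := {x | ∃ v ∈ V, v ≠ 1 ∧ ∃ y, (y ∈ C ∨ y ∈ Xr) ∧ x = v * y} with hXl
  -- points on other sides
  have sideA : ∀ x ∈ A, ∀ i, GP D (mm i) x (aa i) r := by
    intro x hx i
    have := H.star_a St hx (1, i)
    simp only [OneMemClass.coe_one, one_mul] at this
    unfold GP BB at *; omega
  have sideB : ∀ x j i, j ≠ i → Btw D (aa j) x (mm j) → GP D (mm i) x (aa i) r := by
    intro x j i hij hx
    have := H.star_b St (x := x) (i := (1, j)) (j := (1, i)) (by simpa using hij)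
      (by simpa using hx)
    simpa using this
  have sideF : ∀ x j i, j ≠ i → x ∈ F j → GP D (mm i) x (aa i) r := by
    intro x j i hij hx
    have := H.star_f St (x := x) (i := (1, j)) (j := (1, i)) (by simpa using hij)
      (by simpa using hx)
    simpa using this
  have sideL : ∀ x ∈ Xl, ∀ i, GP D (mm i) x (aa i) r := by
    rintro _ ⟨v, hv, hv1, y, hy, rfl⟩ i
    have hne : ∀ j, ((⟨v, hv⟩, j) : V × Bool) ≠ (1, i) := by
      intro j hj
      exact hv1 (congrArg (fun z : V × Bool => (z.1 : G)) hj)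
    rcases hy with (hy | ⟨j, hy⟩) | ⟨j, hy⟩
    · exact sideA _ (hV v hv y hy) i
    · have := H.star_b St (x := v * y) (hne j) ((H.btw_inv v).2 hy)
      simpa using this
    · have := H.star_f St (x := v * y) (hne j) (H.far_inv v hy)
      simpa using this
  -- the action of h
  have step : ∀ x i, (x ∈ C ∨ x ∈ F i ∨ x ∈ Xl) → (bif i then h else h⁻¹) * x ∈ F i := by
    intro x i hx
    have key : Btw D (mm (!i)) x (aa (!i)) ∨ GP D (mm (!i)) x (aa (!i)) r := by
      rcases hx with (hx | ⟨j, hx⟩) | hx | hx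
      · exact Or.inr (sideA x hx _)
      · by_cases hj : j = !i
        · subst hj; exact Or.inl (H.btw_symm hx)
        · exact Or.inr (sideB x j _ hj hx)
      · exact Or.inr (sideF x i _ (by simp) hx)
      · exact Or.inr (sideL x hx _)
    cases i
    · have : h⁻¹ * x ∈ Far D r (h⁻¹ * m) (h⁻¹ * a) := H.far_inv h⁻¹ key
      exact this
    · have : h * x ∈ Far D r (h * (h⁻¹ * m)) (h * b) := H.far_inv h key
      rw [mul_inv_cancel_left] at this
      exact this
  have stepn : ∀ i x (n : ℕ), (x ∈ C ∨ x ∈ Xl) → (bif i then h else h⁻¹) ^ (n + 1) * x ∈ F i := by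
    intro i x n hx
    induction n with
    | zero =>
      rw [zero_add, pow_one]
      exact step x i (hx.imp id Or.inr)
    | succ n ih =>
      rw [pow_succ', mul_assoc]
      exact step _ i (Or.inr (Or.inl ih))
  have hl : ∀ p ∈ V, p ≠ 1 → ∀ x, x ∈ C ∨ x ∈ Xr → p * x ∈ Xl :=
    fun p hp hp1 x hx => ⟨p, hp, hp1, x, hx, rfl⟩
  have hrr : ∀ q ∈ Subgroup.zpowers h, q ≠ 1 → ∀ x, x ∈ C ∨ x ∈ Xl → q * x ∈ Xr := by
    rintro q hq hq1 x hx
    obtain ⟨n, rfl⟩ := Subgroup.mem_zpowers_iff.1 hq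
    rcases n with n | n
    · rcases n with _ | n
      · simp at hq1
      · refine ⟨true, ?_⟩
        have := stepn true x n hx
        simp only [cond_true] at this
        rw [Int.ofNat_eq_natCast, zpow_natCast]
        exact this
    · refine ⟨false, ?_⟩
      have := stepn false x n hx
      rw [zpow_negSucc]
      simpa using this
  obtain ⟨x0, hx0, hx0'⟩ := H.exists_btw m a (e + 1) (by omega)
  have x0C : x0 ∈ C := Or.inr ⟨true, H.btw_symm hx0⟩
  have x0F : ∀ i, x0 ∉ F i := by
    intro i hi
    cases i
    · have h1 := sideF x0 false true (by simp) hi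
      change GP D m x0 a r at h1
      unfold GP at h1
      unfold Btw at hx0
      rw [hr] at h1; unfold rr at h1; omega
    · have := H.far_le (by rw [hr]; unfold rr; omega) hm hi
      unfold Btw at hx0
      omega
  have x0L : x0 ∉ Xl := by
    intro hi
    have h1 := sideL x0 hi true
    change GP D m x0 a r at h1
    unfold GP at h1
    unfold Btw at hx0
    rw [hr] at h1; unfold rr at h1; omega
  refine ⟨pp_inj hl hrr x0C x0L (fun ⟨i, hi⟩ => x0F i hi), ?_, m, hm, ?_⟩
  · intro n hn hn1
    obtain ⟨k, rfl⟩ := Nat.exists_eq_succ_of_ne_zero hn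
    have := stepn true x0 k (Or.inl x0C)
    simp only [cond_true] at this
    rw [show h ^ (k + 1) = 1 from hn1, one_mul] at this
    exact x0F true this
  set W := V ⊔ Subgroup.zpowers h with hW
  have hhW : h ∈ W := (le_sup_right : Subgroup.zpowers h ≤ W) (Subgroup.mem_zpowers h)
  have hVW : V ≤ W := le_sup_left
  have hhull : hull W {x | x ∈ A ∨ x ∈ bridge D a m (h * b)} = hull W C := by
    apply Set.Subset.antisymm
    · rintro _ ⟨g, hg, c, hc | hc | hc, rfl⟩
      · exact ⟨g, hg, c, Or.inl hc, rfl⟩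
      · exact ⟨g, hg, c, Or.inr ⟨true, hc⟩, rfl⟩
      · refine ⟨g * h, W.mul_mem hg hhW, h⁻¹ * c, Or.inr ⟨false, ?_⟩, by group⟩
        change Btw D b (h⁻¹ * c) (h⁻¹ * m)
        rw [← H.btw_inv h]; simpa using H.btw_symm hc
    · rintro _ ⟨g, hg, c, hc | ⟨i, hc⟩, rfl⟩
      · exact ⟨g, hg, c, Or.inl hc, rfl⟩
      · cases i
        · refine ⟨g * h⁻¹, W.mul_mem hg (W.inv_mem hhW), h * c, Or.inr (Or.inr ?_), by group⟩
          change Btw D b c (h⁻¹ * m) at hc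
          rw [← H.btw_inv h] at hc
          simpa using H.btw_symm hc
        · exact ⟨g, hg, c, Or.inr (Or.inl hc), rfl⟩
  rw [hhull]
  refine H.hull_qc ?_
  intro y hy p hp z hz hz'
  refine H.star_local St ?_ ?_ (y := y) (p := p) ?_ ?_ hz hz'
  · exact fun x hx => subset_hull _ _ (Or.inl hx)
  · rintro ⟨v, i⟩ x hx
    rw [← hhull]
    have hx' : (v : G)⁻¹ * x ∈ bridge D (aa i) (mm i) (oo i) := by
      have := H.bridge_inv (v : G)⁻¹ (show x ∈ bridge D (v * aa i) (v * mm i) (v * oo i) from hx)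
      simpa using this
    cases i
    · refine ⟨v * h⁻¹, W.mul_mem (hVW v.2) (W.inv_mem hhW), h * ((v : G)⁻¹ * x), Or.inr ?_,
        by group⟩
      have := H.bridge_symm (H.bridge_inv h hx')
      simpa [aa, mm, oo] using this
    · exact ⟨v, hVW v.2, (v : G)⁻¹ * x, Or.inr hx', by group⟩
  · rcases hy with hy | ⟨i, hy⟩
    · exact Or.inl hy
    · exact Or.inr ⟨(1, i), by simpa using hy⟩
  · obtain ⟨g, hg, c, hc, rfl⟩ := hp
    obtain ⟨v, hv, g', rfl, rfl | hg'⟩ := pp_class hl hrr hg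
    · rw [mul_one]
      rcases hc with hc | ⟨i, hc⟩
      · exact Or.inl (Or.inl (hV v hv c hc))
      · exact Or.inl (Or.inr ⟨(⟨v, hv⟩, i), (H.btw_inv v).2 hc⟩)
    · obtain ⟨i, hi⟩ := hg' c hc
      refine Or.inr ⟨(⟨v, hv⟩, i), ?_⟩
      rw [mul_assoc]
      exact H.far_inv v hi
end merge2
end KW

namespace KW
section states
open Monoid
variable {G : Type*} [Group G] {ι κ : Type*}

/-- conjugate subgroup -/
def cj (g : G) (V : Subgroup G) : Subgroup G := V.map (MulAut.conj g).toMonoidHom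
/-- translated set -/
def tr (g : G) (A : Set G) : Set G := {x | g⁻¹ * x ∈ A}

theorem mem_cj {g x : G} {V : Subgroup G} : x ∈ cj g V ↔ g⁻¹ * x * g ∈ V := by
  unfold cj
  rw [Subgroup.mem_map]
  constructor
  · rintro ⟨y, hy, rfl⟩
    simpa [mul_assoc] using hy
  · intro h
    exact ⟨_, h, by simp [mul_assoc]⟩

theorem mem_tr {g x : G} {A : Set G} : x ∈ tr g A ↔ g⁻¹ * x ∈ A := Iff.rfl

theorem mul_mem_tr {g x : G} {A : Set G} : g * x ∈ tr g A ↔ x ∈ A := by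
  simp [mem_tr]

theorem cj_sup (g : G) (V W : Subgroup G) : cj g (V ⊔ W) = cj g V ⊔ cj g W :=
  Subgroup.map_sup _ _ _

theorem cj_zpowers (g h : G) :
    cj g (Subgroup.zpowers h) = Subgroup.zpowers (g * h * g⁻¹) := by
  unfold cj
  rw [MonoidHom.map_zpowers]; simp

theorem hull_tr (g : G) (W : Subgroup G) (C : Set G) :
    hull (cj g W) (tr g C) = tr g (hull W C) := by
  ext x
  constructor
  · rintro ⟨w, hw, c, hc, rfl⟩
    exact ⟨g⁻¹ * w * g, mem_cj.1 hw, g⁻¹ * c, hc, by group⟩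
  · rintro ⟨w, hw, c, hc, hx⟩
    refine ⟨g * w * g⁻¹, mem_cj.2 (by simpa [mul_assoc] using hw), g * c, mul_mem_tr.2 hc, ?_⟩
    rw [inv_mul_eq_iff_eq_mul] at hx
    rw [hx]; group

/-- A configuration: clusters and free elements. -/
structure Conf (G ι κ : Type*) [Group G] where
  V : ι → Subgroup G
  A : ι → Set G
  h : κ → G

/-- the subgroup generated by a part of the configuration -/
def gen (s : Conf G ι κ) (I : Finset ι) (K : Finset κ) : Subgroup G :=
  Subgroup.closure {x | (∃ i ∈ I, x ∈ s.V i) ∨ ∃ t ∈ K, x = s.h t}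

theorem V_le_gen {s : Conf G ι κ} {I : Finset ι} {K : Finset κ} {i : ι} (hi : i ∈ I) :
    s.V i ≤ gen s I K := fun _ hx => Subgroup.subset_closure (Or.inl ⟨i, hi, hx⟩)

theorem h_mem_gen {s : Conf G ι κ} {I : Finset ι} {K : Finset κ} {t : κ} (ht : t ∈ K) :
    s.h t ∈ gen s I K := Subgroup.subset_closure (Or.inr ⟨t, ht, rfl⟩)

theorem gen_le {s : Conf G ι κ} {I : Finset ι} {K : Finset κ} {W : Subgroup G}
    (h1 : ∀ i ∈ I, s.V i ≤ W) (h2 : ∀ t ∈ K, s.h t ∈ W) : gen s I K ≤ W := by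
  unfold gen
  rw [Subgroup.closure_le]
  rintro x (⟨i, hi, hx⟩ | ⟨t, ht, rfl⟩)
  · exact h1 i hi hx
  · exact h2 t ht

variable [DecidableEq ι] [DecidableEq κ]

/-- conjugating a cluster -/
def Move1 (I : Finset ι) (K : Finset κ) (s s' : Conf G ι κ) : Prop :=
  ∃ i ∈ I, ∃ g ∈ gen s (I.erase i) K, s'.V i = cj g (s.V i) ∧ s'.A i = tr g (s.A i) ∧
    (∀ j ∈ I, j ≠ i → s'.V j = s.V j ∧ s'.A j = s.A j) ∧ ∀ t ∈ K, s'.h t = s.h t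

/-- multiplying a free element -/
def Move2 (I : Finset ι) (K : Finset κ) (s s' : Conf G ι κ) : Prop :=
  ∃ t ∈ K, ∃ g ∈ gen s I (K.erase t), (s'.h t = g * s.h t ∨ s'.h t = s.h t * g) ∧
    (∀ t' ∈ K, t' ≠ t → s'.h t' = s.h t') ∧ ∀ i ∈ I, s'.V i = s.V i ∧ s'.A i = s.A i

def Closed (P : Set (Conf G ι κ)) (I : Finset ι) (K : Finset κ) : Prop :=
  ∀ s ∈ P, ∀ s', Move1 I K s s' ∨ Move2 I K s s' → s' ∈ P

variable {P : Set (Conf G ι κ)} {I : Finset ι} {K : Finset κ}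

theorem Closed.op1 (hP : Closed P I K) {s : Conf G ι κ} (hs : s ∈ P) {i : ι} (hi : i ∈ I) {g : G}
    (hg : g ∈ gen s (I.erase i) K) : ∃ s1 ∈ P, s1.V i = cj g (s.V i) ∧ s1.A i = tr g (s.A i) ∧
      (∀ j, j ≠ i → s1.V j = s.V j ∧ s1.A j = s.A j) ∧ ∀ t, s1.h t = s.h t := by
  refine ⟨⟨Function.update s.V i (cj g (s.V i)), Function.update s.A i (tr g (s.A i)), s.h⟩,
    hP s hs _ (Or.inl ⟨i, hi, g, hg, ?_⟩), ?_⟩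
  · refine ⟨by simp, by simp, fun j _ hj => ?_, fun _ _ => rfl⟩
    simp [hj]
  · refine ⟨by simp, by simp, fun j hj => ?_, fun _ => rfl⟩
    simp [hj]

theorem gen_congr {s s' : Conf G ι κ} (h1 : ∀ i ∈ I, s'.V i = s.V i)
    (h2 : ∀ t ∈ K, s'.h t = s.h t) : gen s' I K = gen s I K := by
  apply le_antisymm
  · exact gen_le (fun i hi => by rw [h1 i hi]; exact V_le_gen hi)
      (fun t ht => by rw [h2 t ht]; exact h_mem_gen ht)
  · exact gen_le (fun i hi => by rw [← h1 i hi]; exact V_le_gen hi)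
      (fun t ht => by rw [← h2 t ht]; exact h_mem_gen ht)

theorem Closed.op2 (hP : Closed P I K) {s : Conf G ι κ} (hs : s ∈ P) {t : κ} (ht : t ∈ K)
    {g1 g2 : G} (hg1 : g1 ∈ gen s I (K.erase t)) (hg2 : g2 ∈ gen s I (K.erase t)) :
    ∃ s1 ∈ P, s1.h t = g1 * s.h t * g2 ∧ (∀ t', t' ≠ t → s1.h t' = s.h t') ∧
      (∀ i, s1.V i = s.V i ∧ s1.A i = s.A i) := by
  set s1 : Conf G ι κ := ⟨s.V, s.A, Function.update s.h t (g1 * s.h t)⟩ with hs1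
  have h1 : s1 ∈ P := hP s hs _ (Or.inr ⟨t, ht, g1, hg1, by simp [hs1],
    fun t' _ ht' => by simp [hs1, ht'], fun _ _ => ⟨rfl, rfl⟩⟩)
  have hgen : gen s1 I (K.erase t) = gen s I (K.erase t) :=
    gen_congr (fun _ _ => rfl) (fun t' ht' => by simp [hs1, Finset.ne_of_mem_erase ht'])
  refine ⟨⟨s.V, s.A, Function.update s.h t (g1 * s.h t * g2)⟩, ?_, by simp,
    fun t' ht' => by simp [ht'], fun _ => ⟨rfl, rfl⟩⟩
  exact hP s1 h1 _ (Or.inr ⟨t, ht, g2, hgen ▸ hg2, by simp [hs1],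
    fun t' _ ht' => by simp [hs1, ht'], fun _ _ => ⟨rfl, rfl⟩⟩)

end states

section fi
open Monoid
variable {G : Type*} [Group G]

theorem fi_split {U V1 V2 : Subgroup G} (hU : FreelyIndecomposable U) (hs : V1 ⊔ V2 = U)
    (hinj : Function.Injective (Coprod.lift V1.subtype V2.subtype)) : V1 = ⊥ ∨ V2 = ⊥ := by
  by_contra hcon
  push Not at hcon
  have l1 : V1 ≤ U := hs ▸ le_sup_left
  have l2 : V2 ≤ U := hs ▸ le_sup_right
  refine hU.2 ⟨V1.subgroupOf U, V2.subgroupOf U, ?_, ?_, ?_, ?_⟩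
  · intro h
    apply hcon.1
    rw [Subgroup.subgroupOf_eq_bot] at h
    exact (disjoint_of_le_iff_left_eq_bot l1).1 h
  · intro h
    apply hcon.2
    rw [Subgroup.subgroupOf_eq_bot] at h
    exact (disjoint_of_le_iff_left_eq_bot l2).1 h
  · have key : (U.subtype).comp (Coprod.lift (V1.subgroupOf U).subtype (V2.subgroupOf U).subtype)
        = (Coprod.lift V1.subtype V2.subtype).comp
          (MulEquiv.coprodCongr (Subgroup.subgroupOfEquivOfLe l1)
            (Subgroup.subgroupOfEquivOfLe l2)).toMonoidHom := by
      apply Coprod.hom_ext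
      · ext x; simp
      · ext x; simp
    have h2 : Function.Injective ((U.subtype).comp
        (Coprod.lift (V1.subgroupOf U).subtype (V2.subgroupOf U).subtype)) := by
      rw [key]
      exact hinj.comp (MulEquiv.injective _)
    rw [MonoidHom.coe_comp] at h2
    exact Function.Injective.of_comp h2
  · rw [← MonoidHom.range_eq_top, Coprod.range_lift, Subgroup.range_subtype,
      Subgroup.range_subtype]
    apply Subgroup.map_injective U.subtype_injective
    rw [Subgroup.map_sup, Subgroup.subgroupOf_map_subtype, Subgroup.subgroupOf_map_subtype,
      inf_of_le_left l1, inf_of_le_left l2, hs, ← MonoidHom.range_eq_map, Subgroup.range_subtype]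
end fi
end KW

namespace KW
section good
variable {G : Type*} [Group G] {D : G → G → ℕ} {e : ℕ} {ι κ : Type*}

/-- A configuration all of whose relevant distances exceed `M`. -/
structure Good (D : G → G → ℕ) (ε M : ℕ) (I : Finset ι) (K : Finset κ) (s : Conf G ι κ) :
    Prop where
  ne : ∀ i ∈ I, (s.A i).Nonempty
  inv : ∀ i ∈ I, Inv (s.V i) (s.A i)
  qc : ∀ i ∈ I, QC D ε (s.A i)
  l1 : ∀ i ∈ I, ∀ j ∈ I, i ≠ j → ∀ a ∈ s.A i, ∀ b ∈ s.A j, M < D a b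
  l2 : ∀ i ∈ I, ∀ t ∈ K, ∀ a ∈ s.A i, ∀ b ∈ s.A i, M < D a (s.h t * b)
  l3 : ∀ t ∈ K, ∀ x, M < D x (s.h t * x)

variable (H : Hyp D e)
include H

/-- two points at distance `< L/2` from the relevant things on a bridge -/
theorem Hyp.bridge1 {L : ℕ} {a b c y : G} (hL : D a b = L) (hc : Btw D a c b) (h1 : L ≤ D a y)
    (h2 : L ≤ D b y) : L ≤ 2 * D c y := by
  unfold Btw at hc
  have := H.tri a c y; have := H.tri b c y; have := H.symm b c
  omega

theorem Hyp.bridge2 {L M : ℕ} {a b c d h : G} (hL : D a b = L) (hc : Btw D a c b)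
    (hd : Btw D a d b) (h1 : L ≤ D a (h * a)) (h2 : L ≤ D a (h * b)) (h3 : L ≤ D b (h * a))
    (h4 : L ≤ D b (h * b)) (hM : M < D d (h * d)) : M < 2 * D c (h * d) + e := by
  unfold Btw at hc hd
  have e1 := H.inv h a d
  have e2 := H.inv h d b
  have := H.tri a c (h * a); have := H.tri a c (h * b)
  have := H.tri b c (h * a); have := H.tri b c (h * b)
  have := H.tri c (h * d) (h * a); have := H.tri c (h * d) (h * b)
  have := H.symm b c; have := H.symm (h * d) (h * a)
  have := H.tri d c (h * d)
  have := H.symm c d; have := H.symm c a; have := H.symm d a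
  rcases H.four c d a b with h | h <;> omega

theorem Hyp.qc_mono {ε ε' : ℕ} (h : ε ≤ ε') {A : Set G} (hA : QC D ε A) : QC D ε' A := by
  intro a ha b hb z hz
  obtain ⟨w, hw, hd⟩ := hA a ha b hb z hz
  exact ⟨w, hw, by omega⟩

theorem Hyp.qc_tr {ε : ℕ} {A : Set G} (g : G) (hA : QC D ε A) : QC D ε (tr g A) := by
  intro a ha b hb z hz
  obtain ⟨w, hw, hd⟩ := hA _ ha _ hb (g⁻¹ * z) ((H.btw_inv _).2 hz)
  refine ⟨g * w, mul_mem_tr.2 hw, ?_⟩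
  rw [← H.inv g⁻¹]; simpa using hd

theorem Hyp.bridge_btw {a m b c : G} (hm : Btw D a m b) (hc : c ∈ bridge D a m b) :
    Btw D a c b := by
  rcases hc with hc | hc
  · exact H.btw_sub hm hc
  · exact H.btw_symm (H.btw_sub (H.btw_symm hm) (H.btw_symm hc))

theorem Hyp.good_step {ε ε' M N L : ℕ} {I I' : Finset ι} {K K' : Finset κ} {s s' : Conf G ι κ}
    (hs : Good D ε M I K s) (hε : ε ≤ ε') (hMN : 2 * N + e + 2 ≤ M) (hML : M < L)
    {i0 : ι} (hI : I' ⊆ I) (hK : K' ⊆ K)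
    (hV : ∀ i ∈ I', i ≠ i0 → s'.V i = s.V i ∧ s'.A i = s.A i)
    (hh : ∀ t ∈ K', s'.h t = s.h t)
    {E E0 : Set G} {a b m : G} (hE0 : E0 ⊆ E) (ha : a ∈ E) (hb : b ∈ E) (hab : D a b = L)
    (hne : E0.Nonempty)
    (hm : Btw D a m b) (hA : s'.A i0 = hull (s'.V i0) {x | x ∈ E0 ∨ x ∈ bridge D a m b})
    (hqc : QC D ε' (s'.A i0))
    (k1 : ∀ w ∈ s'.V i0, ∀ j ∈ I', j ≠ i0 → ∀ y ∈ s.A j, ∀ q ∈ E, L ≤ D q (w * y))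
    (k2 : ∀ t ∈ K', ∀ w ∈ s'.V i0, ∀ w' ∈ s'.V i0, ∀ q ∈ E, ∀ q' ∈ E,
      L ≤ D q (w * s.h t * w' * q'))
    (k3 : ∀ t ∈ K', ∀ w ∈ s'.V i0, ∀ w' ∈ s'.V i0, ∀ x, M < D x (w * s.h t * w' * x)) :
    Good D ε' N I' K' s' := by
  have n1 : ∀ j ∈ I', j ≠ i0 → ∀ x ∈ s'.A i0, ∀ y ∈ s.A j, N < D x y := by
    intro j hj hj0 x hx y hy
    rw [hA] at hx
    obtain ⟨w, hw, c, hc, rfl⟩ := hx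
    have hk := k1 w⁻¹ (Subgroup.inv_mem _ hw) j hj hj0 y hy
    have : D (w * c) y = D c (w⁻¹ * y) := by rw [← H.inv w⁻¹]; simp
    rw [this]
    rcases hc with hc | hc
    · have := hk c (hE0 hc); omega
    · have := H.bridge1 hab (H.bridge_btw hm hc) (hk a ha) (hk b hb)
      omega
  refine ⟨?_, ?_, ?_, ?_, ?_, ?_⟩
  · intro i hi
    by_cases h : i = i0
    · subst h; rw [hA]
      obtain ⟨x, hx⟩ := hne
      exact ⟨x, subset_hull _ _ (Or.inl hx)⟩
    · rw [(hV i hi h).2]; exact hs.ne i (hI hi)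
  · intro i hi
    by_cases h : i = i0
    · subst h; rw [hA]; exact hull_inv _ _
    · rw [(hV i hi h).2, (hV i hi h).1]; exact hs.inv i (hI hi)
  · intro i hi
    by_cases h : i = i0
    · subst h; exact hqc
    · rw [(hV i hi h).2]; exact H.qc_mono hε (hs.qc i (hI hi))
  · intro i hi j hj hij x hx y hy
    by_cases h : i = i0
    · subst h
      rw [(hV j hj hij.symm).2] at hy
      exact n1 j hj hij.symm x hx y hy
    · by_cases h' : j = i0
      · subst h'
        rw [(hV i hi h).2] at hx
        rw [H.symm]
        exact n1 i hi h y hy x hx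
      · rw [(hV i hi h).2] at hx
        rw [(hV j hj h').2] at hy
        have := hs.l1 i (hI hi) j (hI hj) hij x hx y hy
        omega
  · intro i hi t ht x hx y hy
    rw [hh t ht]
    by_cases h : i = i0
    · subst h
      rw [hA] at hx hy
      obtain ⟨w, hw, c, hc, rfl⟩ := hx
      obtain ⟨w', hw', d, hd, rfl⟩ := hy
      have hk := k2 t ht w⁻¹ (Subgroup.inv_mem _ hw) w' hw'
      have hk3 := k3 t ht w⁻¹ (Subgroup.inv_mem _ hw) w' hw'
      set h' := w⁻¹ * s.h t * w' with hh'
      have : D (w * c) (s.h t * (w' * d)) = D c (h' * d) := by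
        rw [← H.inv w⁻¹]; simp [hh', mul_assoc]
      rw [this]
      have e1 : ∀ x y, D x (h' * y) = D y (h'⁻¹ * x) := by
        intro x y; rw [← H.inv h'⁻¹, H.symm]; simp
      rcases hc with hc | hc <;> rcases hd with hd | hd
      · have := hk c (hE0 hc) d (hE0 hd); omega
      · have := H.bridge1 (y := h'⁻¹ * c) hab (H.bridge_btw hm hd)
          (by rw [← e1]; exact hk c (hE0 hc) a ha) (by rw [← e1]; exact hk c (hE0 hc) b hb)
        rw [e1]; omega
      · have := H.bridge1 (y := h' * d) hab (H.bridge_btw hm hc)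
          (hk a ha d (hE0 hd)) (hk b hb d (hE0 hd))
        omega
      · have := H.bridge2 (h := h') hab (H.bridge_btw hm hc) (H.bridge_btw hm hd)
          (hk a ha a ha) (hk a ha b hb) (hk b hb a ha) (hk b hb b hb) (hk3 d)
        omega
    · rw [(hV i hi h).2] at hx hy
      have := hs.l2 i (hI hi) t (hK ht) x hx y hy
      omega
  · intro t ht x
    rw [hh t ht]
    have := hs.l3 t (hK ht) x
    omega
end good
end KW

namespace KW
section main
variable {G : Type*} [Group G] {D : G → G → ℕ} {e : ℕ} {ι κ : Type*}

theorem gen_mono {s : Conf G ι κ} {I I' : Finset ι} {K K' : Finset κ} (h1 : I ⊆ I')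
    (h2 : K ⊆ K') : gen s I K ≤ gen s I' K' :=
  gen_le (fun _ hi => V_le_gen (h1 hi)) (fun _ ht => h_mem_gen (h2 ht))

theorem tr_bridge (H : Hyp D e) (g a m b : G) :
    bridge D (g * a) (g * m) (g * b) = tr g (bridge D a m b) := by
  ext x
  have e1 : x = g * (g⁻¹ * x) := by group
  show Btw D (g * a) x (g * m) ∨ Btw D (g * m) x (g * b) ↔
    Btw D a (g⁻¹ * x) m ∨ Btw D m (g⁻¹ * x) b
  rw [e1, H.btw_inv, H.btw_inv, ← e1]

variable [DecidableEq ι] [DecidableEq κ]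

/-- merged configurations, first type -/
def PA (D : G → G → ℕ) (ε L : ℕ) (P : Set (Conf G ι κ)) (I : Finset ι) (K : Finset κ) (i0 j0 : ι) :
    Set (Conf G ι κ) :=
  {s' | ∃ s ∈ P, ∃ a ∈ s.A i0, ∃ b ∈ s.A j0, ∃ m, D a b = L ∧ Btw D a m b ∧
    s'.V i0 = s.V i0 ⊔ s.V j0 ∧
    s'.A i0 = hull (s'.V i0) {x | x ∈ {x | x ∈ s.A i0 ∨ x ∈ s.A j0} ∨ x ∈ bridge D a m b} ∧
    QC D ε (s'.A i0) ∧
    (∀ i ∈ I, i ≠ i0 → i ≠ j0 → s'.V i = s.V i ∧ s'.A i = s.A i) ∧ ∀ t ∈ K, s'.h t = s.h t}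

variable (H : Hyp D e)
include H

theorem PA_gen {s s' : Conf G ι κ} {I : Finset ι} {K : Finset κ} {i0 j0 : ι} (hi0 : i0 ∈ I)
    (hj0 : j0 ∈ I) (hij : i0 ≠ j0)
    (h1 : s'.V i0 = s.V i0 ⊔ s.V j0)
    (h2 : ∀ i ∈ I, i ≠ i0 → i ≠ j0 → s'.V i = s.V i ∧ s'.A i = s.A i)
    (h3 : ∀ t ∈ K, s'.h t = s.h t) : gen s' (I.erase j0) K = gen s I K := by
  apply le_antisymm
  · refine gen_le (fun i hi => ?_) (fun t ht => ?_)
    · obtain ⟨hij', hi⟩ := Finset.mem_erase.1 hi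
      by_cases h : i = i0
      · subst h; rw [h1]; exact sup_le (V_le_gen hi) (V_le_gen hj0)
      · rw [(h2 i hi h hij').1]; exact V_le_gen hi
    · rw [h3 t ht]; exact h_mem_gen ht
  · have hi0' : i0 ∈ I.erase j0 := Finset.mem_erase.2 ⟨hij, hi0⟩
    refine gen_le (fun i hi => ?_) (fun t ht => ?_)
    · by_cases h : i = i0
      · subst h; exact le_trans (h1 ▸ le_sup_left) (V_le_gen hi0')
      · by_cases h' : i = j0
        · subst h'; exact le_trans (h1 ▸ le_sup_right) (V_le_gen hi0')
        · rw [← (h2 i hi h h').1]; exact V_le_gen (Finset.mem_erase.2 ⟨h', hi⟩)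
    · rw [← h3 t ht]; exact h_mem_gen ht

theorem PA_closed {ε L : ℕ} {P : Set (Conf G ι κ)} {I : Finset ι} {K : Finset κ} {i0 j0 : ι}
    (hi0 : i0 ∈ I) (hj0 : j0 ∈ I) (hij : i0 ≠ j0) (hP : Closed P I K) :
    Closed (PA D ε L P I K i0 j0) (I.erase j0) K := by
  rintro s' ⟨s, hs, a, ha, b, hb, m, hab, hm, hV, hA, hqc, hoth, hh⟩ s'' hmove
  rcases hmove with ⟨i, hi, g, hg, q1, q2, q3, q4⟩ | ⟨t, ht, g, hg, q1, q2, q3⟩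
  · obtain ⟨hij', hiI⟩ := Finset.mem_erase.1 hi
    by_cases h : i = i0
    · subst h
      have hg0 : g ∈ gen s ((I.erase j0).erase i) K := by
        rw [← gen_congr (s' := s')]
        · exact hg
        · intro j hj
          simp only [Finset.mem_erase] at hj
          exact (hoth j hj.2.2 hj.1 hj.2.1).1
        · exact hh
      obtain ⟨s1, hs1, u1, u2, u3, u4⟩ := hP.op1 hs hiI (g := g)
        (gen_mono (Finset.erase_subset_erase _ (Finset.erase_subset _ _)) (le_refl _) hg0)
      have hg1 : g ∈ gen s1 (I.erase j0) K := by
        refine gen_mono (Finset.erase_subset i _) (le_refl K) ?_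
        rw [gen_congr (s := s)]
        · exact hg0
        · intro j hj
          simp only [Finset.mem_erase] at hj
          exact (u3 j hj.1).1
        · exact fun t _ => u4 t
      obtain ⟨s2, hs2, v1, v2, v3, v4⟩ := hP.op1 hs1 hj0 hg1
      have Vi : s2.V i = cj g (s.V i) := by rw [(v3 i hij).1, u1]
      have Ai : s2.A i = tr g (s.A i) := by rw [(v3 i hij).2, u2]
      have Vj : s2.V j0 = cj g (s.V j0) := by rw [v1, (u3 j0 hij.symm).1]
      have Aj : s2.A j0 = tr g (s.A j0) := by rw [v2, (u3 j0 hij.symm).2]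
      refine ⟨s2, hs2, g * a, ?_, g * b, ?_, g * m, ?_, ?_, ?_, ?_, ?_, ?_, ?_⟩
      · rw [Ai]; exact mul_mem_tr.2 ha
      · rw [Aj]; exact mul_mem_tr.2 hb
      · rw [H.inv]; exact hab
      · exact (H.btw_inv _).2 hm
      · rw [q1, hV, cj_sup, Vi, Vj]
      · rw [q2, q1, Ai, Aj, tr_bridge H, hA, ← hull_tr]; rfl
      · rw [q2]; exact H.qc_tr g hqc
      · intro j hj hji hjj
        have := q3 j (Finset.mem_erase.2 ⟨hjj, hj⟩) hji
        rw [this.1, this.2, (hoth j hj hji hjj).1, (hoth j hj hji hjj).2, (v3 j hjj).1,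
          (v3 j hjj).2, (u3 j hji).1, (u3 j hji).2]
        exact ⟨rfl, rfl⟩
      · intro t ht; rw [q4 t ht, hh t ht, v4, u4]
    · have hle : gen s' ((I.erase j0).erase i) K ≤ gen s (I.erase i) K := by
        refine gen_le (fun j hj => ?_) (fun t ht => ?_)
        · simp only [Finset.mem_erase] at hj
          by_cases h' : j = i0
          · subst h'; rw [hV]
            exact sup_le (V_le_gen (Finset.mem_erase.2 ⟨hj.1, hj.2.2⟩))
              (V_le_gen (Finset.mem_erase.2 ⟨Ne.symm hij', hj0⟩))
          · rw [(hoth j hj.2.2 h' hj.2.1).1]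
            exact V_le_gen (Finset.mem_erase.2 ⟨hj.1, hj.2.2⟩)
        · rw [hh t ht]; exact h_mem_gen ht
      obtain ⟨s1, hs1, u1, u2, u3, u4⟩ := hP.op1 hs hiI (hle hg)
      have q3' := q3 i0 (Finset.mem_erase.2 ⟨hij, hi0⟩) (Ne.symm h)
      refine ⟨s1, hs1, a, ?_, b, ?_, m, hab, hm, ?_, ?_, ?_, ?_, ?_⟩
      · rw [(u3 i0 (Ne.symm h)).2]; exact ha
      · rw [(u3 j0 (Ne.symm hij')).2]; exact hb
      · rw [q3'.1, hV, (u3 i0 (Ne.symm h)).1, (u3 j0 (Ne.symm hij')).1]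
      · rw [q3'.2, q3'.1, hA, (u3 i0 (Ne.symm h)).2, (u3 j0 (Ne.symm hij')).2]
      · rw [q3'.2]; exact hqc
      · intro j hj hji hjj
        by_cases h' : j = i
        · subst h'; rw [q1, q2, u1, u2, (hoth j hj hji hjj).1, (hoth j hj hji hjj).2]
          exact ⟨rfl, rfl⟩
        · have := q3 j (Finset.mem_erase.2 ⟨hjj, hj⟩) h'
          rw [this.1, this.2, (hoth j hj hji hjj).1, (hoth j hj hji hjj).2, (u3 j h').1,
            (u3 j h').2]
          exact ⟨rfl, rfl⟩
      · intro t ht; rw [q4 t ht, hh t ht, u4]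
  · have hg' : g ∈ gen s I (K.erase t) := by
      rw [← PA_gen H hi0 hj0 hij hV hoth (fun t' ht' => hh t' (Finset.mem_of_mem_erase ht'))]
      exact hg
    have key : ∃ s1 ∈ P, s1.h t = s''.h t ∧ (∀ t', t' ≠ t → s1.h t' = s.h t') ∧
      (∀ i, s1.V i = s.V i ∧ s1.A i = s.A i) := by
      rcases q1 with q1 | q1
      · obtain ⟨s1, hs1, u1, u2⟩ := hP.op2 hs ht hg' (one_mem _)
        exact ⟨s1, hs1, by rw [u1, q1, hh t ht, mul_one], u2⟩
      · obtain ⟨s1, hs1, u1, u2⟩ := hP.op2 hs ht (one_mem _) hg'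
        exact ⟨s1, hs1, by rw [u1, q1, hh t ht, one_mul], u2⟩
    obtain ⟨s1, hs1, u1, u2, u3⟩ := key
    have q3' := q3 i0 (Finset.mem_erase.2 ⟨hij, hi0⟩)
    refine ⟨s1, hs1, a, by rw [(u3 i0).2]; exact ha, b, by rw [(u3 j0).2]; exact hb, m, hab, hm,
      ?_, ?_, ?_, ?_, ?_⟩
    · rw [q3'.1, hV, (u3 i0).1, (u3 j0).1]
    · rw [q3'.2, q3'.1, hA, (u3 i0).2, (u3 j0).2]
    · rw [q3'.2]; exact hqc
    · intro j hj hji hjj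
      have := q3 j (Finset.mem_erase.2 ⟨hjj, hj⟩)
      rw [this.1, this.2, (hoth j hj hji hjj).1, (hoth j hj hji hjj).2, (u3 j).1, (u3 j).2]
      exact ⟨rfl, rfl⟩
    · intro t' ht'
      by_cases h : t' = t
      · subst h; exact u1.symm
      · rw [q2 t' ht' h, hh t' ht', u2 t' h]

theorem Hyp.step1 {ε L L0 M N : ℕ}
    (hmerge : ∀ (V1 V2 : Subgroup G) (A1 A2 : Set G) (a b : G), QC D ε A1 → QC D ε A2 →
      Inv V1 A1 → Inv V2 A2 → a ∈ A1 → b ∈ A2 → (∀ a' ∈ A1, ∀ b' ∈ A2, D a b ≤ D a' b') →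
      L0 ≤ D a b → Function.Injective (Monoid.Coprod.lift V1.subtype V2.subtype) ∧
        ∃ m, Btw D a m b ∧ QC D (epsQ e ε)
          (hull (V1 ⊔ V2) {x | x ∈ A1 ∨ x ∈ A2 ∨ x ∈ bridge D a m b}))
    (hLM : L0 ≤ M) (hMN : 2 * N + e + 2 ≤ M) (hML : M < L) (hεε : ε ≤ epsQ e ε)
    {P : Set (Conf G ι κ)} {I : Finset ι} {K : Finset κ} {U : Subgroup G}
    (hP : Closed P I K) (hG : ∀ s ∈ P, Good D ε M I K s ∧ gen s I K = U)
    (hU : FreelyIndecomposable U)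
    (m1 : ∀ s ∈ P, ∀ i ∈ I, ∀ j ∈ I, i ≠ j → ∀ a ∈ s.A i, ∀ b ∈ s.A j, L ≤ D a b)
    (m2 : ∀ s ∈ P, ∀ i ∈ I, ∀ t ∈ K, ∀ a ∈ s.A i, ∀ b ∈ s.A i, L ≤ D a (s.h t * b))
    {s0 : Conf G ι κ} (hs0 : s0 ∈ P) {i0 j0 : ι} (hi0 : i0 ∈ I) (hj0 : j0 ∈ I) (hij : i0 ≠ j0)
    {a0 b0 : G} (ha0 : a0 ∈ s0.A i0) (hb0 : b0 ∈ s0.A j0) (hab0 : D a0 b0 = L)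
    (IH : ∀ P' : Set (Conf G ι κ), P'.Nonempty → Closed P' (I.erase j0) K →
      (∀ s ∈ P', Good D (epsQ e ε) N (I.erase j0) K s ∧ gen s (I.erase j0) K = U) →
      ∃ s ∈ P', ∃ i ∈ I.erase j0, s.V i = U) :
    ∃ s ∈ P, ∃ i ∈ I, s.V i = U := by
  have mg : ∀ s ∈ P, ∀ a ∈ s.A i0, ∀ b ∈ s.A j0, D a b = L → _ := fun s hs a ha b hb hab =>
    hmerge (s.V i0) (s.V j0) (s.A i0) (s.A j0) a b ((hG s hs).1.qc i0 hi0) ((hG s hs).1.qc j0 hj0)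
      ((hG s hs).1.inv i0 hi0) ((hG s hs).1.inv j0 hj0) ha hb
      (fun a' ha' b' hb' => hab ▸ m1 s hs i0 hi0 j0 hj0 hij a' ha' b' hb') (by omega)
  have hne : (PA D (epsQ e ε) L P I K i0 j0).Nonempty := by
    obtain ⟨-, m, hm, hqc⟩ := mg s0 hs0 a0 ha0 b0 hb0 hab0
    have hst : {x | x ∈ {x | x ∈ s0.A i0 ∨ x ∈ s0.A j0} ∨ x ∈ bridge D a0 m b0} =
        {x | x ∈ s0.A i0 ∨ x ∈ s0.A j0 ∨ x ∈ bridge D a0 m b0} := by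
      ext x; simp [or_assoc]
    refine ⟨⟨Function.update s0.V i0 (s0.V i0 ⊔ s0.V j0), Function.update s0.A i0
      (hull (s0.V i0 ⊔ s0.V j0) {x | x ∈ s0.A i0 ∨ x ∈ s0.A j0 ∨ x ∈ bridge D a0 m b0}), s0.h⟩,
      s0, hs0, a0, ha0, b0, hb0, m, hab0, hm, by simp, ?_, by simpa using hqc, ?_, fun _ _ => rfl⟩
    · rw [hst]; simp
    · intro i _ h _; simp [h]
  obtain ⟨s', hs', i, hi, hVi⟩ := IH _ hne (PA_closed H hi0 hj0 hij hP) (by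
    rintro s' ⟨s, hs, a, ha, b, hb, m, hab, hm, hV, hA, hqc, hoth, hh⟩
    refine ⟨?_, by rw [PA_gen H hi0 hj0 hij hV hoth hh]; exact (hG s hs).2⟩
    have hop : ∀ t ∈ K, ∀ w ∈ s'.V i0, ∀ w' ∈ s'.V i0, ∃ s1 ∈ P, s1.h t = w * s.h t * w' ∧
        (∀ i, s1.V i = s.V i ∧ s1.A i = s.A i) := by
      intro t ht w hw w' hw'
      have hle : s'.V i0 ≤ gen s I (K.erase t) := by
        rw [hV]; exact sup_le (V_le_gen hi0) (V_le_gen hj0)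
      obtain ⟨s1, hs1, u1, -, u3⟩ := hP.op2 hs ht (hle hw) (hle hw')
      exact ⟨s1, hs1, u1, u3⟩
    refine H.good_step (L := L) (i0 := i0) (hG s hs).1 hεε hMN hML (Finset.erase_subset _ _)
      (le_refl K) (fun i hi h => hoth i (Finset.mem_of_mem_erase hi) h (Finset.ne_of_mem_erase hi))
      hh (E := {x | x ∈ s.A i0 ∨ x ∈ s.A j0}) (le_refl _) (Or.inl ha) (Or.inr hb) hab
      ⟨a, Or.inl ha⟩ hm hA hqc ?_ ?_ ?_
    · intro w hw j hj hji y hy q hq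
      obtain ⟨hjj, hjI⟩ := Finset.mem_erase.1 hj
      have hle : s'.V i0 ≤ gen s (I.erase j) K := by
        rw [hV]
        exact sup_le (V_le_gen (Finset.mem_erase.2 ⟨Ne.symm hji, hi0⟩))
          (V_le_gen (Finset.mem_erase.2 ⟨Ne.symm hjj, hj0⟩))
      obtain ⟨s1, hs1, u1, u2, u3, u4⟩ := hP.op1 hs hjI (hle hw)
      have hy1 : w * y ∈ s1.A j := by rw [u2]; exact mul_mem_tr.2 hy
      rcases hq with hq | hq
      · exact m1 s1 hs1 i0 hi0 j hjI (Ne.symm hji) q (by rw [(u3 i0 (Ne.symm hji)).2]; exact hq) _ hy1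
      · exact m1 s1 hs1 j0 hj0 j hjI (Ne.symm hjj) q (by rw [(u3 j0 (Ne.symm hjj)).2]; exact hq) _ hy1
    · intro t ht w hw w' hw' q hq q' hq'
      obtain ⟨s1, hs1, u1, u3⟩ := hop t ht w hw w' hw'
      rw [← u1]
      have c1 : ∀ i ∈ I, ∀ j ∈ I, i ≠ j → ∀ q ∈ s.A i, ∀ q' ∈ s.A j, L ≤ D q (s1.h t * q') := by
        intro i hi j hj hij q hq q' hq'
        obtain ⟨s2, hs2, v1, v2, v3, v4⟩ := hP.op1 hs1 hj (g := s1.h t) (h_mem_gen ht)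
        exact m1 s2 hs2 i hi j hj hij q (by rw [(v3 i hij).2, (u3 i).2]; exact hq) _
          (by rw [v2, (u3 j).2]; exact mul_mem_tr.2 hq')
      rcases hq with hq | hq <;> rcases hq' with hq' | hq'
      · exact m2 s1 hs1 i0 hi0 t ht q (by rw [(u3 i0).2]; exact hq) q' (by rw [(u3 i0).2]; exact hq')
      · exact c1 i0 hi0 j0 hj0 hij q hq q' hq'
      · exact c1 j0 hj0 i0 hi0 hij.symm q hq q' hq'
      · exact m2 s1 hs1 j0 hj0 t ht q (by rw [(u3 j0).2]; exact hq) q' (by rw [(u3 j0).2]; exact hq')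
    · intro t ht w hw w' hw' x
      obtain ⟨s1, hs1, u1, u3⟩ := hop t ht w hw w' hw'
      rw [← u1]
      exact (hG s1 hs1).1.l3 t ht x)
  obtain ⟨s, hs, a, ha, b, hb, m, hab, hm, hV, hA, hqc, hoth, hh⟩ := hs'
  obtain ⟨hij', hiI⟩ := Finset.mem_erase.1 hi
  by_cases h : i = i0
  · subst h
    obtain ⟨hinj, -⟩ := mg s hs a ha b hb hab
    rw [hV] at hVi
    rcases fi_split hU hVi hinj with h | h
    · refine ⟨s, hs, j0, hj0, ?_⟩
      rw [← hVi, h, bot_sup_eq]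
    · refine ⟨s, hs, i, hi0, ?_⟩
      rw [← hVi, h, sup_bot_eq]
  · exact ⟨s, hs, i, hiI, by rw [← (hoth i hiI h hij').1]; exact hVi⟩
end main
end KW

namespace KW
section main
variable {G : Type*} [Group G] {D : G → G → ℕ} {e : ℕ} {ι κ : Type*}

theorem infCyclic_zpowers {h : G} {U : Subgroup G} (hU : Subgroup.zpowers h = U)
    (hh : ∀ n : ℕ, n ≠ 0 → h ^ n ≠ 1) : InfiniteCyclic U := by
  subst hU
  refine ⟨?_, inferInstance⟩
  have : ¬ IsOfFinOrder h := by
    rw [isOfFinOrder_iff_pow_eq_one]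
    rintro ⟨n, hn, h1⟩
    exact hh n (by omega) h1
  exact Set.infinite_coe_iff.2 (infinite_zpowers.2 this)

variable [DecidableEq ι] [DecidableEq κ]

/-- merged configurations, second type -/
def PB (D : G → G → ℕ) (ε L : ℕ) (P : Set (Conf G ι κ)) (I : Finset ι) (K : Finset κ) (i0 : ι)
    (t0 : κ) : Set (Conf G ι κ) :=
  {s' | ∃ s ∈ P, ∃ a ∈ s.A i0, ∃ b ∈ s.A i0, ∃ m, D a (s.h t0 * b) = L ∧
    Btw D a m (s.h t0 * b) ∧
    s'.V i0 = s.V i0 ⊔ Subgroup.zpowers (s.h t0) ∧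
    s'.A i0 = hull (s'.V i0) {x | x ∈ s.A i0 ∨ x ∈ bridge D a m (s.h t0 * b)} ∧
    QC D ε (s'.A i0) ∧
    (∀ i ∈ I, i ≠ i0 → s'.V i = s.V i ∧ s'.A i = s.A i) ∧ ∀ t ∈ K, t ≠ t0 → s'.h t = s.h t}

theorem PB_gen {s s' : Conf G ι κ} {I : Finset ι} {K : Finset κ} {i0 : ι} {t0 : κ} (hi0 : i0 ∈ I)
    (ht0 : t0 ∈ K)
    (h1 : s'.V i0 = s.V i0 ⊔ Subgroup.zpowers (s.h t0))
    (h2 : ∀ i ∈ I, i ≠ i0 → s'.V i = s.V i ∧ s'.A i = s.A i)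
    (h3 : ∀ t ∈ K, t ≠ t0 → s'.h t = s.h t) : gen s' I (K.erase t0) = gen s I K := by
  apply le_antisymm
  · refine gen_le (fun i hi => ?_) (fun t ht => ?_)
    · by_cases h : i = i0
      · subst h; rw [h1]
        exact sup_le (V_le_gen hi) (by rw [Subgroup.zpowers_le]; exact h_mem_gen ht0)
      · rw [(h2 i hi h).1]; exact V_le_gen hi
    · obtain ⟨h, ht⟩ := Finset.mem_erase.1 ht
      rw [h3 t ht h]; exact h_mem_gen ht
  · refine gen_le (fun i hi => ?_) (fun t ht => ?_)
    · by_cases h : i = i0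
      · subst h; exact le_trans (h1 ▸ le_sup_left) (V_le_gen hi0)
      · rw [← (h2 i hi h).1]; exact V_le_gen hi
    · by_cases h : t = t0
      · subst h
        have : Subgroup.zpowers (s.h t) ≤ gen s' I (K.erase t) :=
          le_trans (h1 ▸ le_sup_right) (V_le_gen hi0)
        exact this (Subgroup.mem_zpowers _)
      · rw [← h3 t ht h]; exact h_mem_gen (Finset.mem_erase.2 ⟨h, ht⟩)

variable (H : Hyp D e)
include H

theorem PB_closed {ε L : ℕ} {P : Set (Conf G ι κ)} {I : Finset ι} {K : Finset κ} {i0 : ι} {t0 : κ}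
    (hi0 : i0 ∈ I) (ht0 : t0 ∈ K) (hP : Closed P I K) :
    Closed (PB D ε L P I K i0 t0) I (K.erase t0) := by
  rintro s' ⟨s, hs, a, ha, b, hb, m, hab, hm, hV, hA, hqc, hoth, hh⟩ s'' hmove
  rcases hmove with ⟨i, hi, g, hg, q1, q2, q3, q4⟩ | ⟨t, ht, g, hg, q1, q2, q3⟩
  · by_cases h : i = i0
    · subst h
      have hg0 : g ∈ gen s (I.erase i) (K.erase t0) := by
        rw [← gen_congr (s' := s')]
        · exact hg
        · intro j hj
          simp only [Finset.mem_erase] at hj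
          exact (hoth j hj.2 hj.1).1
        · intro t ht
          exact hh t (Finset.mem_of_mem_erase ht) (Finset.ne_of_mem_erase ht)
      obtain ⟨s1, hs1, u1, u2, u3, u4⟩ := hP.op1 hs hi (g := g)
        (gen_mono (le_refl _) (Finset.erase_subset _ _) hg0)
      have hg1 : g ∈ gen s1 I (K.erase t0) := by
        refine gen_mono (Finset.erase_subset i _) (le_refl (K.erase t0)) ?_
        rw [gen_congr (s := s)]
        · exact hg0
        · intro j hj
          simp only [Finset.mem_erase] at hj
          exact (u3 j hj.1).1
        · exact fun t _ => u4 t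
      obtain ⟨s2, hs2, v1, v2, v3⟩ := hP.op2 hs1 ht0 hg1 (inv_mem hg1)
      have Vi : s2.V i = cj g (s.V i) := by rw [(v3 i).1, u1]
      have Ai : s2.A i = tr g (s.A i) := by rw [(v3 i).2, u2]
      have Ht : s2.h t0 = g * s.h t0 * g⁻¹ := by rw [v1, u4]
      have Hb : s2.h t0 * (g * b) = g * (s.h t0 * b) := by rw [Ht]; group
      refine ⟨s2, hs2, g * a, ?_, g * b, ?_, g * m, ?_, ?_, ?_, ?_, ?_, ?_, ?_⟩
      · rw [Ai]; exact mul_mem_tr.2 ha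
      · rw [Ai]; exact mul_mem_tr.2 hb
      · rw [Hb, H.inv]; exact hab
      · rw [Hb]; exact (H.btw_inv _).2 hm
      · rw [q1, hV, cj_sup, Vi, Ht, cj_zpowers]
      · rw [q2, q1, Ai, Hb, tr_bridge H, hA, ← hull_tr]; rfl
      · rw [q2]; exact H.qc_tr g hqc
      · intro j hj hji
        have := q3 j hj hji
        rw [this.1, this.2, (hoth j hj hji).1, (hoth j hj hji).2, (v3 j).1,
          (v3 j).2, (u3 j hji).1, (u3 j hji).2]
        exact ⟨rfl, rfl⟩
      · intro t ht htt; rw [q4 t (Finset.mem_erase.2 ⟨htt, ht⟩), hh t ht htt, v2 t htt, u4]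
    · have hle : gen s' (I.erase i) (K.erase t0) ≤ gen s (I.erase i) K := by
        rw [PB_gen (i0 := i0) (Finset.mem_erase.2 ⟨Ne.symm h, hi0⟩) ht0 hV
          (fun j hj => hoth j (Finset.mem_of_mem_erase hj)) hh]
      obtain ⟨s1, hs1, u1, u2, u3, u4⟩ := hP.op1 hs hi (hle hg)
      have q3' := q3 i0 hi0 (Ne.symm h)
      refine ⟨s1, hs1, a, ?_, b, ?_, m, by rw [u4]; exact hab, by rw [u4]; exact hm, ?_, ?_, ?_, ?_, ?_⟩
      · rw [(u3 i0 (Ne.symm h)).2]; exact ha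
      · rw [(u3 i0 (Ne.symm h)).2]; exact hb
      · rw [q3'.1, hV, (u3 i0 (Ne.symm h)).1, u4]
      · rw [q3'.2, q3'.1, hA, (u3 i0 (Ne.symm h)).2, u4]
      · rw [q3'.2]; exact hqc
      · intro j hj hji
        by_cases h' : j = i
        · subst h'; rw [q1, q2, u1, u2, (hoth j hj hji).1, (hoth j hj hji).2]
          exact ⟨rfl, rfl⟩
        · have := q3 j hj h'
          rw [this.1, this.2, (hoth j hj hji).1, (hoth j hj hji).2, (u3 j h').1,
            (u3 j h').2]
          exact ⟨rfl, rfl⟩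
      · intro t ht htt; rw [q4 t (Finset.mem_erase.2 ⟨htt, ht⟩), hh t ht htt, u4]
  · obtain ⟨htt, htK⟩ := Finset.mem_erase.1 ht
    have hg' : g ∈ gen s I (K.erase t) := by
      rw [← PB_gen (s' := s') (t0 := t0) hi0 (Finset.mem_erase.2 ⟨Ne.symm htt, ht0⟩) hV hoth
        (fun t' ht' => hh t' (Finset.mem_of_mem_erase ht')), Finset.erase_right_comm]
      exact hg
    have key : ∃ s1 ∈ P, s1.h t = s''.h t ∧ (∀ t', t' ≠ t → s1.h t' = s.h t') ∧
      (∀ i, s1.V i = s.V i ∧ s1.A i = s.A i) := by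
      rcases q1 with q1 | q1
      · obtain ⟨s1, hs1, u1, u2⟩ := hP.op2 hs htK hg' (one_mem _)
        exact ⟨s1, hs1, by rw [u1, q1, hh t htK htt, mul_one], u2⟩
      · obtain ⟨s1, hs1, u1, u2⟩ := hP.op2 hs htK (one_mem _) hg'
        exact ⟨s1, hs1, by rw [u1, q1, hh t htK htt, one_mul], u2⟩
    obtain ⟨s1, hs1, u1, u2, u3⟩ := key
    have q3' := q3 i0 hi0
    have u2' := u2 t0 (Ne.symm htt)
    refine ⟨s1, hs1, a, by rw [(u3 i0).2]; exact ha, b, by rw [(u3 i0).2]; exact hb, m,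
      by rw [u2']; exact hab, by rw [u2']; exact hm, ?_, ?_, ?_, ?_, ?_⟩
    · rw [q3'.1, hV, (u3 i0).1, u2']
    · rw [q3'.2, q3'.1, hA, (u3 i0).2, u2']
    · rw [q3'.2]; exact hqc
    · intro j hj hji
      have := q3 j hj
      rw [this.1, this.2, (hoth j hj hji).1, (hoth j hj hji).2, (u3 j).1, (u3 j).2]
      exact ⟨rfl, rfl⟩
    · intro t' ht' htt'
      by_cases h : t' = t
      · subst h; exact u1.symm
      · rw [q2 t' (Finset.mem_erase.2 ⟨htt', ht'⟩) h, hh t' ht' htt', u2 t' h]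

theorem Hyp.step2 {ε L L0 M N : ℕ}
    (hmerge : ∀ (V : Subgroup G) (A : Set G) (h a b : G), QC D ε A → Inv V A → a ∈ A → b ∈ A →
      (∀ a' ∈ A, ∀ b' ∈ A, D a (h*b) ≤ D a' (h*b')) → L0 ≤ D a (h*b) →
      (∀ v ∈ V, ∀ x, L0 < D x (h*v*x)) →
      Function.Injective (Monoid.Coprod.lift V.subtype (Subgroup.zpowers h).subtype) ∧
      (∀ n:ℕ, n ≠ 0 → h^n ≠ 1) ∧
      ∃ m, Btw D a m (h*b) ∧ QC D (epsQ e ε) (hull (V ⊔ Subgroup.zpowers h)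
        {x | x ∈ A ∨ x ∈ bridge D a m (h*b)}))
    (hLM : L0 ≤ M) (hMN : 2 * N + e + 2 ≤ M) (hML : M < L) (hεε : ε ≤ epsQ e ε)
    {P : Set (Conf G ι κ)} {I : Finset ι} {K : Finset κ} {U : Subgroup G}
    (hP : Closed P I K) (hG : ∀ s ∈ P, Good D ε M I K s ∧ gen s I K = U)
    (hU : FreelyIndecomposable U) (hU' : ¬ InfiniteCyclic U)
    (m1 : ∀ s ∈ P, ∀ i ∈ I, ∀ j ∈ I, i ≠ j → ∀ a ∈ s.A i, ∀ b ∈ s.A j, L ≤ D a b)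
    (m2 : ∀ s ∈ P, ∀ i ∈ I, ∀ t ∈ K, ∀ a ∈ s.A i, ∀ b ∈ s.A i, L ≤ D a (s.h t * b))
    {s0 : Conf G ι κ} (hs0 : s0 ∈ P) {i0 : ι} {t0 : κ} (hi0 : i0 ∈ I) (ht0 : t0 ∈ K)
    {a0 b0 : G} (ha0 : a0 ∈ s0.A i0) (hb0 : b0 ∈ s0.A i0) (hab0 : D a0 (s0.h t0 * b0) = L)
    (IH : ∀ P' : Set (Conf G ι κ), P'.Nonempty → Closed P' I (K.erase t0) →
      (∀ s ∈ P', Good D (epsQ e ε) N I (K.erase t0) s ∧ gen s I (K.erase t0) = U) →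
      ∃ s ∈ P', ∃ i ∈ I, s.V i = U) :
    ∃ s ∈ P, ∃ i ∈ I, s.V i = U := by
  have mg : ∀ s ∈ P, ∀ a ∈ s.A i0, ∀ b ∈ s.A i0, D a (s.h t0 * b) = L → _ :=
    fun s hs a ha b hb hab =>
    hmerge (s.V i0) (s.A i0) (s.h t0) a b ((hG s hs).1.qc i0 hi0)
      ((hG s hs).1.inv i0 hi0) ha hb
      (fun a' ha' b' hb' => hab ▸ m2 s hs i0 hi0 t0 ht0 a' ha' b' hb') (by omega) (by
        intro v hv x
        obtain ⟨s1, hs1, u1, -, -⟩ := hP.op2 hs ht0 (one_mem _) (V_le_gen hi0 hv)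
        have := (hG s1 hs1).1.l3 t0 ht0 x
        rw [u1, one_mul] at this
        omega)
  have hne : (PB D (epsQ e ε) L P I K i0 t0).Nonempty := by
    obtain ⟨-, -, m, hm, hqc⟩ := mg s0 hs0 a0 ha0 b0 hb0 hab0
    refine ⟨⟨Function.update s0.V i0 (s0.V i0 ⊔ Subgroup.zpowers (s0.h t0)),
      Function.update s0.A i0 (hull (s0.V i0 ⊔ Subgroup.zpowers (s0.h t0))
        {x | x ∈ s0.A i0 ∨ x ∈ bridge D a0 m (s0.h t0 * b0)}), s0.h⟩,
      s0, hs0, a0, ha0, b0, hb0, m, hab0, hm, by simp, by simp, by simpa using hqc, ?_,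
      fun _ _ _ => rfl⟩
    intro i _ h; simp [h]
  obtain ⟨s', hs', i, hi, hVi⟩ := IH _ hne (PB_closed H hi0 ht0 hP) (by
    rintro s' ⟨s, hs, a, ha, b, hb, m, hab, hm, hV, hA, hqc, hoth, hh⟩
    refine ⟨?_, by rw [PB_gen hi0 ht0 hV hoth hh]; exact (hG s hs).2⟩
    have hmem : s.h t0 ∈ s'.V i0 := by
      rw [hV]; exact (le_sup_right : _ ≤ s.V i0 ⊔ _) (Subgroup.mem_zpowers _)
    have hop : ∀ t ∈ K.erase t0, ∀ w ∈ s'.V i0, ∀ w' ∈ s'.V i0, ∃ s1 ∈ P,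
        s1.h t = w * s.h t * w' ∧ (∀ i, s1.V i = s.V i ∧ s1.A i = s.A i) := by
      intro t ht w hw w' hw'
      obtain ⟨htt, htK⟩ := Finset.mem_erase.1 ht
      have hle : s'.V i0 ≤ gen s I (K.erase t) := by
        rw [hV]; refine sup_le (V_le_gen hi0) ?_
        rw [Subgroup.zpowers_le]; exact h_mem_gen (Finset.mem_erase.2 ⟨Ne.symm htt, ht0⟩)
      obtain ⟨s1, hs1, u1, -, u3⟩ := hP.op2 hs htK (hle hw) (hle hw')
      exact ⟨s1, hs1, u1, u3⟩
    refine H.good_step (L := L) (i0 := i0) (hG s hs).1 hεε hMN hML (le_refl I)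
      (Finset.erase_subset _ _) hoth
      (fun t ht => hh t (Finset.mem_of_mem_erase ht) (Finset.ne_of_mem_erase ht))
      (E := {x | x ∈ s.A i0 ∨ ∃ y ∈ s.A i0, x = s.h t0 * y}) (E0 := s.A i0)
      (fun x hx => Or.inl hx) (Or.inl ha) (Or.inr ⟨b, hb, rfl⟩) hab ⟨a, ha⟩ hm hA hqc ?_ ?_ ?_
    · intro w hw j hj hji y hy q hq
      have hle : s'.V i0 ≤ gen s (I.erase j) K := by
        rw [hV]
        refine sup_le (V_le_gen (Finset.mem_erase.2 ⟨Ne.symm hji, hi0⟩)) ?_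
        rw [Subgroup.zpowers_le]; exact h_mem_gen ht0
      have base : ∀ w ∈ s'.V i0, ∀ q ∈ s.A i0, L ≤ D q (w * y) := by
        intro w hw q hq
        obtain ⟨s1, hs1, u1, u2, u3, u4⟩ := hP.op1 hs hj (hle hw)
        have hy1 : w * y ∈ s1.A j := by rw [u2]; exact mul_mem_tr.2 hy
        exact m1 s1 hs1 i0 hi0 j hj (Ne.symm hji) q
          (by rw [(u3 i0 (Ne.symm hji)).2]; exact hq) _ hy1
      rcases hq with hq | ⟨q1, hq, rfl⟩
      · exact base w hw q hq
      · have := base ((s.h t0)⁻¹ * w) (mul_mem (inv_mem hmem) hw) q1 hq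
        rw [← H.inv (s.h t0)⁻¹]
        simpa [mul_assoc] using this
    · intro t ht w hw w' hw' q hq q' hq'
      have base : ∀ w ∈ s'.V i0, ∀ w' ∈ s'.V i0, ∀ q ∈ s.A i0, ∀ q' ∈ s.A i0,
          L ≤ D q (w * s.h t * w' * q') := by
        intro w hw w' hw' q hq q' hq'
        obtain ⟨s1, hs1, u1, u3⟩ := hop t ht w hw w' hw'
        rw [← u1]
        exact m2 s1 hs1 i0 hi0 t (Finset.mem_of_mem_erase ht) q (by rw [(u3 i0).2]; exact hq) q'
          (by rw [(u3 i0).2]; exact hq')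
      have base2 : ∀ w ∈ s'.V i0, ∀ w' ∈ s'.V i0, ∀ q ∈ s.A i0, 
          L ≤ D q (w * s.h t * w' * q') := by
        intro w hw w' hw' q hq
        rcases hq' with hq' | ⟨q1, hq', rfl⟩
        · exact base w hw w' hw' q hq q' hq'
        · simpa [mul_assoc] using base w hw (w' * s.h t0) (mul_mem hw' hmem) q hq q1 hq'
      rcases hq with hq | ⟨q1, hq, rfl⟩
      · exact base2 w hw w' hw' q hq
      · have := base2 ((s.h t0)⁻¹ * w) (mul_mem (inv_mem hmem) hw) w' hw' q1 hq
        rw [← H.inv (s.h t0)⁻¹]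
        simpa [mul_assoc] using this
    · intro t ht w hw w' hw' x
      obtain ⟨s1, hs1, u1, u3⟩ := hop t ht w hw w' hw'
      rw [← u1]
      exact (hG s1 hs1).1.l3 t (Finset.mem_of_mem_erase ht) x)
  obtain ⟨s, hs, a, ha, b, hb, m, hab, hm, hV, hA, hqc, hoth, hh⟩ := hs'
  by_cases h : i = i0
  · subst h
    obtain ⟨hinj, hn, -⟩ := mg s hs a ha b hb hab
    rw [hV] at hVi
    rcases fi_split hU hVi hinj with h | h
    · rw [h, bot_sup_eq] at hVi
      exact absurd (infCyclic_zpowers hVi hn) hU'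
    · exact absurd (by simpa using h) (hn 1 one_ne_zero)
  · exact ⟨s, hs, i, hi, by rw [← (hoth i hi h).1]; exact hVi⟩

/-- The main proposition. -/
theorem Hyp.mainProp (n : ℕ) : ∀ ε : ℕ, ∃ M : ℕ, ∀ (P : Set (Conf G ι κ)) (I : Finset ι)
    (K : Finset κ) (U : Subgroup G), I.card + K.card ≤ n → I.Nonempty → P.Nonempty →
    Closed P I K → (∀ s ∈ P, Good D ε M I K s ∧ gen s I K = U) → FreelyIndecomposable U →
    ¬ InfiniteCyclic U → ∃ s ∈ P, ∃ i ∈ I, s.V i = U := by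
  induction n with
  | zero =>
    intro ε
    refine ⟨0, fun P I K U hn hI => ?_⟩
    have := hI.card_pos; omega
  | succ n IH =>
    intro ε
    obtain ⟨N, hN⟩ := IH (epsQ e ε)
    obtain ⟨L1, hL1⟩ := H.merge1 ε
    obtain ⟨L2, hL2⟩ := H.merge2 ε
    have hεε : ε ≤ epsQ e ε := by unfold epsQ eps1; omega
    refine ⟨max (max L1 L2) (2 * N + e + 2), fun P I K U hn hI hPne hP hG hU hU' => ?_⟩
    set M := max (max L1 L2) (2 * N + e + 2) with hM
    have q1 : L1 ≤ M := le_trans (le_max_left _ _) (le_max_left _ _)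
    have q2 : L2 ≤ M := le_trans (le_max_right _ _) (le_max_left _ _)
    have q3 : 2 * N + e + 2 ≤ M := le_max_right _ _
    let T1 : ℕ → Prop := fun L => ∃ s ∈ P, ∃ i ∈ I, ∃ j ∈ I, i ≠ j ∧ ∃ a ∈ s.A i, ∃ b ∈ s.A j,
      D a b = L
    let T2 : ℕ → Prop := fun L => ∃ s ∈ P, ∃ i ∈ I, ∃ t ∈ K, ∃ a ∈ s.A i, ∃ b ∈ s.A i,
      D a (s.h t * b) = L
    obtain ⟨s0, hs0⟩ := hPne
    obtain ⟨i0, hi0⟩ := hI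
    by_cases hT : ∃ L, T1 L ∨ T2 L
    · classical
      set L := Nat.find hT with hL
      have m1 : ∀ s ∈ P, ∀ i ∈ I, ∀ j ∈ I, i ≠ j → ∀ a ∈ s.A i, ∀ b ∈ s.A j, L ≤ D a b :=
        fun s hs i hi j hj hij a ha b hb =>
          Nat.find_min' hT (Or.inl ⟨s, hs, i, hi, j, hj, hij, a, ha, b, hb, rfl⟩)
      have m2 : ∀ s ∈ P, ∀ i ∈ I, ∀ t ∈ K, ∀ a ∈ s.A i, ∀ b ∈ s.A i, L ≤ D a (s.h t * b) :=
        fun s hs i hi t ht a ha b hb =>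
          Nat.find_min' hT (Or.inr ⟨s, hs, i, hi, t, ht, a, ha, b, hb, rfl⟩)
      rcases Nat.find_spec hT with h | h
      · obtain ⟨s, hs, i, hi, j, hj, hij, a, ha, b, hb, hab⟩ := h
        have hML : M < L := by
          have := (hG s hs).1.l1 i hi j hj hij a ha b hb
          rw [hab] at this; exact this
        refine H.step1 hL1 q1 q3 hML hεε hP hG hU m1 m2 hs hi hj hij ha hb hab ?_
        intro P' h1 h2 h3
        have hc := Finset.card_erase_of_mem hj
        exact hN P' _ _ U (by have := Finset.card_pos.2 ⟨j, hj⟩; omega)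
          ⟨i, Finset.mem_erase.2 ⟨hij, hi⟩⟩ h1 h2 h3 hU hU'
      · obtain ⟨s, hs, i, hi, t, ht, a, ha, b, hb, hab⟩ := h
        have hML : M < L := by
          have := (hG s hs).1.l2 i hi t ht a ha b hb
          rw [hab] at this; exact this
        refine H.step2 hL2 q2 q3 hML hεε hP hG hU hU' m1 m2 hs hi ht ha hb hab ?_
        intro P' h1 h2 h3
        have hc := Finset.card_erase_of_mem ht
        exact hN P' _ _ U (by have := Finset.card_pos.2 ⟨t, ht⟩; omega)
          ⟨i, hi⟩ h1 h2 h3 hU hU'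
    · refine ⟨s0, hs0, i0, hi0, ?_⟩
      have hK : ∀ t, t ∉ K := by
        intro t ht
        obtain ⟨a, ha⟩ := (hG s0 hs0).1.ne i0 hi0
        exact hT ⟨_, Or.inr ⟨s0, hs0, i0, hi0, t, ht, a, ha, a, ha, rfl⟩⟩
      have hI' : ∀ j ∈ I, j = i0 := by
        intro j hj
        by_contra hne
        obtain ⟨a, ha⟩ := (hG s0 hs0).1.ne i0 hi0
        obtain ⟨b, hb⟩ := (hG s0 hs0).1.ne j hj
        exact hT ⟨_, Or.inl ⟨s0, hs0, i0, hi0, j, hj, Ne.symm hne, a, ha, b, hb, rfl⟩⟩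
      rw [← (hG s0 hs0).2]
      refine le_antisymm (V_le_gen hi0) (gen_le (fun j hj => by rw [hI' j hj]) (fun t ht => absurd ht (hK t)))
end main
end KW

namespace KW
section geo
variable {X : Type*} [MetricSpace X]

theorem seg_btw {s : Set X} {x y p : X} (hs : IsGeodesicSegment s x y) (hp : p ∈ s) :
    dist x p + dist p y = dist x y := by
  obtain ⟨b, f, hb, rfl, rfl, hf, rfl⟩ := hs
  obtain ⟨u, hu, rfl⟩ := hp
  rw [hf 0 ⟨le_refl _, hb⟩ u hu, hf u hu b ⟨hb, le_refl _⟩, hf 0 ⟨le_refl _, hb⟩ b ⟨hb, le_refl _⟩]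
  rw [abs_of_nonpos (by linarith [hu.1]), abs_of_nonpos (by linarith [hu.2]),
    abs_of_nonpos (by linarith)]
  ring

theorem seg_exists_btw (hX : GeodesicSpace X) {x z y : X}
    (h : dist x z + dist z y = dist x y) : ∃ s, IsGeodesicSegment s x y ∧ z ∈ s := by
  obtain ⟨s1, b1, f1, hb1, rfl, rfl, hf1, -⟩ := hX x z
  obtain ⟨s2, b2, f2, hb2, h20, rfl, hf2, -⟩ := hX (f1 b1) y
  have e1 : dist (f1 0) (f1 b1) = b1 := by
    rw [hf1 0 ⟨le_refl _, hb1⟩ b1 ⟨hb1, le_refl _⟩, abs_of_nonpos (by linarith)]; ring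
  have e2 : dist (f1 b1) (f2 b2) = b2 := by
    rw [← h20, hf2 0 ⟨le_refl _, hb2⟩ b2 ⟨hb2, le_refl _⟩, abs_of_nonpos (by linarith)]; ring
  rw [e1, e2] at h
  set f : ℝ → X := fun u => if u ≤ b1 then f1 u else f2 (u - b1) with hf
  have fl : ∀ u, u ≤ b1 → f u = f1 u := fun u hu => by simp [hf, hu]
  have fr : ∀ u, b1 < u → f u = f2 (u - b1) := fun u hu => by simp [hf, not_le.2 hu]
  have fb : f (b1 + b2) = f2 b2 := by
    rcases hb2.eq_or_lt with h0 | h0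
    · rw [← h0, add_zero, fl b1 (le_refl _), h20]
    · rw [fr _ (by linarith)]; congr 1; ring
  have cross : ∀ u v, 0 ≤ u → u ≤ b1 → b1 < v → v ≤ b1 + b2 →
      dist (f u) (f v) = v - u := by
    intro u v hu hu1 hv hv1
    rw [fl u hu1, fr v hv]
    have d1 := hf1 u ⟨hu, hu1⟩ b1 ⟨hb1, le_refl _⟩
    have d2 := hf2 0 ⟨le_refl _, hb2⟩ (v - b1) ⟨by linarith, by linarith⟩
    have d3 := hf1 0 ⟨le_refl _, hb1⟩ u ⟨hu, hu1⟩
    have d4 := hf2 (v - b1) ⟨by linarith, by linarith⟩ b2 ⟨hb2, le_refl _⟩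
    rw [abs_of_nonpos (by linarith)] at d1 d2 d3 d4
    rw [h20] at d2
    have t1 := dist_triangle (f1 u) (f1 b1) (f2 (v - b1))
    have t2 := dist_triangle4 (f1 0) (f1 u) (f2 (v - b1)) (f2 b2)
    linarith
  refine ⟨f '' Set.Icc 0 (b1 + b2), ⟨b1 + b2, f, by linarith, fl 0 hb1, fb, ?_, rfl⟩,
    ⟨b1, ⟨hb1, by linarith⟩, fl b1 (le_refl _)⟩⟩
  rintro u ⟨hu0, hu1⟩ v ⟨hv0, hv1⟩
  rcases le_or_gt u b1 with hu | hu <;> rcases le_or_gt v b1 with hv | hv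
  · rw [fl u hu, fl v hv, hf1 u ⟨hu0, hu⟩ v ⟨hv0, hv⟩]
  · rw [cross u v hu0 hu hv hv1, abs_of_nonpos (by linarith)]; ring
  · rw [dist_comm, cross v u hv0 hv hu hu1, abs_of_nonneg (by linarith)]
  · rw [fr u hu, fr v hv, hf2 _ ⟨by linarith, by linarith⟩ _ ⟨by linarith, by linarith⟩]
    congr 1; ring

theorem exists_near {δ : ℝ} (hX : DeltaHyperbolic δ X) {s : Set X} {x z : X} (w : X)
    (hs : IsGeodesicSegment s x z) :
    ∃ p ∈ s, 2 * dist w p ≤ dist w x + dist w z - dist x z + 4 * δ + 2 := by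
  obtain ⟨s2, hs2⟩ := hX.1 z w
  obtain ⟨s3, hs3⟩ := hX.1 x w
  have thin := hX.2 x z w s s2 s3 hs hs2 hs3
  have hs' := hs
  obtain ⟨b, f, hb, h0, hb1, hf, hsf⟩ := hs'
  have mem : ∀ u ∈ Set.Icc 0 b, f u ∈ s := fun u hu => hsf ▸ ⟨u, hu, rfl⟩
  have hδ : 0 ≤ δ := by
    obtain ⟨q, -, hq⟩ := thin (f 0) (mem 0 ⟨le_refl _, hb⟩)
    exact dist_nonneg.trans hq
  let Q : ℝ → Prop := fun u => ∃ q ∈ s3, dist (f u) q ≤ δ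
  let R : ℝ → Prop := fun u => ∃ q ∈ s2, dist (f u) q ≤ δ
  have hQR : ∀ u ∈ Set.Icc 0 b, ¬ R u → Q u := by
    intro u hu hR
    obtain ⟨q, hq | hq, hd⟩ := thin (f u) (mem u hu)
    · exact absurd ⟨q, hq, hd⟩ hR
    · exact ⟨q, hq, hd⟩
  have hQ0 : Q 0 := by
    refine ⟨x, ?_, by rw [h0, dist_self]; exact hδ⟩
    obtain ⟨b', f', hb', h0', -, -, rfl⟩ := hs3
    exact ⟨0, ⟨le_refl _, hb'⟩, h0'⟩
  have hRb : R b := by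
    refine ⟨z, ?_, by rw [hb1, dist_self]; exact hδ⟩
    obtain ⟨b', f', hb', h0', -, -, rfl⟩ := hs2
    exact ⟨0, ⟨le_refl _, hb'⟩, h0'⟩
  have hmin : ∀ n : ℕ, min (n : ℝ) b ∈ Set.Icc 0 b := fun n =>
    ⟨le_min (Nat.cast_nonneg n) hb, min_le_right _ _⟩
  have hex : ∃ n : ℕ, R (min (n : ℝ) b) := by
    obtain ⟨n, hn⟩ := exists_nat_ge b
    exact ⟨n, by rw [min_eq_right hn]; exact hRb⟩
  have key : ∃ u ∈ Set.Icc 0 b, ∃ v ∈ Set.Icc 0 b, Q u ∧ R v ∧ |u - v| ≤ 1 := by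
    classical
    set n := Nat.find hex with hn
    have hRn : R (min (n : ℝ) b) := Nat.find_spec hex
    rcases Nat.eq_zero_or_pos n with h | h
    · refine ⟨0, ⟨le_refl _, hb⟩, 0, ⟨le_refl _, hb⟩, hQ0, ?_, by simp⟩
      rw [h] at hRn
      simpa [hb] using hRn
    · have hnR := Nat.find_min hex (m := n - 1) (by omega)
      refine ⟨_, hmin (n - 1), _, hmin n, hQR _ (hmin _) hnR, hRn, ?_⟩
      have : ((n - 1 : ℕ) : ℝ) = n - 1 := by rw [Nat.cast_sub h]; simp
      rw [this]
      calc |min ((n : ℝ) - 1) b - min (n : ℝ) b| ≤ max |((n : ℝ) - 1) - n| |b - b| :=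
            abs_min_sub_min_le_max _ _ _ _
        _ ≤ 1 := by simp
  obtain ⟨u, hu, v, hv, ⟨q1, hq1, d1⟩, ⟨q2, hq2, d2⟩, huv⟩ := key
  refine ⟨f u, mem u hu, ?_⟩
  have g1 := seg_btw hs3 hq1
  have g2 := seg_btw hs2 hq2
  have g3 := seg_btw hs (mem u hu)
  have g4 : dist (f u) (f v) ≤ 1 := by rw [hf u hu v hv]; exact huv
  have t1 := dist_triangle x q1 (f u)
  have t2 := dist_triangle (f u) q1 w
  have t3 := dist_triangle (f u) (f v) q2
  have t4 := dist_triangle (f u) q2 w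
  have t5 := dist_triangle z q2 (f u)
  rw [dist_comm w (f u), dist_comm w x, dist_comm w z]
  rw [dist_comm q1 (f u)] at t1
  rw [dist_comm q2 (f u)] at t5
  rw [dist_comm (f u) z] at g3
  have t6 := dist_triangle x q1 (f u)
  linarith

theorem four_point {δ : ℝ} (hX : DeltaHyperbolic δ X) (x y z w : X) :
    dist x z + dist y w ≤ dist x y + dist z w + (6 * δ + 2) ∨
    dist x z + dist y w ≤ dist y z + dist x w + (6 * δ + 2) := by
  obtain ⟨s, hs⟩ := hX.1 x z
  obtain ⟨s2, hs2⟩ := hX.1 z y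
  obtain ⟨s3, hs3⟩ := hX.1 x y
  obtain ⟨p, hp, hwp⟩ := exists_near hX w hs
  obtain ⟨q, hq | hq, hd⟩ := hX.2 x z y s s2 s3 hs hs2 hs3 p hp
  · right
    have := seg_btw hs2 hq
    have t1 := dist_triangle z q w
    have t2 := dist_triangle y q w
    have t3 := dist_triangle q p w
    rw [dist_comm q p, dist_comm p w] at t3
    rw [dist_comm q y] at this
    rw [dist_comm w x, dist_comm w z] at hwp
    rw [dist_comm y z]
    linarith
  · left
    have := seg_btw hs3 hq
    have t1 := dist_triangle x q w
    have t2 := dist_triangle y q w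
    have t3 := dist_triangle q p w
    rw [dist_comm q p, dist_comm p w] at t3
    rw [dist_comm q y] at this
    rw [dist_comm w x, dist_comm w z] at hwp
    linarith
end geo

section words
variable {G : Type*} [Group G] {S : Set G}

theorem wl_le {L : List G} (hL : ∀ y ∈ L, y ∈ S ∨ y⁻¹ ∈ S) : wordLength S L.prod ≤ L.length := by
  apply Nat.sInf_le
  exact ⟨fun i => L.get i, fun i => hL _ (List.get_mem _ _), by rw [List.ofFn_get]⟩

theorem wl_spec (hgen : Subgroup.closure S = ⊤) (g : G) :
    ∃ L : List G, L.length = wordLength S g ∧ (∀ y ∈ L, y ∈ S ∨ y⁻¹ ∈ S) ∧ L.prod = g := by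
  have hne : {n : ℕ | ∃ f : Fin n → G, (∀ i, f i ∈ S ∨ (f i)⁻¹ ∈ S) ∧
      (List.ofFn f).prod = g}.Nonempty := by
    have hg : g ∈ (Subgroup.closure S).toSubmonoid := by rw [hgen]; trivial
    rw [Subgroup.closure_toSubmonoid] at hg
    obtain ⟨L, hL, hp⟩ := Submonoid.exists_list_of_mem_closure hg
    exact ⟨L.length, fun i => L.get i, fun i => hL _ (List.get_mem _ _), by
      rw [List.ofFn_get]; exact hp⟩
  obtain ⟨f, hf, hp⟩ := Nat.sInf_mem hne
  refine ⟨List.ofFn f, by rw [List.length_ofFn]; rfl, ?_, hp⟩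
  intro y hy
  rw [List.mem_ofFn] at hy
  obtain ⟨i, rfl⟩ := hy
  exact hf i

/-- the word metric -/
def wD (S : Set G) (x y : G) : ℕ := wordLength S (x⁻¹ * y)

variable {X : Type*} [MetricSpace X] [MulAction G X] {ι : G → X}

theorem mkHyp {S : Finset G} (hgen : Subgroup.closure (S : Set G) = ⊤)
    (hCay : IsCayleyGraph G (S : Set G) X ι)
    {δ : ℝ} (hδ : DeltaHyperbolic δ X) (hATF : AlmostTorsionFree G) :
    ∃ e, Hyp (wD (S : Set G)) e := by
  obtain ⟨-, -, hinj, -, hdist, -⟩ := hCay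
  have hd : ∀ x y, (wD (S : Set G) x y : ℝ) = dist (ι x) (ι y) := fun x y => (hdist x y).symm
  have tri : ∀ x y z, wD (S : Set G) x z ≤ wD (S : Set G) x y + wD (S : Set G) y z := by
    intro x y z
    have := dist_triangle (ι x) (ι y) (ι z)
    rw [← hd, ← hd, ← hd] at this
    exact_mod_cast this
  have inv : ∀ g x y, wD (S : Set G) (g * x) (g * y) = wD (S : Set G) x y := by
    intro g x y; unfold wD; congr 1; group
  have self : ∀ x, wD (S : Set G) x x = 0 := by
    intro x
    have := hd x x
    rw [dist_self] at this
    exact_mod_cast this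
  have eq_of : ∀ x y, wD (S : Set G) x y = 0 → x = y := by
    intro x y h
    have := hd x y
    rw [h, Nat.cast_zero] at this
    exact hinj (dist_eq_zero.1 this.symm)
  have mid : ∀ x y t, t ≤ wD (S : Set G) x y → ∃ z, wD (S : Set G) x z = t ∧
      wD (S : Set G) z y + t = wD (S : Set G) x y := by
    intro x y t ht
    obtain ⟨L, hl, hL, hp⟩ := wl_spec hgen (x⁻¹ * y)
    change L.length = wD (S : Set G) x y at hl
    refine ⟨x * (L.take t).prod, ?_⟩
    have h1 : wD (S : Set G) x (x * (L.take t).prod) ≤ t := by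
      unfold wD
      rw [inv_mul_cancel_left]
      refine (wl_le (fun y hy => hL y (List.mem_of_mem_take hy))).trans ?_
      simp
    have h2 : wD (S : Set G) (x * (L.take t).prod) y ≤ L.length - t := by
      unfold wD
      have : (x * (L.take t).prod)⁻¹ * y = (L.drop t).prod := by
        rw [inv_mul_eq_iff_eq_mul, mul_assoc, List.prod_take_mul_prod_drop, hp]; group
      rw [this]
      refine (wl_le (fun y hy => hL y (List.mem_of_mem_drop hy))).trans ?_
      simp
    have := tri x (x * (L.take t).prod) y
    omega
  have ball : ∀ r, {x | wD (S : Set G) 1 x ≤ r}.Finite := by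
    intro r
    induction r with
    | zero =>
      refine (Set.finite_singleton (1 : G)).subset ?_
      intro x hx
      exact (eq_of 1 x (Nat.le_zero.1 hx)).symm
    | succ r ih =>
      have hfin : {g : G | g ∈ S ∨ g⁻¹ ∈ S}.Finite := by
        have h1 : {g : G | g ∈ S}.Finite := S.finite_toSet
        have h2 : {g : G | g⁻¹ ∈ S}.Finite :=
          Set.Finite.preimage (inv_injective.injOn) S.finite_toSet
        exact h1.union h2
      refine (ih.union (Set.Finite.image2 (fun a b => a * b) ih hfin)).subset ?_
      intro x hx
      rcases Nat.lt_or_ge (wD (S : Set G) 1 x) (r + 1) with h | h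
      · exact Or.inl (Nat.lt_succ_iff.1 h)
      · right
        have hx' : wD (S : Set G) 1 x = r + 1 := le_antisymm hx h
        obtain ⟨z, h1, h2⟩ := mid 1 x r (by omega)
        obtain ⟨L, hl, hL, hp⟩ := wl_spec hgen (z⁻¹ * x)
        have hl1 : L.length = 1 := by rw [hl]; change wD (S : Set G) z x = 1; omega
        obtain ⟨g, rfl⟩ := List.length_eq_one_iff.1 hl1
        refine ⟨z, h1.le, g, hL g (by simp), ?_⟩
        simp at hp
        show z * g = x
        rw [hp]; group
  refine ⟨⌈6 * δ + 2⌉₊, ⟨?_, ?_, ?_, ?_, ?_, ?_, ?_, ?_, ?_⟩⟩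
  · exact self
  · exact eq_of
  · intro x y
    have := dist_comm (ι x) (ι y)
    rw [← hd, ← hd] at this
    exact_mod_cast this
  · exact tri
  · exact inv
  · exact mid
  · intro x y z w
    have hc := Nat.le_ceil (6 * δ + 2)
    rcases four_point hδ (ι x) (ι z) (ι y) (ι w) with h | h
    · left
      rw [← hd, ← hd, ← hd, ← hd] at h
      have h' : (wD (S : Set G) x y : ℝ) + wD (S : Set G) z w ≤ wD (S : Set G) x z +
        wD (S : Set G) y w + (⌈6 * δ + 2⌉₊ : ℝ) := by linarith
      exact_mod_cast h'
    · right
      rw [dist_comm (ι z) (ι y), ← hd, ← hd, ← hd, ← hd] at h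
      have h' : (wD (S : Set G) x y : ℝ) + wD (S : Set G) z w ≤ wD (S : Set G) x w +
        wD (S : Set G) y z + (⌈6 * δ + 2⌉₊ : ℝ) := by linarith
      exact_mod_cast h'
  · exact ball
  · exact hATF

theorem qc_of_QCSubgroup {S : Finset G} (hCay : IsCayleyGraph G (S : Set G) X ι)
    {H : Subgroup G} (hH : QCSubgroup X ι H) : ∃ ε, QC (wD (S : Set G)) ε (H : Set G) := by
  obtain ⟨-, -, hinj, hX, hdist, -⟩ := hCay
  have hd : ∀ x y, (wD (S : Set G) x y : ℝ) = dist (ι x) (ι y) := fun x y => (hdist x y).symm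
  obtain ⟨ε, hε, hq⟩ := hH
  refine ⟨⌈ε⌉₊, ?_⟩
  intro a ha b hb z hz
  unfold Btw at hz
  have hz' : dist (ι a) (ι z) + dist (ι z) (ι b) = dist (ι a) (ι b) := by
    rw [← hd, ← hd, ← hd]; exact_mod_cast hz
  obtain ⟨s, hs, hzs⟩ := seg_exists_btw hX hz'
  obtain ⟨_, ⟨h, hh, rfl⟩, hdh⟩ := hq _ ⟨a, ha, rfl⟩ _ ⟨b, hb, rfl⟩ s hs _ hzs
  refine ⟨h, hh, ?_⟩
  rw [← hd] at hdh
  exact_mod_cast hdh.trans (Nat.le_ceil ε)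
end words
end KW

namespace KW
section nielsen
variable {G : Type*} [Group G] {k : ℕ}

theorem NE.refl (f : Fin k → G) : NielsenEq f f := Relation.ReflTransGen.refl

theorem NE.trans {f g h : Fin k → G} (h1 : NielsenEq f g) (h2 : NielsenEq g h) : NielsenEq f h :=
  Relation.ReflTransGen.trans h1 h2

theorem NE.inv (f : Fin k → G) (i : Fin k) : NielsenEq f (Function.update f i (f i)⁻¹) :=
  Relation.ReflTransGen.single (Or.inl ⟨i, fun j hj => by simp [hj], by simp⟩)

theorem NE.mul (f : Fin k → G) {i j : Fin k} (h : i ≠ j) :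
    NielsenEq f (Function.update f i (f i * f j)) :=
  Relation.ReflTransGen.single (Or.inr (Or.inl ⟨i, j, h, fun j hj => by simp [hj], by simp⟩))

theorem NE.swap (f : Fin k → G) (i j : Fin k) : NielsenEq f (f ∘ Equiv.swap i j) := by
  by_cases h : i = j
  · subst h; simp; exact NE.refl f
  · exact Relation.ReflTransGen.single (Or.inr (Or.inr ⟨i, j, h, rfl⟩))

theorem NE.perm (σ : Equiv.Perm (Fin k)) : ∀ f : Fin k → G, NielsenEq f (f ∘ σ) := by
  induction σ using Equiv.Perm.swap_induction_on with
  | one => intro f; exact NE.refl f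
  | swap_mul σ x y _ ih =>
    intro f
    have := NE.trans (NE.swap f x y) (ih _)
    exact this

theorem NE.mul_inv (f : Fin k → G) {i j : Fin k} (h : i ≠ j) :
    NielsenEq f (Function.update f i (f i * (f j)⁻¹)) := by
  have h1 := NE.inv f j
  have h2 := NE.mul (Function.update f j (f j)⁻¹) h
  have h3 := NE.inv (Function.update (Function.update f j (f j)⁻¹) i
    (Function.update f j (f j)⁻¹ i * Function.update f j (f j)⁻¹ j)) j
  have := NE.trans (NE.trans h1 h2) h3
  convert this using 1
  funext t
  by_cases ht : t = i
  · subst ht; simp [h]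
  · by_cases ht' : t = j
    · subst ht'; simp [Ne.symm h]
    · simp [ht, ht']

theorem NE.symm {f g : Fin k → G} (h : NielsenEq f g) : NielsenEq g f := by
  induction h with
  | refl => exact NE.refl f
  | @tail b c _ hbc ih =>
    refine NE.trans ?_ ih
    rcases hbc with ⟨i, h1, h2⟩ | ⟨i, j, hij, h1, h2⟩ | ⟨i, j, hij, rfl⟩
    · have := NE.inv c i
      convert this using 1
      funext t
      by_cases ht : t = i
      · subst ht; simp [h2]
      · simp [ht, h1]
    · have := NE.mul_inv c hij
      convert this using 1
      funext t
      by_cases ht : t = i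
      · subst ht; simp [h2, h1 j (Ne.symm hij)]
      · simp [ht, h1]
    · have := NE.swap (b ∘ Equiv.swap i j) i j
      convert this using 1
      funext t; simp

theorem NE.closure {f g : Fin k → G} (h : NielsenEq f g) :
    Subgroup.closure (Set.range g) = Subgroup.closure (Set.range f) := by
  have key : ∀ {f g : Fin k → G}, NielsenEq f g →
      Subgroup.closure (Set.range g) ≤ Subgroup.closure (Set.range f) := by
    intro f g h
    induction h with
    | refl => exact le_refl _
    | @tail b c _ hbc ih =>
      refine le_trans ?_ ih
      rw [Subgroup.closure_le]
      have hb : ∀ t, b t ∈ Subgroup.closure (Set.range b) := fun t =>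
        Subgroup.subset_closure ⟨t, rfl⟩
      rintro _ ⟨t, rfl⟩
      rcases hbc with ⟨i, h1, h2⟩ | ⟨i, j, hij, h1, h2⟩ | ⟨i, j, hij, rfl⟩
      · by_cases ht : t = i
        · subst ht; rw [h2]; exact inv_mem (hb t)
        · rw [h1 t ht]; exact hb t
      · by_cases ht : t = i
        · subst ht; rw [h2]; exact mul_mem (hb t) (hb j)
        · rw [h1 t ht]; exact hb t
      · exact hb _
  exact le_antisymm (key h) (key (NE.symm h))

theorem NE.mulRight (f : Fin k → G) (i : Fin k) {g : G}
    (hg : g ∈ Subgroup.closure (f '' {j | j ≠ i})) :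
    NielsenEq f (Function.update f i (f i * g)) := by
  have key : ∀ f' : Fin k → G, (∀ j, j ≠ i → f' j = f j) →
      NielsenEq f' (Function.update f' i (f' i * g)) := by
    induction hg using Subgroup.closure_induction with
    | mem y hy =>
      obtain ⟨j, hj, rfl⟩ := hy
      intro f' hf'
      rw [← hf' j hj]
      exact NE.mul f' (Ne.symm hj)
    | one => intro f' _; simp; exact NE.refl f'
    | mul a b _ _ iha ihb =>
      intro f' hf'
      have h1 := iha f' hf'
      have h2 := ihb (Function.update f' i (f' i * a)) (fun j hj => by simp [hj, hf' j hj])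
      have := NE.trans h1 h2
      simpa [mul_assoc] using this
    | inv a _ iha =>
      intro f' hf'
      have h2 := iha (Function.update f' i (f' i * a⁻¹)) (fun j hj => by simp [hj, hf' j hj])
      have := NE.symm h2
      simpa [mul_assoc] using this
  exact key f (fun _ _ => rfl)

theorem NE.mulLeft (f : Fin k → G) (i : Fin k) {g : G}
    (hg : g ∈ Subgroup.closure (f '' {j | j ≠ i})) :
    NielsenEq f (Function.update f i (g * f i)) := by
  have h1 := NE.inv f i
  have hg' : g⁻¹ ∈ Subgroup.closure (Function.update f i (f i)⁻¹ '' {j | j ≠ i}) := by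
    have : Function.update f i (f i)⁻¹ '' {j | j ≠ i} = f '' {j | j ≠ i} :=
      Set.image_congr (fun j hj => by simp [show j ≠ i from hj])
    rw [this]; exact inv_mem hg
  have h2 := NE.mulRight _ i hg'
  have := NE.trans (NE.trans h1 h2) (NE.inv _ i)
  simpa using this

theorem NE.conj1 (f : Fin k → G) (i : Fin k) {g : G}
    (hg : g ∈ Subgroup.closure (f '' {j | j ≠ i})) :
    NielsenEq f (Function.update f i (g * f i * g⁻¹)) := by
  have h1 := NE.mulLeft f i hg
  have hg' : g⁻¹ ∈ Subgroup.closure (Function.update f i (g * f i) '' {j | j ≠ i}) := by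
    have : Function.update f i (g * f i) '' {j | j ≠ i} = f '' {j | j ≠ i} :=
      Set.image_congr (fun j hj => by simp [show j ≠ i from hj])
    rw [this]; exact inv_mem hg
  have := NE.trans h1 (NE.mulRight _ i hg')
  simpa using this

/-- conjugate the entries in `B` by `y` -/
def cjB (f : Fin k → G) (B : Finset (Fin k)) (y : G) : Fin k → G :=
  fun t => if t ∈ B then y * f t * y⁻¹ else f t

theorem NE.conjB (f : Fin k → G) (B : Finset (Fin k)) {g : G}
    (hg : g ∈ Subgroup.closure (f '' {j | j ∉ B})) : NielsenEq f (cjB f B g) := by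
  have key : ∀ B' : Finset (Fin k), B' ⊆ B → NielsenEq f (cjB f B' g) := by
    intro B'
    induction B' using Finset.induction_on with
    | empty => intro _; exact NE.refl f
    | insert a B' ha ih =>
      intro hB
      have h1 := ih (fun x hx => hB (Finset.mem_insert_of_mem hx))
      have haB : a ∈ B := hB (Finset.mem_insert_self _ _)
      have hg' : g ∈ Subgroup.closure (cjB f B' g '' {j | j ≠ a}) := by
        refine Subgroup.closure_mono ?_ hg
        rintro _ ⟨j, hj, rfl⟩
        refine ⟨j, fun h => hj (h ▸ haB), ?_⟩
        have : j ∉ B' := fun h => hj (hB (Finset.mem_insert_of_mem h))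
        simp [cjB, this]
      have := NE.trans h1 (NE.conj1 _ a hg')
      convert this using 1
      funext t
      by_cases ht : t = a
      · subst ht; simp [cjB, ha]
      · simp [cjB, ht]
  exact key B (le_refl _)

theorem NE.conjOwn (f : Fin k → G) (B : Finset (Fin k)) {w : G}
    (hw : w ∈ Subgroup.closure (f '' {j | j ∈ B})) : NielsenEq f (cjB f B w) := by
  have key : ∀ y, NielsenEq (cjB f B y) (cjB f B (y * w)) := by
    induction hw using Subgroup.closure_induction with
    | mem z hz =>
      obtain ⟨s, hs, rfl⟩ := hz
      intro y
      have h1 := NE.conjB (cjB f B y) (B.erase s) (g := y * f s * y⁻¹)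
        (Subgroup.subset_closure ⟨s, by simp, by simp [cjB, show s ∈ B from hs]⟩)
      convert h1 using 1
      funext t
      by_cases ht : t ∈ B
      · by_cases hts : t = s
        · subst hts; simp [cjB, ht]
        · simp [cjB, ht, hts, mul_assoc]
      · simp [cjB, ht]
    | one => intro y; simp; exact NE.refl _
    | mul a b _ _ iha ihb =>
      intro y
      have := NE.trans (iha y) (ihb (y * a))
      rwa [mul_assoc] at this
    | inv a _ iha =>
      intro y
      have := NE.symm (iha (y * a⁻¹))
      simpa using this
  have := key 1
  have h1 : cjB f B 1 = f := by funext t; simp [cjB]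
  rwa [h1, one_mul] at this

theorem NE.kill (f : Fin k → G) (B : Finset (Fin k))
    (hB : ∀ t, f t ∈ Subgroup.closure (f '' {j | j ∈ B})) :
    NielsenEq f (fun t => if t ∈ B then f t else 1) := by
  have key : ∀ A : Finset (Fin k), Disjoint A B → NielsenEq f (fun t => if t ∈ A then 1 else f t) := by
    intro A
    induction A using Finset.induction_on with
    | empty => intro _; exact NE.refl f
    | insert a A ha ih =>
      intro hd
      rw [Finset.disjoint_insert_left] at hd
      have h1 := ih hd.2
      have hg : (f a)⁻¹ ∈ Subgroup.closure ((fun t => if t ∈ A then 1 else f t) '' {j | j ≠ a}) := by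
        refine Subgroup.closure_mono ?_ (inv_mem (hB a))
        rintro _ ⟨j, hj, rfl⟩
        refine ⟨j, fun h => hd.1 (h ▸ hj), ?_⟩
        have : j ∉ A := fun h => Finset.disjoint_left.1 hd.2 h hj
        simp [this]
      have := NE.trans h1 (NE.mulRight _ a hg)
      convert this using 1
      funext t
      by_cases ht : t = a
      · subst ht; simp [ha]
      · simp [ht]
  have := key (Finset.univ \ B) Finset.sdiff_disjoint
  convert this using 1
  funext t
  by_cases ht : t ∈ B <;> simp [ht]

theorem exists_front {l : ℕ} (B : Finset (Fin k)) (hB : l + 1 ≤ B.card) :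
    ∃ σ : Equiv.Perm (Fin k), ∀ i : Fin k, (i : ℕ) < l + 1 → σ i ∈ B := by
  classical
  have hk : l + 1 ≤ k := hB.trans (by simpa using B.card_le_univ)
  obtain ⟨B', hB', hc⟩ := Finset.exists_subset_card_eq hB
  have hcard : Fintype.card {i : Fin k // (i : ℕ) < l + 1} = Fintype.card {i : Fin k // i ∈ B'} := by
    rw [Fintype.card_coe, hc, Fintype.card_subtype]
    have : (Finset.univ.filter (fun i : Fin k => (i : ℕ) < l + 1)) =
        Finset.univ.map (Fin.castLEEmb hk) := by
      ext i
      simp only [Finset.mem_filter, Finset.mem_univ, true_and, Finset.mem_map]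
      constructor
      · intro h; exact ⟨⟨i, h⟩, rfl⟩
      · rintro ⟨j, rfl⟩; exact j.2
    rw [this]; simp
  let eq := Fintype.equivOfCardEq hcard
  refine ⟨eq.extendSubtype, fun i hi => hB' ?_⟩
  exact eq.extendSubtype_mem i hi
end nielsen
end KW

namespace KW
section top
variable {G : Type*} [Group G] {k l : ℕ} {D : G → G → ℕ} {e : ℕ}

/-- the set of indices of the block with label `i` -/
def blk {ι : Type*} [DecidableEq ι] (K : Finset (Fin k)) (c : Fin k → ι) (i : ι) : Finset (Fin k) :=
  Finset.univ.filter (fun t => t ∉ K ∧ c t = i)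

theorem mem_blk {ι : Type*} [DecidableEq ι] {K : Finset (Fin k)} {c : Fin k → ι} {i : ι}
    {t : Fin k} : t ∈ blk K c i ↔ t ∉ K ∧ c t = i := by simp [blk]

/-- the subgroup of a block -/
def Vb {ι : Type*} [DecidableEq ι] (f : Fin k → G) (K : Finset (Fin k)) (c : Fin k → ι) (i : ι) :
    Subgroup G := Subgroup.closure (f '' {t | t ∈ blk K c i})

theorem mem_Vb {ι : Type*} [DecidableEq ι] {f : Fin k → G} {K : Finset (Fin k)} {c : Fin k → ι}
    {t : Fin k} (ht : t ∉ K) : f t ∈ Vb f K c (c t) :=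
  Subgroup.subset_closure ⟨t, mem_blk.2 ⟨ht, rfl⟩, rfl⟩

/-- the states of the top level argument -/
structure St {ι : Type*} [DecidableEq ι] (D : G → G → ℕ) (C : ℕ) (fs : Fin k → G) (I : Finset ι)
    (K : Finset (Fin k)) (c : Fin k → ι) (s : Conf G ι (Fin k)) (f : Fin k → G) (x : ι → G) :
    Prop where
  ne : NielsenEq fs f
  bd : ∀ t, t ∉ K → D (x (c t)) (f t * x (c t)) ≤ C
  hV : ∀ i ∈ I, s.V i = Vb f K c i
  hA : ∀ i ∈ I, s.A i = {y | y * (x i)⁻¹ ∈ Vb f K c i}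
  hh : ∀ t ∈ K, s.h t = f t

variable {ι : Type*} [DecidableEq ι]

theorem St.gen_eq {C : ℕ} {fs : Fin k → G} {I : Finset ι} {K : Finset (Fin k)} {c : Fin k → ι}
    {s : Conf G ι (Fin k)} {f : Fin k → G} {x : ι → G} (hs : St D C fs I K c s f x)
    (hc : ∀ t, t ∉ K → c t ∈ I) : gen s I K = Subgroup.closure (Set.range fs) := by
  rw [← NE.closure hs.ne]
  apply le_antisymm
  · refine gen_le (fun i hi => ?_) (fun t ht => ?_)
    · rw [hs.hV i hi]
      exact Subgroup.closure_mono (Set.image_subset_range _ _)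
    · rw [hs.hh t ht]; exact Subgroup.subset_closure ⟨t, rfl⟩
  · rw [Subgroup.closure_le]
    rintro _ ⟨t, rfl⟩
    by_cases ht : t ∈ K
    · rw [← hs.hh t ht]; exact h_mem_gen ht
    · refine V_le_gen (hc t ht) ?_
      rw [hs.hV _ (hc t ht)]; exact mem_Vb ht

theorem closure_conj (g : G) (T : Set G) :
    cj g (Subgroup.closure T) = Subgroup.closure ((fun y => g * y * g⁻¹) '' T) := by
  unfold cj
  rw [MonoidHom.map_closure]; rfl

theorem Vb_cjB (f : Fin k → G) (K : Finset (Fin k)) (c : Fin k → ι) (i : ι) (g : G) :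
    Vb (cjB f (blk K c i) g) K c i = cj g (Vb f K c i) := by
  unfold Vb
  rw [closure_conj, Set.image_image]
  congr 1
  apply Set.image_congr
  intro t ht
  simp [cjB, show t ∈ blk K c i from ht]

theorem Vb_congr {f f' : Fin k → G} {K : Finset (Fin k)} {c : Fin k → ι} {i : ι}
    (h : ∀ t ∈ blk K c i, f' t = f t) : Vb f' K c i = Vb f K c i := by
  unfold Vb
  congr 1
  exact Set.image_congr h

variable (H : Hyp D e)
include H

theorem St_closed {C : ℕ} {fs : Fin k → G} {I : Finset ι} {K : Finset (Fin k)} {c : Fin k → ι} :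
    Closed {s | ∃ f x, St D C fs I K c s f x} I K := by
  rintro s ⟨f, x, hs⟩ s' hmove
  rcases hmove with ⟨i, hi, g, hg, q1, q2, q3, q4⟩ | ⟨t, ht, g, hg, q1, q2, q3⟩
  · have hg' : g ∈ Subgroup.closure (f '' {t | t ∉ blk K c i}) := by
      refine gen_le (fun j hj => ?_) (fun t ht => ?_) hg
      · obtain ⟨hji, hj⟩ := Finset.mem_erase.1 hj
        rw [hs.hV j hj]
        refine Subgroup.closure_mono (Set.image_mono ?_)
        intro t ht ht'
        exact hji ((mem_blk.1 ht).2.symm.trans (mem_blk.1 ht').2)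
      · rw [hs.hh t ht]
        exact Subgroup.subset_closure ⟨t, fun h => (mem_blk.1 h).1 ht, rfl⟩
    have hoff : ∀ j, j ≠ i → ∀ t ∈ blk K c j, cjB f (blk K c i) g t = f t := by
      intro j hj t ht
      have : t ∉ blk K c i := fun h => hj ((mem_blk.1 ht).2.symm.trans (mem_blk.1 h).2)
      simp [cjB, this]
    refine ⟨cjB f (blk K c i) g, Function.update x i (g * x i),
      hs.ne.trans (NE.conjB f _ hg'), ?_, ?_, ?_, ?_⟩
    · intro t ht
      have := hs.bd t ht
      by_cases h : c t = i
      · have htb : t ∈ blk K c i := mem_blk.2 ⟨ht, h⟩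
        rw [h] at this ⊢
        simp only [cjB, htb, if_true, Function.update_self]
        have e1 : g * f t * g⁻¹ * (g * x i) = g * (f t * x i) := by group
        rw [e1, H.inv]; exact this
      · rw [hoff (c t) h t (mem_blk.2 ⟨ht, rfl⟩), Function.update_of_ne h]; exact this
    · intro j hj
      by_cases h : j = i
      · subst h; rw [q1, hs.hV j hi, Vb_cjB]
      · rw [(q3 j hj h).1, hs.hV j hj, Vb_congr (hoff j h)]
    · intro j hj
      by_cases h : j = i
      · subst h; rw [q2, hs.hA j hi, Vb_cjB]
        ext y
        simp only [Function.update_self, Set.mem_setOf_eq, mem_tr, mem_cj]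
        have : g⁻¹ * (y * (g * x j)⁻¹) * g = g⁻¹ * y * (x j)⁻¹ := by group
        rw [this]
      · rw [(q3 j hj h).2, hs.hA j hj, Vb_congr (hoff j h), Function.update_of_ne h]
    · intro t ht
      have : t ∉ blk K c i := fun h => (mem_blk.1 h).1 ht
      rw [q4 t ht, hs.hh t ht]; simp [cjB, this]
  · have hg' : g ∈ Subgroup.closure (f '' {j | j ≠ t}) := by
      refine gen_le (fun j hj => ?_) (fun t' ht' => ?_) hg
      · rw [hs.hV j hj]
        refine Subgroup.closure_mono (Set.image_mono ?_)
        intro t' ht' h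
        exact (mem_blk.1 ht').1 (h ▸ ht)
      · obtain ⟨h1, h2⟩ := Finset.mem_erase.1 ht'
        rw [hs.hh t' h2]
        exact Subgroup.subset_closure ⟨t', h1, rfl⟩
    have hne : NielsenEq fs (Function.update f t (s'.h t)) := by
      refine hs.ne.trans ?_
      rcases q1 with q1 | q1
      · rw [q1, hs.hh t ht]; exact NE.mulLeft f t hg'
      · rw [q1, hs.hh t ht]; exact NE.mulRight f t hg'
    have hoff : ∀ t', t' ∉ K → Function.update f t (s'.h t) t' = f t' := by
      intro t' ht'
      rw [Function.update_of_ne]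
      rintro rfl; exact ht' ht
    have hVV : ∀ i, Vb (Function.update f t (s'.h t)) K c i = Vb f K c i := fun i =>
      Vb_congr (fun t' ht' => hoff t' (mem_blk.1 ht').1)
    refine ⟨Function.update f t (s'.h t), x, hne, ?_, ?_, ?_, ?_⟩
    · intro t' ht'; rw [hoff t' ht']; exact hs.bd t' ht'
    · intro i hi; rw [hVV, (q3 i hi).1, hs.hV i hi]
    · intro i hi; rw [hVV, (q3 i hi).2, hs.hA i hi]
    · intro t' ht'
      by_cases h : t' = t
      · subst h; simp
      · rw [q2 t' ht' h, hs.hh t' ht', Function.update_of_ne h]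

theorem Hyp.uniform_eps
    (hqc : ∀ T : Finset G, T.card ≤ l → ∃ ε, QC D ε (Subgroup.closure (T : Set G) : Set G)) (C : ℕ) :
    ∃ ε, ∀ T : Finset G, T.card ≤ l → (∀ y ∈ T, D 1 y ≤ C) →
      QC D ε (Subgroup.closure (T : Set G) : Set G) := by
  classical
  have hfin := H.ball C
  have hqc' : ∀ T : Finset G, ∃ ε, T.card ≤ l → QC D ε (Subgroup.closure (T : Set G) : Set G) := by
    intro T
    by_cases h : T.card ≤ l
    · obtain ⟨ε, hε⟩ := hqc T h; exact ⟨ε, fun _ => hε⟩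
    · exact ⟨0, fun h' => absurd h' h⟩
  choose E hE using hqc'
  refine ⟨hfin.toFinset.powerset.sup E, fun T hT hTC => ?_⟩
  refine H.qc_mono ?_ (hE T hT)
  refine Finset.le_sup (f := E) ?_
  rw [Finset.mem_powerset]
  intro y hy
  simpa using hTC y hy

theorem St.qc {C ε : ℕ} {fs : Fin k → G} {I : Finset ι} {K : Finset (Fin k)} {c : Fin k → ι}
    {s : Conf G ι (Fin k)} {f : Fin k → G} {x : ι → G} (hs : St D C fs I K c s f x)
    (hε : ∀ T : Finset G, T.card ≤ l → (∀ y ∈ T, D 1 y ≤ C) →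
      QC D ε (Subgroup.closure (T : Set G) : Set G)) {i : ι} (hi : i ∈ I)
    (hcard : (blk K c i).card ≤ l) : QC D ε (s.A i) := by
  classical
  have h1 := hε ((blk K c i).image (fun t => (x i)⁻¹ * f t * x i))
    (Finset.card_image_le.trans hcard) (by
      intro y hy
      obtain ⟨t, ht, rfl⟩ := Finset.mem_image.1 hy
      obtain ⟨h1, rfl⟩ := mem_blk.1 ht
      have := hs.bd t h1
      rw [← H.inv (x (c t))⁻¹] at this
      simpa [mul_assoc] using this)
  have h2 := H.qc_tr (x i) h1
  have h3 : s.A i = tr (x i) (Subgroup.closure (((blk K c i).image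
      (fun t => (x i)⁻¹ * f t * x i) : Finset G) : Set G) : Set G) := by
    have h4 : Subgroup.closure (((blk K c i).image
      (fun t => (x i)⁻¹ * f t * x i) : Finset G) : Set G) = cj (x i)⁻¹ (Vb f K c i) := by
      unfold Vb
      rw [closure_conj, Set.image_image, Finset.coe_image]
      simp only [inv_inv]
      rfl
    rw [h4, hs.hA i hi]
    ext y
    rw [mem_tr, SetLike.mem_coe, mem_cj, Set.mem_setOf_eq]
    have : (x i)⁻¹⁻¹ * ((x i)⁻¹ * y) * (x i)⁻¹ = y * (x i)⁻¹ := by group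
    rw [this]
  rw [h3]; exact h2
end top
end KW

namespace KW
section toplevel
variable {G : Type*} [Group G] {k l : ℕ} {D : G → G → ℕ} {e : ℕ}
variable (H : Hyp D e)
include H

theorem Hyp.top
    (hqc : ∀ T : Finset G, T.card ≤ l → ∃ ε, QC D ε (Subgroup.closure (T : Set G) : Set G)) (n : ℕ) :
    ∀ C : ℕ, ∃ C' : ℕ, ∀ (fs : Fin k → G) (I : Finset (Option (Fin k))) (K : Finset (Fin k))
      (c : Fin k → Option (Fin k)) (x : Option (Fin k) → G),
      2 * K.card + I.card ≤ n → I.Nonempty → (∀ t, t ∉ K → c t ∈ I) → (∀ t ∈ K, some t ∉ I) →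
      (∀ t, t ∉ K → D (x (c t)) (fs t * x (c t)) ≤ C) →
      FreelyIndecomposable (Subgroup.closure (Set.range fs)) →
      ¬ InfiniteCyclic (Subgroup.closure (Set.range fs)) →
      ∃ f, NielsenEq fs f ∧ ∃ g, ∀ i : Fin k, (i : ℕ) < l + 1 → D g (f i * g) ≤ C' := by
  induction n with
  | zero =>
    intro C
    refine ⟨0, fun fs I K c x hn hI => ?_⟩
    have := hI.card_pos; omega
  | succ n IH =>
    intro C
    obtain ⟨ε, hε⟩ := H.uniform_eps hqc C
    obtain ⟨M, hM⟩ := H.mainProp (ι := Option (Fin k)) (κ := Fin k) (n + 1) ε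
    obtain ⟨C1, hC1⟩ := IH (C + 2 * M)
    refine ⟨max C C1, fun fs I K c x hn hI hc hKI hbd hU hU' => ?_⟩
    have weaken : ∀ f : Fin k → G, NielsenEq fs f →
        (∃ f', NielsenEq f f' ∧ ∃ g, ∀ i : Fin k, (i : ℕ) < l + 1 → D g (f' i * g) ≤ C1) →
        ∃ f, NielsenEq fs f ∧ ∃ g, ∀ i : Fin k, (i : ℕ) < l + 1 → D g (f i * g) ≤ max C C1 := by
      rintro f hf ⟨f', hf', g, hg⟩
      exact ⟨f', NE.trans hf hf', g, fun i hi => (hg i hi).trans (le_max_right _ _)⟩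
    by_cases hbig : ∃ i ∈ I, l + 1 ≤ (blk K c i).card
    · obtain ⟨i, hi, hcard⟩ := hbig
      obtain ⟨σ, hσ⟩ := exists_front _ hcard
      refine ⟨fs ∘ σ, NE.perm σ fs, x i, fun j hj => ?_⟩
      obtain ⟨h1, h2⟩ := mem_blk.1 (hσ j hj)
      have := hbd (σ j) h1
      rw [h2] at this
      exact this.trans (le_max_left _ _)
    push Not at hbig
    set P : Set (Conf G (Option (Fin k)) (Fin k)) := {s | ∃ f x, St D C fs I K c s f x} with hPdef
    have hPne : P.Nonempty := ⟨⟨Vb fs K c, fun i => {y | y * (x i)⁻¹ ∈ Vb fs K c i}, fs⟩, fs, x,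
      NE.refl _, hbd, fun _ _ => rfl, fun _ _ => rfl, fun _ _ => rfl⟩
    by_cases hgood : ∀ s ∈ P, Good D ε M I K s ∧ gen s I K = Subgroup.closure (Set.range fs)
    · obtain ⟨s, ⟨f, y, hs⟩, i, hi, hV⟩ := hM P I K _ (by omega) hI hPne (St_closed H) hgood hU hU'
      have hall : ∀ t, f t ∈ Subgroup.closure (f '' {j | j ∈ blk K c i}) := by
        intro t
        have h1 : f t ∈ Subgroup.closure (Set.range f) := Subgroup.subset_closure ⟨t, rfl⟩
        rw [NE.closure hs.ne, ← hV, hs.hV i hi] at h1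
        exact h1
      refine ⟨_, NE.trans hs.ne (NE.kill f _ hall), y i, fun j _ => ?_⟩
      refine le_trans ?_ (le_max_left _ _)
      by_cases hj : j ∈ blk K c i
      · obtain ⟨h1, h2⟩ := mem_blk.1 hj
        have := hs.bd j h1
        rw [h2] at this
        simpa [hj] using this
      · simp [hj, H.self]
    · have hbad : ∃ s ∈ P, ¬ Good D ε M I K s := by
        by_contra hcon
        push Not at hcon
        refine hgood (fun s hs => ⟨hcon s hs, ?_⟩)
        obtain ⟨f, y, hs⟩ := hs
        exact hs.gen_eq hc
      obtain ⟨s, ⟨f, y, hs⟩, hnot⟩ := hbad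
      have hUf : FreelyIndecomposable (Subgroup.closure (Set.range f)) := by
        rw [NE.closure hs.ne]; exact hU
      have hUf' : ¬ InfiniteCyclic (Subgroup.closure (Set.range f)) := by
        rw [NE.closure hs.ne]; exact hU'
      have hfin : ∀ f' : Fin k → G, NielsenEq f f' → ∀ (I' : Finset (Option (Fin k)))
          (K' : Finset (Fin k)) (c' : Fin k → Option (Fin k)) (x' : Option (Fin k) → G),
          2 * K'.card + I'.card ≤ n → I'.Nonempty → (∀ t, t ∉ K' → c' t ∈ I') →
          (∀ t ∈ K', some t ∉ I') →
          (∀ t, t ∉ K' → D (x' (c' t)) (f' t * x' (c' t)) ≤ C + 2 * M) →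
          ∃ f, NielsenEq fs f ∧ ∃ g, ∀ i : Fin k, (i : ℕ) < l + 1 → D g (f i * g) ≤ max C C1 := by
        intro f' hf' I' K' c' x' h1 h2 h3 h4 h5
        refine weaken f' (NE.trans hs.ne hf') (hC1 f' I' K' c' x' h1 h2 h3 h4 h5 ?_ ?_)
        · rw [NE.closure hf']; exact hUf
        · rw [NE.closure hf']; exact hUf'
      by_cases hl1 : ∀ i ∈ I, ∀ j ∈ I, i ≠ j → ∀ a ∈ s.A i, ∀ b ∈ s.A j, M < D a b
      · by_cases hl2 : ∀ i ∈ I, ∀ t ∈ K, ∀ a ∈ s.A i, ∀ b ∈ s.A i, M < D a (s.h t * b)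
        · by_cases hl3 : ∀ t ∈ K, ∀ x, M < D x (s.h t * x)
          · exfalso
            refine hnot ⟨?_, ?_, ?_, hl1, hl2, hl3⟩
            · intro i hi
              rw [hs.hA i hi]
              refine ⟨y i, ?_⟩
              show y i * (y i)⁻¹ ∈ Vb f K c i
              rw [mul_inv_cancel]; exact one_mem _
            · intro i hi v hv z hz
              rw [hs.hA i hi] at hz ⊢
              rw [hs.hV i hi] at hv
              show v * z * (y i)⁻¹ ∈ Vb f K c i
              rw [mul_assoc]
              exact mul_mem hv hz
            · intro i hi
              exact hs.qc H hε hi (Nat.lt_succ_iff.1 (hbig i hi))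
          · push Not at hl3
            obtain ⟨t, ht, z, hz⟩ := hl3
            rw [hs.hh t ht] at hz
            refine hfin f (NE.refl f) (insert (some t) I) (K.erase t) (Function.update c t (some t))
              (Function.update y (some t) z) ?_ (Finset.insert_nonempty _ _) ?_ ?_ ?_
            · have h1 := Finset.card_erase_of_mem ht
              have h2 := Finset.card_insert_of_notMem (hKI t ht)
              have h3 := Finset.card_pos.2 ⟨t, ht⟩
              omega
            · intro t' ht'
              by_cases h : t' = t
              · subst h; simp
              · rw [Function.update_of_ne h]
                exact Finset.mem_insert_of_mem
                  (hc t' (fun h' => ht' (Finset.mem_erase.2 ⟨h, h'⟩)))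
            · intro t' ht' h
              obtain ⟨h1, h2⟩ := Finset.mem_erase.1 ht'
              rcases Finset.mem_insert.1 h with h | h
              · exact h1 (Option.some_injective _ h)
              · exact hKI t' h2 h
            · intro t' ht'
              by_cases h : t' = t
              · subst h; simp; omega
              · have hK' : t' ∉ K := fun h' => ht' (Finset.mem_erase.2 ⟨h, h'⟩)
                have h3 : c t' ≠ some t := fun h' => hKI t ht (h' ▸ hc t' hK')
                rw [Function.update_of_ne h, Function.update_of_ne h3]
                have := hs.bd t' hK'
                omega
        · push Not at hl2
          obtain ⟨i, hi, t, ht, a, ha, b, hb, hab⟩ := hl2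
          rw [hs.hA i hi] at ha hb
          rw [hs.hh t ht] at hab
          set v := a * (y i)⁻¹ with hv
          set w := b * (y i)⁻¹ with hw
          change v ∈ Vb f K c i at ha
          change w ∈ Vb f K c i at hb
          have ea : a = v * y i := by rw [hv]; group
          have eb : b = w * y i := by rw [hw]; group
          have hsub : Vb f K c i ≤ Subgroup.closure (f '' {j | j ≠ t}) := by
            refine Subgroup.closure_mono (Set.image_mono ?_)
            intro t' ht' h
            exact (mem_blk.1 ht').1 (h ▸ ht)
          have hn1 := NE.mulLeft f t (inv_mem (hsub ha))
          have him : Function.update f t (v⁻¹ * f t) '' {j | j ≠ t} = f '' {j | j ≠ t} :=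
            Set.image_congr (fun j hj => by simp [show j ≠ t from hj])
          have hn2 := NE.mulRight (Function.update f t (v⁻¹ * f t)) t (g := w)
            (by rw [him]; exact hsub hb)
          have hn3 := NE.trans hn1 hn2
          simp only [Function.update_self, Function.update_idem] at hn3
          refine hfin _ hn3 I (K.erase t) (Function.update c t i) y ?_ hI ?_ ?_ ?_
          · have h1 := Finset.card_erase_of_mem ht
            have h3 := Finset.card_pos.2 ⟨t, ht⟩
            omega
          · intro t' ht'
            by_cases h : t' = t
            · subst h; simpa using hi
            · rw [Function.update_of_ne h]
              exact hc t' (fun h' => ht' (Finset.mem_erase.2 ⟨h, h'⟩))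
          · intro t' ht'
            exact hKI t' (Finset.mem_of_mem_erase ht')
          · intro t' ht'
            by_cases h : t' = t
            · subst h
              simp only [Function.update_self]
              rw [ea, eb, ← H.inv v⁻¹] at hab
              have e1 : v⁻¹ * (v * y i) = y i := by group
              have e2 : v⁻¹ * (f t' * (w * y i)) = v⁻¹ * f t' * w * y i := by group
              rw [e1, e2] at hab
              omega
            · have hK' : t' ∉ K := fun h' => ht' (Finset.mem_erase.2 ⟨h, h'⟩)
              rw [Function.update_of_ne h, Function.update_of_ne h]
              have := hs.bd t' hK'
              omega
      · push Not at hl1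
        obtain ⟨i, hi, j, hj, hij, a, ha, b, hb, hab⟩ := hl1
        rw [hs.hA i hi] at ha
        rw [hs.hA j hj] at hb
        set v := a * (y i)⁻¹ with hv
        set w := b * (y j)⁻¹ with hw
        change v ∈ Vb f K c i at ha
        change w ∈ Vb f K c j at hb
        have ea : a = v * y i := by rw [hv]; group
        have eb : b = w * y j := by rw [hw]; group
        have hn1 := NE.conjOwn f (blk K c j) hb
        have hn2 := NE.conjB (cjB f (blk K c j) w) (blk K c j) (g := v⁻¹) (by
          refine inv_mem (Subgroup.closure_mono ?_ ha)
          rintro _ ⟨t, ht, rfl⟩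
          have : t ∉ blk K c j := fun h => hij ((mem_blk.1 ht).2.symm.trans (mem_blk.1 h).2)
          exact ⟨t, this, by simp [cjB, this]⟩)
        have hn3 := NE.trans hn1 hn2
        refine hfin _ hn3 (I.erase j) K (fun t => if c t = j then i else c t) y ?_
          ⟨i, Finset.mem_erase.2 ⟨hij, hi⟩⟩ ?_ ?_ ?_
        · have h1 := Finset.card_erase_of_mem hj
          have h3 := Finset.card_pos.2 ⟨j, hj⟩
          omega
        · intro t ht
          by_cases h : c t = j
          · simp only [h, if_true]; exact Finset.mem_erase.2 ⟨hij, hi⟩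
          · simp only [h, if_false]; exact Finset.mem_erase.2 ⟨h, hc t ht⟩
        · intro t ht h
          exact hKI t ht (Finset.mem_of_mem_erase h)
        · intro t ht
          have hb1 := hs.bd t ht
          by_cases h : c t = j
          · have hblk : t ∈ blk K c j := mem_blk.2 ⟨ht, h⟩
            rw [h] at hb1
            simp only [h, if_true, cjB, hblk]
            rw [ea, eb, ← H.inv v⁻¹] at hab
            have e1 : v⁻¹ * (v * y i) = y i := by group
            rw [e1, ← mul_assoc] at hab
            set p := v⁻¹ * w with hp
            have e2 : v⁻¹ * (w * f t * w⁻¹) * v⁻¹⁻¹ = p * f t * p⁻¹ := by rw [hp]; group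
            rw [e2]
            have t1 := H.tri (y i) (p * y j) (p * f t * p⁻¹ * y i)
            have t2 := H.tri (p * y j) (p * f t * p⁻¹ * (p * y j)) (p * f t * p⁻¹ * y i)
            rw [H.inv (p * f t * p⁻¹), H.symm (p * y j) (y i)] at t2
            have e3 : p * f t * p⁻¹ * (p * y j) = p * (f t * y j) := by group
            rw [e3, H.inv] at t2
            omega
          · have hblk : t ∉ blk K c j := fun h' => h (mem_blk.1 h').2
            simp only [h, if_false, cjB, hblk]
            omega
end toplevel
end KW

universe u v

namespace KW

open Pointwise Metric Set

theorem statement0 {G : Type u} {X : Type v} [Group G] [MetricSpace X] [MulAction G X]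
    (S : Finset G) (hgen : Subgroup.closure (S : Set G) = ⊤)
    (ι : G → X) (hCay : IsCayleyGraph G (S : Set G) X ι)
    (δ : ℝ) (hδ : DeltaHyperbolic δ X)
    (hATF : AlmostTorsionFree G)
    (l : ℕ) (hl : 1 ≤ l)
    (hqc : ∀ H : Subgroup G,
      (∃ T : Finset G, T.card ≤ l ∧ Subgroup.closure (T : Set G) = H) → QCSubgroup X ι H)
    (k : ℕ) (hk : l + 1 ≤ k) :
    ∃ C : ℝ, ∀ gs : Fin k → G,
      FreelyIndecomposable ↥(Subgroup.closure (Set.range gs)) →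
      ¬ InfiniteCyclic ↥(Subgroup.closure (Set.range gs)) →
      ∃ fs : Fin k → G, NielsenEq gs fs ∧
        ∃ g : G, ∀ i : Fin k, (i : ℕ) < l + 1 →
          (wordLength (S : Set G) (g⁻¹ * fs i * g) : ℝ) ≤ C := by
  obtain ⟨e, H⟩ := mkHyp hgen hCay hδ hATF
  have hqc' : ∀ T : Finset G, T.card ≤ l →
      ∃ ε, QC (wD (S : Set G)) ε (Subgroup.closure (T : Set G) : Set G) :=
    fun T hT => qc_of_QCSubgroup hCay (hqc _ ⟨T, hT, rfl⟩)
  obtain ⟨C', hC'⟩ := H.top (k := k) hqc' (2 * k + 1) 0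
  refine ⟨(C' : ℝ), fun gs hFI hIC => ?_⟩
  obtain ⟨f, hf, g, hg⟩ := hC' gs {none} Finset.univ (fun _ => none) (fun _ => 1)
    (by simp) (by simp) (by simp) (by simp) (by simp) hFI hIC
  refine ⟨f, hf, g, fun i hi => ?_⟩
  have h := hg i hi
  unfold wD at h
  rw [← mul_assoc] at h
  exact_mod_cast h

end KW
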